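/- Let D₁, D₂ be semilocal Prüfer domains of finite Krull dimension. Suppose there is an order isomorphism ν : hiSpec(D₁) → hiSpec(D₂) such that ω(P) = ω(ν(P)) for every P ∈ hiSpec(D₁). Then there are order isomorphisms 𝛎 : SStar(D₁) → SStar(D₂) and 𝛎_F : FStar(D₁) → FStar(D₂) such that 𝛎(SStar_Δ(D₁)) = SStar_{ν̄(Δ)}(D₂) for every Δ ⊆ SkOver(D₁) closed under intersections, where ν̄ : SkOver(D₁) → SkOver(D₂) is the order isomorphism of skeletons induced by ν. -/

import Mathlib

/- Common background: Prüfer domains, semistar and (fractional) star operations,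
standard decomposition, skeleton, supports, `hiSpec`, the rings `Z(P)`,
and the invariants `ω` and `ε`, following Spirito,
"Semistar operations on semilocal Prüfer domains". -/

set_option linter.unusedSectionVars false
set_option maxHeartbeats 1000000

open Pointwise

noncomputable section

namespace Paper

variable (D : Type*) [CommRing D] [IsDomain D]
variable (K : Type*) [Field K] [Algebra D K] [IsFractionRing D K]

/-- The localization of `D` at a prime ideal `P`, viewed as an overring of `D`
inside its quotient field `K`. -/
def locAt (P : Ideal D) (hP : P.IsPrime) : Subalgebra D K :=
  Localization.subalgebra K (@Ideal.primeCompl D _ P hP)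
    (fun _ hx => mem_nonZeroDivisors_of_ne_zero fun h => hx (h ▸ P.zero_mem))

/-- A Prüfer domain: every localization at a prime ideal is a valuation domain
(any two elements are comparable w.r.t. divisibility). -/
def IsPrufer : Prop :=
  ∀ (P : Ideal D) (hP : P.IsPrime), ∀ x y : locAt D K P hP, ∃ z, x * z = y ∨ y * z = x

/-- A semilocal ring: finitely many maximal ideals. -/
def IsSemilocal : Prop := {I : Ideal D | I.IsMaximal}.Finite

/-- Two ideals are dependent if some nonzero prime ideal is contained in both. -/
def Dependent (M N : Ideal D) : Prop :=
  ∃ P : Ideal D, P.IsPrime ∧ P ≠ ⊥ ∧ P ≤ M ∧ P ≤ N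

/-- The member of the standard decomposition corresponding to the dependence class
of the maximal ideal `M`: the intersection of the localizations of `D` at the
maximal ideals dependent on `M`. -/
def TOf (M : Ideal D) : Subalgebra D K :=
  sInf {A | ∃ (N : Ideal D) (hN : N.IsMaximal), Dependent D M N ∧ A = locAt D K N hN.isPrime}

/-- The standard decomposition of `D`. -/
def stdDecomp : Set (Subalgebra D K) :=
  {T | ∃ M : Ideal D, M.IsMaximal ∧ T = TOf D K M}

/-- The skeleton of `Over(D)`: all intersections of subsets of the standard
decomposition (including the empty intersection `K` and the total one `D`). -/
def SkOver : Set (Subalgebra D K) :=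
  {A | ∃ S ⊆ stdDecomp D K, A = sInf S}

/-- `I` is a fractional ideal of the overring `A` of `D`: it is an `A`-submodule
of `K` and `dI ⊆ A` for some nonzero `d ∈ K`. -/
def IsFracOf (A : Subalgebra D K) (I : Submodule D K) : Prop :=
  (∀ a ∈ A, ∀ x ∈ I, a * x ∈ I) ∧ ∃ d : K, d ≠ 0 ∧ ∀ x ∈ I, d * x ∈ A

end Paper

namespace Paper

/-- A semistar operation on a domain `R` with quotient field `K`: an extensive,
order-preserving, idempotent self-map of the set of `R`-submodules of `K` such
that `(xI)^⋆ = x·I^⋆` for every nonzero `x ∈ K`. -/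
structure Semistar (R : Type*) [CommRing R] (K : Type*) [Field K] [Algebra R K] where
  toFun : Submodule R K → Submodule R K
  le_star' : ∀ I, I ≤ toFun I
  mono' : ∀ ⦃I J⦄, I ≤ J → toFun I ≤ toFun J
  idem' : ∀ I, toFun (toFun I) = toFun I
  smul' : ∀ (x : K), x ≠ 0 → ∀ I,
    toFun (Submodule.span R {x} * I) = Submodule.span R {x} * toFun I

namespace Semistar

variable {R : Type*} [CommRing R] {K : Type*} [Field K] [Algebra R K]

theorem ext' {s t : Semistar R K} (h : s.toFun = t.toFun) : s = t := by
  cases s; cases t; cases h; rfl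

instance : PartialOrder (Semistar R K) where
  le s t := ∀ I, s.toFun I ≤ t.toFun I
  le_refl _ _ := le_rfl
  le_trans _ _ _ hab hbc I := (hab I).trans (hbc I)
  le_antisymm _ _ h h' := ext' (funext fun I => le_antisymm (h I) (h' I))

end Semistar

/-- The identity semistar operation `d`. -/
def dOp (R : Type*) [CommRing R] (K : Type*) [Field K] [Algebra R K] : Semistar R K where
  toFun I := I
  le_star' _ := le_rfl
  mono' _ _ h := h
  idem' _ := rfl
  smul' _ _ _ := rfl

end Paper

namespace Paper

variable (D : Type*) [CommRing D] [IsDomain D]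
variable (K : Type*) [Field K] [Algebra D K] [IsFractionRing D K]

/-- A fractional star operation on an overring `A` of `D` (inside `K`): a
semistar-like closure operation defined on the fractional ideals of `A`.
In particular `FracStar D K ⊥` is the set of fractional star operations on `D`. -/
structure FracStar (A : Subalgebra D K) where
  toFun : {I : Submodule D K // IsFracOf D K A I} → {I : Submodule D K // IsFracOf D K A I}
  le_star' : ∀ I, I.1 ≤ (toFun I).1
  mono' : ∀ I J, I.1 ≤ J.1 → (toFun I).1 ≤ (toFun J).1
  idem' : ∀ I, toFun (toFun I) = toFun I
  smul' : ∀ (x : K), x ≠ 0 → ∀ I J, J.1 = Submodule.span D {x} * I.1 →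
    (toFun J).1 = Submodule.span D {x} * (toFun I).1

namespace FracStar

variable {D K} {A : Subalgebra D K}

theorem ext' {s t : FracStar D K A} (h : s.toFun = t.toFun) : s = t := by
  cases s; cases t; cases h; rfl

instance : PartialOrder (FracStar D K A) where
  le s t := ∀ I, (s.toFun I).1 ≤ (t.toFun I).1
  le_refl _ _ := le_rfl
  le_trans _ _ _ hab hbc I := (hab I).trans (hbc I)
  le_antisymm _ _ h h' := ext' (funext fun I => Subtype.ext (le_antisymm (h I) (h' I)))

end FracStar

/-- A fractional star operation on the overring `A` is a *star operation* if it
closes `A` itself. -/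
def FracStar.IsStarOp {A : Subalgebra D K} (f : FracStar D K A) : Prop :=
  ∀ h : IsFracOf D K A (Subalgebra.toSubmodule A),
    (f.toFun ⟨Subalgebra.toSubmodule A, h⟩).1 = Subalgebra.toSubmodule A

/-- The support of a semistar operation on `D`: the elements `A` of the skeleton
such that `A^⋆` is a fractional ideal of `A`. -/
def supp (s : Semistar D K) : Set (Subalgebra D K) :=
  {A | A ∈ SkOver D K ∧ IsFracOf D K A (s.toFun (Subalgebra.toSubmodule A))}

/-- The image of an ideal of `D` inside `K`. -/
def idealToK (P : Ideal D) : Submodule D K := Submodule.map (Algebra.linearMap D K) P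

end Paper

namespace Paper

/-- An abstract fractional star operation on a commutative ring `A`, acting on
the fractional ideals of `A` inside its fraction ring. -/
structure AFracStar (A : Type*) [CommRing A] where
  toFun : FractionalIdeal (nonZeroDivisors A) (FractionRing A) →
    FractionalIdeal (nonZeroDivisors A) (FractionRing A)
  le_star' : ∀ I, I ≤ toFun I
  mono' : ∀ ⦃I J⦄, I ≤ J → toFun I ≤ toFun J
  idem' : ∀ I, toFun (toFun I) = toFun I
  smul' : ∀ (x : FractionRing A), x ≠ 0 → ∀ I,
    toFun (FractionalIdeal.spanSingleton (nonZeroDivisors A) x * I) =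
      FractionalIdeal.spanSingleton (nonZeroDivisors A) x * toFun I

namespace AFracStar

variable {A : Type*} [CommRing A]

theorem ext' {s t : AFracStar A} (h : s.toFun = t.toFun) : s = t := by
  cases s; cases t; cases h; rfl

instance : PartialOrder (AFracStar A) where
  le s t := ∀ I, s.toFun I ≤ t.toFun I
  le_refl _ _ := le_rfl
  le_trans _ _ _ hab hbc I := (hab I).trans (hbc I)
  le_antisymm _ _ h h' := ext' (funext fun I => le_antisymm (h I) (h' I))

end AFracStar

/-- Abstract star operations on `A`: fractional star operations closing `A`. -/
def AStar (A : Type*) [CommRing A] : Type _ := {s : AFracStar A // s.toFun 1 = 1}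

instance (A : Type*) [CommRing A] : PartialOrder (AStar A) :=
  inferInstanceAs (PartialOrder {s : AFracStar A // s.toFun 1 = 1})

end Paper

namespace Paper

variable (D : Type*) [CommRing D] [IsDomain D]

/-- `P` is a branching point of `Spec(D)`: the infimum (among the primes) of a
family of pairwise incomparable primes not containing `P`. -/
def IsBranchPoint (P : Ideal D) : Prop :=
  ∃ S : Set (Ideal D), (∀ Q ∈ S, Q.IsPrime) ∧
    (S.Pairwise fun Q₁ Q₂ => ¬Q₁ ≤ Q₂ ∧ ¬Q₂ ≤ Q₁) ∧ P ∉ S ∧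
    (∀ Q ∈ S, P ≤ Q) ∧ ∀ P' : Ideal D, P'.IsPrime → (∀ Q ∈ S, P' ≤ Q) → P' ≤ P

/-- The homeomorphically irreducible tree underlying `Spec(D)`: the zero ideal,
the maximal ideals and the branching points, ordered by inclusion. -/
def hiSpec : Set (Ideal D) :=
  {P | P.IsPrime ∧ (P = ⊥ ∨ P.IsMaximal ∨ IsBranchPoint D P)}

/-- `Q` is the element of `hiSpec D` directly below `P`. -/
def DirectlyBelow (Q P : Ideal D) : Prop :=
  Q ∈ hiSpec D ∧ P ∈ hiSpec D ∧ Q < P ∧ ∀ R ∈ hiSpec D, Q < R → ¬R < P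

/-- The localization of `D` at the prime ideal `P`, as an abstract ring. -/
abbrev locRing (P : Ideal D) (hP : P.IsPrime) : Type _ :=
  Localization (@Ideal.primeCompl D _ P hP)

/-- The valuation ring `Z(P) = D_P / Q·D_P`. -/
abbrev Zring (P Q : Ideal D) (hP : P.IsPrime) : Type _ :=
  locRing D P hP ⧸ Ideal.map (algebraMap D (locRing D P hP)) Q

/-- `ω(P) = |FStar(Z(P))|`, where `Q` is the element of `hiSpec D` directly
below `P`. -/
def omegaAt (P Q : Ideal D) (hP : P.IsPrime) : ℕ :=
  Nat.card (AFracStar (Zring D P Q hP))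

open Classical in
/-- `ε(P) = |Star(D_P)| ∈ {1,2}` for a (nonzero) prime `P`. -/
def epsilonOf (A : Ideal D) : ℕ :=
  if h : A.IsPrime then Nat.card (AStar (locRing D A h)) else 0

end Paper

namespace Paper

theorem mem_hiSpec_prime {D : Type*} [CommRing D] [IsDomain D] {P : Ideal D}
    (h : P ∈ hiSpec D) : P.IsPrime := h.1

theorem maximal_mem_hiSpec {D : Type*} [CommRing D] [IsDomain D] {M : Ideal D}
    (h : M.IsMaximal) : M ∈ hiSpec D := ⟨h.isPrime, Or.inr (Or.inl h)⟩

end Paper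

namespace Paper

section ClosureSystems

/-- A subset of a poset that is stable under a family of self-maps and under existing
infima of nonempty families. -/
structure IsInfSystem {X G : Type*} [PartialOrder X] (a : G → X → X) (C : Set X) : Prop where
  act : ∀ g, ∀ x ∈ C, a g x ∈ C
  glb : ∀ S ⊆ C, S.Nonempty → ∀ y, IsGLB S y → y ∈ C

variable {ι : Type*}

/-- The index sets on which a family of elements has no bottom entry. -/
def FamSupp {F : ι → Type*} [∀ i, PartialOrder (F i)] (c : Set ι → ∀ i, F i) : Set (Set ι) :=
  {S | ∀ i ∈ S, ¬ IsBot (c S i)}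

/-- The families that describe the inf-systems of a product of posets with top. -/
structure IsFam {F : ι → Type*} [∀ i, PartialOrder (F i)] (c : Set ι → ∀ i, F i) : Prop where
  bot : ∀ S, ∀ i ∉ S, IsBot (c S i)
  bot_of_bot : ∀ S, ∀ i ∈ S, ∀ j ∈ S, IsBot (c S i) → IsBot (c S j)
  union : ∀ S ∈ FamSupp c, ∀ S' ∈ FamSupp c, S ∪ S' ∈ FamSupp c
  mono : ∀ S, ∀ S' ∈ FamSupp c, S ⊆ S' → ∀ i ∈ S, c S i ≤ c S' i

theorem isBot_orderIso {A B : Type*} [PartialOrder A] [PartialOrder B] (e : A ≃o B) (x : A) :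
    IsBot (e x) ↔ IsBot x :=
  ⟨fun h y => e.le_iff_le.1 (h (e y)), fun h y => by
    rw [← e.apply_symm_apply y]; exact e.le_iff_le.2 (h _)⟩

theorem isTop_orderIso {A B : Type*} [PartialOrder A] [PartialOrder B] (e : A ≃o B) (x : A) :
    IsTop (e x) ↔ IsTop x :=
  ⟨fun h y => e.le_iff_le.1 (h (e y)), fun h y => by
    rw [← e.apply_symm_apply y]; exact e.le_iff_le.2 (h _)⟩

theorem famSupp_congr {F F' : ι → Type*} [∀ i, PartialOrder (F i)] [∀ i, PartialOrder (F' i)]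
    (e : ∀ i, F i ≃o F' i) (c : Set ι → ∀ i, F i) :
    FamSupp (fun S i => e i (c S i)) = FamSupp c := by
  ext S; simp only [FamSupp, Set.mem_ofPred_eq, isBot_orderIso]

theorem IsFam.congr {F F' : ι → Type*} [∀ i, PartialOrder (F i)] [∀ i, PartialOrder (F' i)]
    (e : ∀ i, F i ≃o F' i) {c : Set ι → ∀ i, F i} (h : IsFam c) :
    IsFam (fun S i => e i (c S i)) := by
  refine ⟨fun S i hi => ?_, fun S i hi j hj => ?_, ?_, ?_⟩
  · rw [isBot_orderIso]; exact h.bot S i hi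
  · rw [isBot_orderIso, isBot_orderIso]; exact h.bot_of_bot S i hi j hj
  · rw [famSupp_congr]; exact h.union
  · rw [famSupp_congr]; exact fun S S' hS' hh i hi => (e i).le_iff_le.2 (h.mono S S' hS' hh i hi)

/-- Isomorphic entries give isomorphic posets of families. -/
def famCongr {F F' : ι → Type*} [∀ i, PartialOrder (F i)] [∀ i, PartialOrder (F' i)]
    (e : ∀ i, F i ≃o F' i) :
    {c : Set ι → ∀ i, F i // IsFam c} ≃o {c : Set ι → ∀ i, F' i // IsFam c} where
  toFun c := ⟨fun S i => e i (c.1 S i), c.2.congr e⟩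
  invFun c := ⟨fun S i => (e i).symm (c.1 S i), c.2.congr fun i => (e i).symm⟩
  left_inv c := by ext; simp
  right_inv c := by ext; simp
  map_rel_iff' := by
    intro c c'
    constructor
    · intro h S i; exact (e i).le_iff_le.1 (h S i)
    · intro h S i; exact (e i).le_iff_le.2 (h S i)

section Product

variable {Z : ι → Type*} [∀ i, PartialOrder (Z i)] [∀ i, OrderTop (Z i)] {G : Type*}
  (a : ∀ i, G → Z i → Z i)

/-- The coordinates at which an element of a product is not the top. -/
def properSet (x : ∀ i, Z i) : Set ι := {i | x i ≠ ⊤}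

/-- The inf-systems of a poset that avoid the top. -/
abbrev ProperSystem {X : Type*} [PartialOrder X] [OrderTop X] (a : G → X → X) : Type _ :=
  {C : Set X // IsInfSystem a C ∧ ⊤ ∉ C}

theorem ProperSystem.isBot_iff {X : Type*} [PartialOrder X] [OrderTop X] {a : G → X → X}
    (C : ProperSystem a) : IsBot C ↔ C.1 = ∅ := by
  constructor
  · intro h
    have := h ⟨∅, ⟨⟨by simp, fun S hS hne => by
      rw [Set.subset_empty_iff.1 hS] at hne; simp at hne⟩, by simp⟩⟩
    exact Set.subset_empty_iff.1 this
  · intro h B x hx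
    rw [h] at hx; exact hx.elim

/-- Hypotheses on coordinatewise actions under which inf-systems of the product decompose. -/
structure IsPushing : Prop where
  top : ∀ i g z, a i g z = ⊤ ↔ z = ⊤
  inf : ∀ i (z w : Z i), ∃ u, IsGLB {z, w} u
  push : ∀ i (z w : Z i), (z = ⊤ → w = ⊤) → ∃ g, z ≤ a i g w
  push_others : ∀ i (x y : ∀ j, Z j), (∀ j, y j = ⊤ → x j = ⊤) →
    ∃ g, (∀ z, a i g z = z) ∧ ∀ j ≠ i, y j ≤ a j g (x j)

variable {a}

/-- The coordinatewise action on a product. -/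
def piAct (a : ∀ i, G → Z i → Z i) (g : G) (x : ∀ i, Z i) : ∀ i, Z i := fun i => a i g (x i)

theorem IsPushing.properSet_act (h : IsPushing a) (g : G) (x : ∀ i, Z i) :
    properSet (piAct a g x) = properSet x := by
  ext i; simp [properSet, piAct, h.top]

/-- A system of the product contains every element all of whose proper coordinates are
attained by members with the same proper coordinates. -/
theorem IsPushing.mem_of_coord (h : IsPushing a) {C : Set (∀ i, Z i)}
    (hC : IsInfSystem (piAct a) C) (htop : ⊤ ∈ C) (x : ∀ i, Z i)
    (hx : ∀ i ∈ properSet x, ∃ y ∈ C, properSet y = properSet x ∧ y i = x i) : x ∈ C := by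
  rcases (properSet x).eq_empty_or_nonempty with he | ⟨i₀, hi₀⟩
  · have : x = ⊤ := by
      funext i
      by_contra hi
      have : i ∈ properSet x := hi
      rw [he] at this; exact this
    rwa [this]
  choose! y hyC hyp hyi using hx
  have hg : ∀ i ∈ properSet x, ∃ g, (∀ z, a i g z = z) ∧ ∀ j ≠ i, x j ≤ a j g (y i j) := by
    intro i hi
    refine h.push_others i (y i) x fun j hj => ?_
    by_contra hh
    have : j ∈ properSet (y i) := hh
    rw [hyp i hi] at this; exact this hj
  have : Nonempty G := ⟨(hg i₀ hi₀).choose⟩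
  choose! g hg1 hg2 using hg
  refine hC.glb ((fun i => piAct a (g i) (y i)) '' properSet x) ?_ ⟨_, i₀, hi₀, rfl⟩ x ⟨?_, ?_⟩
  · rintro _ ⟨i, hi, rfl⟩; exact hC.act _ _ (hyC i hi)
  · rintro _ ⟨i, hi, rfl⟩ j
    by_cases hj : j = i
    · subst hj; simp only [piAct]; rw [hg1 j hi, hyi j hi]
    · exact hg2 i hi j hj
  · intro b hb j
    by_cases hj : j ∈ properSet x
    · have := hb ⟨j, hj, rfl⟩ j
      simp only [piAct] at this
      rwa [hg1 j hj, hyi j hj] at this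
    · have : x j = ⊤ := not_not.1 hj
      rw [this]; exact le_top

/-- The coordinates at `i` of the members of `C` with proper coordinates `S`. -/
def coordSet (C : Set (∀ i, Z i)) (S : Set ι) (i : ι) : Set (Z i) :=
  {z | i ∈ S ∧ ∃ x ∈ C, properSet x = S ∧ x i = z}

open Classical in
theorem properSet_update {x : ∀ i, Z i} {i : ι} {z : Z i} (hi : i ∈ properSet x) (hz : z ≠ ⊤) :
    properSet (Function.update x i z) = properSet x := by
  ext j
  by_cases hj : j = i
  · subst hj; simpa [properSet, hz] using hi
  · simp [properSet, hj]

open Classical in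
theorem IsPushing.update_mem (h : IsPushing a) {C : Set (∀ i, Z i)}
    (hC : IsInfSystem (piAct a) C) (htop : ⊤ ∈ C) {x : ∀ i, Z i} (hx : x ∈ C) {i : ι} {z : Z i}
    (hz : z ∈ coordSet C (properSet x) i) : Function.update x i z ∈ C := by
  obtain ⟨hi, y, hy, hyp, rfl⟩ := hz
  have hyi : y i ≠ ⊤ := by
    have : i ∈ properSet y := by rwa [hyp]
    exact this
  refine h.mem_of_coord hC htop _ fun j hj => ?_
  rw [properSet_update hi hyi] at hj ⊢
  by_cases hji : j = i
  · subst hji; exact ⟨y, hy, hyp, by simp⟩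
  · exact ⟨x, hx, rfl, by simp [hji]⟩

open Classical in
theorem isGLB_image_update (x : ∀ i, Z i) (i : ι) {T : Set (Z i)} (hT : T.Nonempty) {z : Z i}
    (hz : IsGLB T z) : IsGLB (Function.update x i '' T) (Function.update x i z) := by
  constructor
  · rintro _ ⟨w, hw, rfl⟩
    exact Function.update_mono (hz.1 hw)
  · intro b hb j
    by_cases hj : j = i
    · subst hj
      simp only [Function.update_self]
      exact hz.2 fun w hw => by simpa using hb ⟨w, hw, rfl⟩ j
    · obtain ⟨w, hw⟩ := hT
      have := hb ⟨w, hw, rfl⟩ j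
      simpa [hj] using this

theorem IsPushing.coordSet_system (h : IsPushing a) {C : Set (∀ i, Z i)}
    (hC : IsInfSystem (piAct a) C) (htop : ⊤ ∈ C) (S : Set ι) (i : ι) :
    IsInfSystem (a i) (coordSet C S i) ∧ ⊤ ∉ coordSet C S i := by
  classical
  have hnt : ∀ z ∈ coordSet C S i, z ≠ ⊤ := by
    rintro z ⟨hi, x, hx, rfl, rfl⟩; exact hi
  refine ⟨⟨?_, ?_⟩, fun hh => hnt _ hh rfl⟩
  · rintro g z ⟨hi, x, hx, hS, rfl⟩
    exact ⟨hi, piAct a g x, hC.act _ _ hx, by rw [h.properSet_act, hS], rfl⟩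
  · rintro T hT hne z hz
    obtain ⟨w, hw⟩ := hne
    have hzt : z ≠ ⊤ := fun hh => hnt w (hT hw) (top_le_iff.1 (hh ▸ hz.1 hw))
    obtain ⟨hi, x, hx, rfl, rfl⟩ := hT hw
    refine ⟨hi, Function.update x i z, ?_, properSet_update hi hzt, by simp⟩
    refine hC.glb (Function.update x i '' T) ?_ ⟨_, _, hw, rfl⟩ _ (isGLB_image_update x i ⟨_, hw⟩ hz)
    rintro _ ⟨u, hu, rfl⟩
    exact h.update_mem hC htop hx (hT hu)

theorem IsPushing.exists_inf (h : IsPushing a) (x y : ∀ i, Z i) :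
    ∃ u, IsGLB {x, y} u ∧ (∀ i, IsGLB {x i, y i} (u i)) ∧
      properSet u = properSet x ∪ properSet y := by
  choose u hu using fun i => h.inf i (x i) (y i)
  refine ⟨u, ⟨?_, ?_⟩, hu, ?_⟩
  · rintro _ (rfl | rfl) i
    · exact (hu i).1 (by simp)
    · exact (hu i).1 (by simp)
  · intro b hb i
    refine (hu i).2 ?_
    rintro _ (rfl | rfl)
    · exact hb (by simp) i
    · exact hb (by simp) i
  · ext i
    simp only [properSet, Set.mem_ofPred_eq, Set.mem_union, ← not_and_or, not_iff_not, ne_eq]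
    constructor
    · intro hi
      have := (hu i).1
      rw [hi] at this
      exact ⟨top_le_iff.1 (this (by simp)), top_le_iff.1 (this (by simp))⟩
    · rintro ⟨h1, h2⟩
      refine top_le_iff.1 ((hu i).2 ?_)
      rintro _ (rfl | rfl) <;> simp [h1, h2]

theorem coordSet_nonempty_iff (C : Set (∀ i, Z i)) (htop : ⊤ ∈ C) (S : Set ι) :
    (∀ i ∈ S, (coordSet C S i).Nonempty) ↔ ∃ x ∈ C, properSet x = S := by
  constructor
  · intro h
    rcases S.eq_empty_or_nonempty with rfl | ⟨i, hi⟩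
    · exact ⟨⊤, htop, by ext; simp [properSet]⟩
    · obtain ⟨_, _, x, hx, hS, _⟩ := h i hi
      exact ⟨x, hx, hS⟩
  · rintro ⟨x, hx, hS⟩ i hi
    exact ⟨x i, hi, x, hx, hS, rfl⟩

/-- The family of coordinate systems of an inf-system of the product. -/
def IsPushing.fam (h : IsPushing a)
    (C : {C : Set (∀ i, Z i) // IsInfSystem (piAct a) C ∧ ⊤ ∈ C}) (S : Set ι) (i : ι) :
    ProperSystem (a i) := ⟨coordSet C.1 S i, h.coordSet_system C.2.1 C.2.2 S i⟩

theorem IsPushing.mem_famSupp (h : IsPushing a)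
    (C : {C : Set (∀ i, Z i) // IsInfSystem (piAct a) C ∧ ⊤ ∈ C}) (S : Set ι) :
    S ∈ FamSupp (h.fam C) ↔ ∃ x ∈ C.1, properSet x = S := by
  rw [← coordSet_nonempty_iff C.1 C.2.2 S]
  simp only [FamSupp, Set.mem_ofPred_eq, ProperSystem.isBot_iff, ← Set.nonempty_iff_ne_empty,
    IsPushing.fam, ← ne_eq]

theorem IsPushing.isFam (h : IsPushing a)
    (C : {C : Set (∀ i, Z i) // IsInfSystem (piAct a) C ∧ ⊤ ∈ C}) : IsFam (h.fam C) := by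
  refine ⟨?_, ?_, ?_, ?_⟩
  · intro S i hi
    rw [ProperSystem.isBot_iff]
    ext z; simp [IsPushing.fam, coordSet, hi]
  · intro S i hi j hj
    rw [ProperSystem.isBot_iff, ProperSystem.isBot_iff]
    intro he
    by_contra hne
    obtain ⟨z, _, x, hx, hS, _⟩ := Set.nonempty_iff_ne_empty.2 hne
    have : x i ∈ (h.fam C S i).1 := ⟨hi, x, hx, hS, rfl⟩
    rw [he] at this; exact this
  · intro S hS S' hS'
    rw [h.mem_famSupp] at hS hS' ⊢
    obtain ⟨x, hx, rfl⟩ := hS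
    obtain ⟨y, hy, rfl⟩ := hS'
    obtain ⟨u, hu, -, hup⟩ := h.exists_inf x y
    refine ⟨u, C.2.1.glb {x, y} ?_ (by simp) u hu, hup⟩
    rintro _ (rfl | rfl) <;> assumption
  · rintro S S' hS' hSS i hi z ⟨_, x, hx, rfl, rfl⟩
    rw [h.mem_famSupp] at hS'
    obtain ⟨y, hy, rfl⟩ := hS'
    obtain ⟨g, hg⟩ := h.push i (x i) (y i) fun hh => (hi hh).elim
    obtain ⟨u, hu, hui, hup⟩ := h.exists_inf x (piAct a g y)
    refine ⟨hSS hi, u, C.2.1.glb {x, piAct a g y} ?_ (by simp) u hu, ?_, ?_⟩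
    · rintro _ (rfl | rfl)
      · exact hx
      · exact C.2.1.act _ _ hy
    · rw [hup, h.properSet_act]; exact Set.union_eq_self_of_subset_left hSS
    · refine (hui i).unique ⟨?_, ?_⟩
      · rintro _ (rfl | rfl)
        · exact le_rfl
        · exact hg
      · exact fun b hb => hb (by simp)

/-- The inf-system of the product described by a family. -/
def ofFam (c : Set ι → ∀ i, ProperSystem (a i)) : Set (∀ i, Z i) :=
  {x | ∀ i ∈ properSet x, x i ∈ (c (properSet x) i).1}

theorem sUnion_mem_of_finite {𝒟 E : Set (Set ι)} (hE : E.Finite)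
    (hu : ∀ S ∈ 𝒟, ∀ S' ∈ 𝒟, S ∪ S' ∈ 𝒟) (h0 : ∅ ∈ 𝒟) (hsub : E ⊆ 𝒟) : ⋃₀ E ∈ 𝒟 := by
  induction E, hE using Set.Finite.induction_on with
  | empty => simpa using h0
  | insert _ _ ih =>
    rw [Set.sUnion_insert]
    exact hu _ (hsub (by simp)) _ (ih fun s hs => hsub (by simp [hs]))

theorem IsPushing.ofFam_system [Finite ι] (h : IsPushing a) {c : Set ι → ∀ i, ProperSystem (a i)}
    (hc : IsFam c) : IsInfSystem (piAct a) (ofFam c) ∧ ⊤ ∈ ofFam c := by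
  have hsupp : ∀ x ∈ ofFam c, properSet x ∈ FamSupp c := by
    intro x hx i hi
    rw [ProperSystem.isBot_iff]
    exact Set.Nonempty.ne_empty ⟨_, hx i hi⟩
  refine ⟨⟨?_, ?_⟩, ?_⟩
  · intro g x hx i hi
    rw [h.properSet_act] at hi ⊢
    exact (c _ i).2.1.act g _ (hx i hi)
  · intro T hT hne y hy
    have hyi : ∀ i, IsGLB (Function.eval i '' T) (y i) := fun i => (isGLB_pi.1 hy) i
    have hp : properSet y = ⋃₀ (properSet '' T) := by
      ext i
      simp only [Set.sUnion_image, Set.mem_iUnion, exists_prop]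
      constructor
      · intro hi
        by_contra hcon
        push Not at hcon
        apply hi
        refine top_le_iff.1 ((hyi i).2 ?_)
        rintro _ ⟨x, hx, rfl⟩
        exact (not_not.1 (hcon x hx) : x i = ⊤) ▸ le_rfl
      · rintro ⟨x, hx, hi⟩ hh
        exact hi (top_le_iff.1 (hh ▸ (hyi i).1 ⟨x, hx, rfl⟩))
    have hyS : properSet y ∈ FamSupp c := by
      rw [hp]
      refine sUnion_mem_of_finite (Set.toFinite _) hc.union (by simp [FamSupp]) ?_
      rintro _ ⟨x, hx, rfl⟩; exact hsupp x (hT hx)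
    intro i hi
    have hle : ∀ x ∈ T, properSet x ⊆ properSet y := by
      intro x hx; rw [hp]; exact Set.subset_sUnion_of_mem ⟨x, hx, rfl⟩
    refine (c (properSet y) i).2.1.glb (Function.eval i '' {x ∈ T | i ∈ properSet x}) ?_ ?_ _ ⟨?_, ?_⟩
    · rintro _ ⟨x, ⟨hx, hxi⟩, rfl⟩
      exact hc.mono _ _ hyS (hle x hx) i hxi (hT hx i hxi)
    · rw [hp] at hi
      obtain ⟨_, ⟨x, hx, rfl⟩, hxi⟩ := hi
      exact ⟨_, x, ⟨hx, hxi⟩, rfl⟩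
    · rintro _ ⟨x, ⟨hx, hxi⟩, rfl⟩
      exact (hyi i).1 ⟨x, hx, rfl⟩
    · intro b hb
      refine (hyi i).2 ?_
      rintro _ ⟨x, hx, rfl⟩
      by_cases hxi : i ∈ properSet x
      · exact hb ⟨x, ⟨hx, hxi⟩, rfl⟩
      · exact le_top.trans_eq (not_not.1 hxi : x i = ⊤).symm
  · intro i hi; simp [properSet] at hi

open Classical in
/-- Inf-systems of a product containing the top correspond to compatible families of
inf-systems of the factors. -/
def IsPushing.orderIso [Finite ι] (h : IsPushing a) :
    {C : Set (∀ i, Z i) // IsInfSystem (piAct a) C ∧ ⊤ ∈ C} ≃o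
      {c : Set ι → ∀ i, ProperSystem (a i) // IsFam c} where
  toFun C := ⟨h.fam C, h.isFam C⟩
  invFun c := ⟨ofFam c.1, h.ofFam_system c.2⟩
  left_inv C := by
    apply Subtype.ext
    ext x
    constructor
    · intro hx
      refine h.mem_of_coord C.2.1 C.2.2 x fun i hi => ?_
      obtain ⟨_, y, hy, hyp, hyi⟩ := hx i hi
      exact ⟨y, hy, hyp, hyi⟩
    · intro hx i hi
      exact ⟨hi, x, hx, rfl, rfl⟩
  right_inv c := by
    apply Subtype.ext
    funext S i
    apply Subtype.ext
    ext z
    constructor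
    · rintro ⟨hi, x, hx, rfl, rfl⟩
      exact hx i hi
    · intro hz
      have hi : i ∈ S := by
        by_contra hi
        have := c.2.bot S i hi
        rw [ProperSystem.isBot_iff] at this
        rw [this] at hz; exact hz
      have hne : ∀ j ∈ S, ∃ w, w ∈ (c.1 S j).1 := by
        intro j hj
        apply Set.nonempty_iff_ne_empty.2
        intro he
        have := c.2.bot_of_bot S j hj i hi ((ProperSystem.isBot_iff _).2 he)
        rw [ProperSystem.isBot_iff] at this
        rw [this] at hz; exact hz
      choose! w hw using hne
      have hmem : ∀ j ∈ S, Function.update w i z j ∈ (c.1 S j).1 := by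
        intro j hj
        by_cases hji : j = i
        · subst hji; simpa using hz
        · simpa [hji] using hw j hj
      let x : ∀ j, Z j := fun j => if j ∈ S then Function.update w i z j else ⊤
      have hxS : ∀ j ∈ S, x j = Function.update w i z j := fun j hj => by simp [x, hj]
      have hxp : properSet x = S := by
        ext j
        by_cases hj : j ∈ S
        · simp only [hj, iff_true]
          intro hh
          rw [hxS j hj] at hh
          exact (c.1 S j).2.2 (Set.mem_of_eq_of_mem hh.symm (hmem j hj))
        · simp [properSet, x, hj]
      refine ⟨hi, x, ?_, hxp, by rw [hxS i hi]; simp⟩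
      intro j hj
      rw [hxp] at hj ⊢
      rw [hxS j hj]; exact hmem j hj
  map_rel_iff' := by
    intro C C'
    constructor
    · intro hle x hx
      refine h.mem_of_coord C'.2.1 C'.2.2 x fun i hi => ?_
      obtain ⟨_, y, hy, hyp, hyi⟩ := hle (properSet x) i ⟨hi, x, hx, rfl, rfl⟩
      exact ⟨y, hy, hyp, hyi⟩
    · rintro hle S i z ⟨hi, x, hx, hS, rfl⟩
      exact ⟨hi, x, hle hx, hS, rfl⟩

end Product
end ClosureSystems
end Paper

namespace Paper

section Local

variable {D : Type*} [CommRing D]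

/-- The elements of `D` lying in none of the primes of `W`. -/
def avoid (W : Set (Ideal D)) : Submonoid D where
  carrier := {s | ∀ N ∈ W, N.IsPrime → s ∉ N}
  one_mem' N _ hN h := hN.ne_top ((Ideal.eq_top_iff_one N).2 h)
  mul_mem' ha hb N hN hp h := (hp.mem_or_mem h).elim (ha N hN hp) (hb N hN hp)

theorem mem_avoid_singleton {P : Ideal D} (hP : P.IsPrime) {s : D} : s ∈ avoid {P} ↔ s ∉ P :=
  ⟨fun h => h P rfl hP, fun h N hN _ => by rwa [Set.mem_singleton_iff.1 hN]⟩

variable {K : Type*} [Field K] [Algebra D K]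

/-- The localization of a submodule of `K` away from the primes of `W`. -/
def loc (W : Set (Ideal D)) (I : Submodule D K) : Submodule D K where
  carrier := {x | ∃ s ∈ avoid W, s • x ∈ I}
  zero_mem' := ⟨1, one_mem _, by simp⟩
  add_mem' := by
    rintro x y ⟨s, hs, hx⟩ ⟨t, ht, hy⟩
    refine ⟨s * t, mul_mem hs ht, ?_⟩
    rw [smul_add]
    refine add_mem ?_ ?_
    · rw [mul_comm, mul_smul]; exact I.smul_mem _ hx
    · rw [mul_smul]; exact I.smul_mem _ hy
  smul_mem' := by
    rintro r x ⟨s, hs, hx⟩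
    exact ⟨s, hs, by rw [smul_comm]; exact I.smul_mem _ hx⟩

variable {W : Set (Ideal D)} {I J : Submodule D K}

theorem mem_loc {x : K} : x ∈ loc W I ↔ ∃ s ∈ avoid W, s • x ∈ I := Iff.rfl

theorem le_loc (W : Set (Ideal D)) (I : Submodule D K) : I ≤ loc W I :=
  fun x hx => ⟨1, one_mem _, by simpa⟩

theorem loc_mono (h : I ≤ J) : loc W I ≤ loc W J := fun _ ⟨s, hs, hx⟩ => ⟨s, hs, h hx⟩

theorem loc_loc_le (W : Set (Ideal D)) (I : Submodule D K) : loc W (loc W I) ≤ loc W I := by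
  rintro x ⟨s, hs, t, ht, hx⟩
  exact ⟨t * s, mul_mem ht hs, by rwa [mul_smul]⟩

theorem avoid_le {V W : Set (Ideal D)} (h : ∀ N ∈ V, N.IsPrime → ∃ M ∈ W, M.IsPrime ∧ N ≤ M) :
    avoid W ≤ avoid V := by
  intro s hs N hN hp hsN
  obtain ⟨M, hM, hMp, hNM⟩ := h N hN hp
  exact hs M hM hMp (hNM hsN)

theorem loc_le_loc {V W : Set (Ideal D)} (h : avoid W ≤ avoid V) (I : Submodule D K) :
    loc W I ≤ loc V I := fun _ ⟨s, hs, hx⟩ => ⟨s, h hs, hx⟩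

theorem loc_sInf_le {S : Set (Submodule D K)} (h : ∀ I ∈ S, loc W I ≤ I) :
    loc W (sInf S) ≤ sInf S :=
  le_sInf fun I hI => (loc_mono (sInf_le hI)).trans (h I hI)

/-- The multiple of a submodule of `K` by a scalar. -/
abbrev sc (g : K) (I : Submodule D K) : Submodule D K := Submodule.span D {g} * I

theorem mem_sc {g : K} (hg : g ≠ 0) {x : K} : x ∈ sc g I ↔ g⁻¹ * x ∈ I := by
  rw [Submodule.mem_span_singleton_mul]
  constructor
  · rintro ⟨z, hz, rfl⟩
    rwa [inv_mul_cancel_left₀ hg]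
  · intro h
    exact ⟨_, h, mul_inv_cancel_left₀ hg x⟩

theorem mul_mem_sc {g : K} {x : K} (hx : x ∈ I) : g * x ∈ sc g I :=
  Submodule.mem_span_singleton_mul.2 ⟨x, hx, rfl⟩

theorem sc_mono (g : K) (h : I ≤ J) : sc g I ≤ sc g J := mul_le_mul_right h _

theorem sc_one (I : Submodule D K) : sc 1 I = I := by
  ext x; rw [mem_sc one_ne_zero]; simp

theorem sc_sc {g h : K} (I : Submodule D K) : sc g (sc h I) = sc (g * h) I := by
  rw [sc, sc, sc, ← mul_assoc, Submodule.span_mul_span, Set.singleton_mul_singleton]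

theorem sc_inv_sc {g : K} (hg : g ≠ 0) (I : Submodule D K) : sc g⁻¹ (sc g I) = I := by
  rw [sc_sc, inv_mul_cancel₀ hg, sc_one]

theorem sc_sc_inv {g : K} (hg : g ≠ 0) (I : Submodule D K) : sc g (sc g⁻¹ I) = I := by
  rw [sc_sc, mul_inv_cancel₀ hg, sc_one]

theorem sc_le_iff {g : K} (hg : g ≠ 0) : sc g I ≤ J ↔ I ≤ sc g⁻¹ J :=
  ⟨fun h => by have := sc_mono g⁻¹ h; rwa [sc_inv_sc hg] at this,
    fun h => by have := sc_mono g h; rwa [sc_sc_inv hg] at this⟩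

theorem le_sc_iff {g : K} (hg : g ≠ 0) : I ≤ sc g J ↔ sc g⁻¹ I ≤ J := by
  rw [sc_le_iff (inv_ne_zero hg), inv_inv]

theorem sc_le_sc_iff {g : K} (hg : g ≠ 0) : sc g I ≤ sc g J ↔ I ≤ J := by
  rw [sc_le_iff hg, sc_inv_sc hg]

theorem sc_lt_sc_iff {g : K} (hg : g ≠ 0) : sc g I < sc g J ↔ I < J := by
  rw [lt_iff_le_not_ge, lt_iff_le_not_ge, sc_le_sc_iff hg, sc_le_sc_iff hg]

theorem sc_sInf {g : K} (hg : g ≠ 0) (S : Set (Submodule D K)) :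
    sc g (sInf S) = sInf (sc g '' S) := by
  ext x
  simp [mem_sc hg, Submodule.mem_sInf]

theorem loc_sc {g : K} (hg : g ≠ 0) : loc W (sc g I) = sc g (loc W I) := by
  ext x
  simp only [mem_loc, mem_sc hg, mul_smul_comm]

theorem loc_sc_le {g : K} (hg : g ≠ 0) (h : loc W I ≤ I) : loc W (sc g I) ≤ sc g I := by
  rw [loc_sc hg]; exact sc_mono g h

end Local

section Valuation

variable {D : Type*} [CommRing D] [IsDomain D] {K : Type*} [Field K] [Algebra D K]
  [IsFractionRing D K]

local notation "α" => algebraMap D K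

theorem map_ne_zero_of_notMem {P : Ideal D} {s : D} (hs : s ∉ P) : α s ≠ 0 := by
  intro h
  rw [map_eq_zero_iff _ (IsFractionRing.injective D K)] at h
  exact hs (h ▸ P.zero_mem)

variable (K) in
/-- The localization of `D` at `P`, as a submodule of `K`. -/
def ringAt (P : Ideal D) : Submodule D K := loc {P} 1

variable (K) in
/-- The maximal ideal of the localization of `D` at `P`, as a submodule of `K`. -/
def maxAt (P : Ideal D) : Submodule D K := loc {P} (idealToK D K P)

variable (K) in
/-- The units of the localization of `D` at `P`. -/
def unitAt (P : Ideal D) : Set K := {g | ∃ a b : D, a ∉ P ∧ b ∉ P ∧ g = α a / α b}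

variable {P Q : Ideal D}

theorem mem_ringAt (hP : P.IsPrime) {x : K} :
    x ∈ ringAt K P ↔ ∃ a s : D, s ∉ P ∧ x = α a / α s := by
  simp only [ringAt, mem_loc, mem_avoid_singleton hP, Submodule.mem_one, Algebra.smul_def]
  constructor
  · rintro ⟨s, hs, a, ha⟩
    exact ⟨a, s, hs, by rw [ha, mul_div_cancel_left₀ _ (map_ne_zero_of_notMem hs)]⟩
  · rintro ⟨a, s, hs, rfl⟩
    exact ⟨s, hs, a, by rw [mul_div_cancel₀ _ (map_ne_zero_of_notMem hs)]⟩

theorem mem_maxAt (hP : P.IsPrime) {x : K} :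
    x ∈ maxAt K P ↔ ∃ a ∈ P, ∃ s ∉ P, x = α a / α s := by
  simp only [maxAt, mem_loc, mem_avoid_singleton hP, idealToK, Submodule.mem_map,
    Algebra.linearMap_apply, Algebra.smul_def]
  constructor
  · rintro ⟨s, hs, a, ha, h⟩
    exact ⟨a, ha, s, hs, by rw [h, mul_div_cancel_left₀ _ (map_ne_zero_of_notMem hs)]⟩
  · rintro ⟨a, ha, s, hs, rfl⟩
    exact ⟨s, hs, a, ha, by rw [mul_div_cancel₀ _ (map_ne_zero_of_notMem hs)]⟩

theorem map_mem_ringAt (hP : P.IsPrime) (a : D) : α a ∈ ringAt K P :=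
  (mem_ringAt hP).2 ⟨a, 1, hP.one_notMem, by simp⟩

theorem one_mem_ringAt (hP : P.IsPrime) : (1 : K) ∈ ringAt K P := by
  simpa using map_mem_ringAt (K := K) hP 1

theorem map_mem_maxAt (hP : P.IsPrime) {a : D} : α a ∈ maxAt K P ↔ a ∈ P := by
  rw [mem_maxAt hP]
  constructor
  · rintro ⟨b, hb, s, hs, h⟩
    rw [eq_div_iff (map_ne_zero_of_notMem hs), ← map_mul] at h
    rw [← IsFractionRing.injective D K h] at hb
    exact (hP.mem_or_mem hb).resolve_right hs
  · intro h
    exact ⟨a, h, 1, hP.one_notMem, by simp⟩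

theorem maxAt_le_ringAt (hP : P.IsPrime) : maxAt K P ≤ ringAt K P := by
  intro x hx
  obtain ⟨a, _, s, hs, rfl⟩ := (mem_maxAt hP).1 hx
  exact (mem_ringAt hP).2 ⟨a, s, hs, rfl⟩

theorem mul_mem_of_local (hP : P.IsPrime) {I : Submodule D K} (hI : loc {P} I ≤ I) {r x : K}
    (hr : r ∈ ringAt K P) (hx : x ∈ I) : r * x ∈ I := by
  obtain ⟨a, s, hs, rfl⟩ := (mem_ringAt hP).1 hr
  refine hI ⟨s, (mem_avoid_singleton hP).2 hs, ?_⟩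
  have : s • (α a / α s * x) = a • x := by
    rw [Algebra.smul_def, Algebra.smul_def, ← mul_assoc,
      mul_div_cancel₀ _ (map_ne_zero_of_notMem hs)]
  rw [this]; exact I.smul_mem _ hx

theorem ringAt_local (P : Ideal D) : loc {P} (ringAt K P) ≤ ringAt K P := loc_loc_le _ _

theorem maxAt_local (P : Ideal D) : loc {P} (maxAt K P) ≤ maxAt K P := loc_loc_le _ _

theorem ringAt_mul (hP : P.IsPrime) {x y : K} (hx : x ∈ ringAt K P) (hy : y ∈ ringAt K P) :
    x * y ∈ ringAt K P := mul_mem_of_local hP (ringAt_local P) hx hy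

theorem ringAt_mul_maxAt (hP : P.IsPrime) {x y : K} (hx : x ∈ ringAt K P) (hy : y ∈ maxAt K P) :
    x * y ∈ maxAt K P := mul_mem_of_local hP (maxAt_local P) hx hy

theorem one_notMem_maxAt (hP : P.IsPrime) : (1 : K) ∉ maxAt K P := by
  have := (map_mem_maxAt (K := K) hP (a := 1)).not.2 hP.one_notMem
  simpa using this

theorem maxAt_lt_ringAt (hP : P.IsPrime) : maxAt K P < ringAt K P :=
  lt_of_le_not_ge (maxAt_le_ringAt hP) fun h => one_notMem_maxAt hP (h (one_mem_ringAt hP))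

theorem inv_notMem_ringAt (hP : P.IsPrime) {x : K} (hx : x ∈ maxAt K P) (h0 : x ≠ 0) :
    x⁻¹ ∉ ringAt K P := fun h => one_notMem_maxAt hP <| by
  simpa [h0] using ringAt_mul_maxAt hP h hx

theorem mem_unitAt (hP : P.IsPrime) {g : K} :
    g ∈ unitAt K P ↔ g ∈ ringAt K P ∧ g ∉ maxAt K P := by
  constructor
  · rintro ⟨a, b, ha, hb, rfl⟩
    refine ⟨(mem_ringAt hP).2 ⟨a, b, hb, rfl⟩, fun h => ?_⟩
    refine inv_notMem_ringAt hP h (div_ne_zero (map_ne_zero_of_notMem ha)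
      (map_ne_zero_of_notMem hb)) ?_
    rw [inv_div]; exact (mem_ringAt hP).2 ⟨b, a, ha, rfl⟩
  · rintro ⟨h1, h2⟩
    obtain ⟨a, s, hs, rfl⟩ := (mem_ringAt hP).1 h1
    exact ⟨a, s, fun ha => h2 ((mem_maxAt hP).2 ⟨a, ha, s, hs, rfl⟩), hs, rfl⟩

theorem unitAt_ne_zero {g : K} (hg : g ∈ unitAt K P) : g ≠ 0 := by
  obtain ⟨a, b, ha, hb, rfl⟩ := hg
  exact div_ne_zero (map_ne_zero_of_notMem ha) (map_ne_zero_of_notMem hb)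

theorem unitAt_inv {g : K} (hg : g ∈ unitAt K P) : g⁻¹ ∈ unitAt K P := by
  obtain ⟨a, b, ha, hb, rfl⟩ := hg
  exact ⟨b, a, hb, ha, inv_div _ _⟩

theorem map_mem_unitAt (hP : P.IsPrime) {a : D} (ha : a ∉ P) : α a ∈ unitAt K P :=
  ⟨a, 1, ha, hP.one_notMem, by simp⟩

theorem unitAt_one (hP : P.IsPrime) : (1 : K) ∈ unitAt K P := by
  simpa using map_mem_unitAt (K := K) hP hP.one_notMem

theorem unitAt_mul (hP : P.IsPrime) {g h : K} (hg : g ∈ unitAt K P) (hh : h ∈ unitAt K P) :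
    g * h ∈ unitAt K P := by
  obtain ⟨a, b, ha, hb, rfl⟩ := hg
  obtain ⟨c, d, hc, hd, rfl⟩ := hh
  exact ⟨a * c, b * d, hP.mul_notMem ha hc, hP.mul_notMem hb hd, by
    rw [map_mul, map_mul, div_mul_div_comm]⟩

theorem sc_unit_of_local (hP : P.IsPrime) {I : Submodule D K} (hI : loc {P} I ≤ I) {g : K}
    (hg : g ∈ unitAt K P) : sc g I = I := by
  ext x
  rw [mem_sc (unitAt_ne_zero hg)]
  constructor
  · intro h
    have := mul_mem_of_local hP hI ((mem_unitAt hP).1 hg).1 h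
    rwa [mul_inv_cancel_left₀ (unitAt_ne_zero hg)] at this
  · exact mul_mem_of_local hP hI ((mem_unitAt hP).1 (unitAt_inv hg)).1

theorem sc_unit_ringAt (hP : P.IsPrime) {g : K} (hg : g ∈ unitAt K P) :
    sc g (ringAt K P) = ringAt K P := sc_unit_of_local hP (ringAt_local P) hg

theorem sc_unit_maxAt (hP : P.IsPrime) {g : K} (hg : g ∈ unitAt K P) :
    sc g (maxAt K P) = maxAt K P := sc_unit_of_local hP (maxAt_local P) hg

theorem mem_locAt (hP : P.IsPrime) {x : K} : x ∈ locAt D K P hP ↔ x ∈ ringAt K P := by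
  rw [mem_ringAt hP]
  change (∃ (a s : D) (_ : s ∈ P.primeCompl), x = IsLocalization.mk' K a _) ↔ _
  refine exists_congr fun a => exists_congr fun s => ?_
  constructor
  · rintro ⟨hs, h⟩
    exact ⟨hs, by rw [h, IsFractionRing.mk'_eq_div]⟩
  · rintro ⟨hs, h⟩
    exact ⟨hs, by rw [h, IsFractionRing.mk'_eq_div]⟩

theorem exists_notMem_of_maxAt_lt (hP : P.IsPrime) {I : Submodule D K} (h : maxAt K P < I)
    (h' : I ≤ ringAt K P) : ∃ a ∉ P, α a ∈ I := by
  obtain ⟨x, hx, hxm⟩ := SetLike.exists_of_lt h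
  obtain ⟨a, s, ha, hs, rfl⟩ := (mem_unitAt hP).2 ⟨h' hx, hxm⟩
  refine ⟨a, ha, ?_⟩
  have := I.smul_mem s hx
  rwa [Algebra.smul_def, mul_div_cancel₀ _ (map_ne_zero_of_notMem hs)] at this

theorem loc_ringAt_le {W : Set (Ideal D)} (h : avoid W ≤ avoid {P}) :
    loc W (ringAt K P) ≤ ringAt K P := (loc_le_loc h _).trans (ringAt_local P)

theorem ringAt_bot : ringAt K (⊥ : Ideal D) = ⊤ := by
  refine eq_top_iff.2 fun x _ => (mem_ringAt Ideal.isPrime_bot).2 ?_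
  obtain ⟨a, b, hb, rfl⟩ := IsFractionRing.div_surjective (A := D) x
  exact ⟨a, b, by simpa using nonZeroDivisors.ne_zero hb, rfl⟩

theorem maxAt_bot : maxAt K (⊥ : Ideal D) = ⊥ := by
  refine eq_bot_iff.2 fun x hx => ?_
  obtain ⟨a, ha, s, _, rfl⟩ := (mem_maxAt Ideal.isPrime_bot).1 hx
  simp [(Submodule.mem_bot D).1 ha]

theorem mem_unitAt_bot {x : K} : x ∈ unitAt K (⊥ : Ideal D) ↔ x ≠ 0 := by
  rw [mem_unitAt Ideal.isPrime_bot, ringAt_bot, maxAt_bot]; simp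

section Prufer

variable (hp : IsPrufer D K)
include hp

theorem inv_mem_ringAt (hP : P.IsPrime) {x : K} (hx : x ∉ ringAt K P) : x⁻¹ ∈ ringAt K P := by
  obtain ⟨a, b, hb, rfl⟩ := IsFractionRing.div_surjective (A := D) x
  have hb0 : α b ≠ 0 := IsFractionRing.to_map_ne_zero_of_mem_nonZeroDivisors hb
  have ha0 : α a ≠ 0 := fun h => hx (by rw [h, zero_div]; exact zero_mem _)
  obtain ⟨⟨z, hz⟩, h | h⟩ := hp P hP ⟨α a, (mem_locAt hP).2 (map_mem_ringAt hP a)⟩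
    ⟨α b, (mem_locAt hP).2 (map_mem_ringAt hP b)⟩
  · have h' : α a * z = α b := congrArg Subtype.val h
    rw [inv_div, ← h', mul_div_cancel_left₀ _ ha0]
    exact (mem_locAt hP).1 hz
  · have h' : α b * z = α a := congrArg Subtype.val h
    rw [← h', mul_div_cancel_left₀ _ hb0] at hx
    exact (hx ((mem_locAt hP).1 hz)).elim

theorem inv_mem_maxAt (hP : P.IsPrime) {x : K} (hx : x ∉ ringAt K P) : x⁻¹ ∈ maxAt K P := by
  by_contra h
  apply hx
  have := unitAt_inv ((mem_unitAt hP).2 ⟨inv_mem_ringAt hp hP hx, h⟩)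
  rw [inv_inv] at this
  exact ((mem_unitAt hP).1 this).1

theorem inv_mem_ringAt_of_notMem_maxAt (hP : P.IsPrime) {x : K} (hx : x ∉ maxAt K P) :
    x⁻¹ ∈ ringAt K P := by
  by_cases h : x ∈ ringAt K P
  · exact ((mem_unitAt hP).1 (unitAt_inv ((mem_unitAt hP).2 ⟨h, hx⟩))).1
  · exact inv_mem_ringAt hp hP h

omit hp in
theorem ringAt_anti (hP : P.IsPrime) (hQ : Q.IsPrime) (h : P ≤ Q) : ringAt K Q ≤ ringAt K P := by
  intro x hx
  obtain ⟨a, s, hs, rfl⟩ := (mem_ringAt hQ).1 hx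
  exact (mem_ringAt hP).2 ⟨a, s, fun hh => hs (h hh), rfl⟩

omit hp in
theorem unitAt_anti (h : P ≤ Q) : unitAt K Q ⊆ unitAt K P := by
  rintro _ ⟨a, b, ha, hb, rfl⟩
  exact ⟨a, b, fun hh => ha (h hh), fun hh => hb (h hh), rfl⟩

theorem maxAt_mono (hP : P.IsPrime) (hQ : Q.IsPrime) (h : P ≤ Q) : maxAt K P ≤ maxAt K Q := by
  intro x hx
  by_contra hc
  have h0 : x ≠ 0 := fun h0 => hc (h0 ▸ zero_mem _)
  exact inv_notMem_ringAt hP hx h0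
    (ringAt_anti hP hQ h (inv_mem_ringAt_of_notMem_maxAt hp hQ hc))

theorem le_total_of_le_prime {M : Ideal D} (hM : M.IsPrime) (hP : P.IsPrime) (hQ : Q.IsPrime)
    (hPM : P ≤ M) (hQM : Q ≤ M) : P ≤ Q ∨ Q ≤ P := by
  by_contra! hc
  obtain ⟨a, haP, haQ⟩ := SetLike.not_le_iff_exists.1 hc.1
  obtain ⟨b, hbQ, hbP⟩ := SetLike.not_le_iff_exists.1 hc.2
  have key : ∀ {P Q : Ideal D}, P.IsPrime → P ≤ M → ∀ {a b}, a ∈ P → a ∉ Q → b ∉ P →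
      α b / α a ∈ ringAt K M → False := by
    intro P Q hP hPM a b haP haQ hbP h
    obtain ⟨c, s, hs, h⟩ := (mem_ringAt hM).1 h
    rw [div_eq_div_iff (map_ne_zero_of_notMem haQ) (map_ne_zero_of_notMem hs), ← map_mul,
      ← map_mul] at h
    have h := IsFractionRing.injective D K h
    have : b * s ∈ P := h ▸ P.mul_mem_left c haP
    exact (hP.mem_or_mem this).elim hbP fun hh => hs (hPM hh)
  by_cases h : α b / α a ∈ ringAt K M
  · exact key hP hPM haP haQ hbP h
  · have := inv_mem_ringAt hp hM h
    rw [inv_div] at this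
    exact key hQ hQM hbQ hbP haQ this

/-- In a valuation overring, an element outside a submodule divides every element of it. -/
theorem div_mem_maxAt_of_local (hP : P.IsPrime) {I : Submodule D K} (hI : loc {P} I ≤ I) {x y : K}
    (hx : x ∉ I) (hy : y ∈ I) : x⁻¹ * y ∈ maxAt K P := by
  by_contra h
  apply hx
  have h1 := inv_mem_ringAt_of_notMem_maxAt hp hP h
  rw [mul_inv, inv_inv] at h1
  have hy0 : y ≠ 0 := by
    rintro rfl
    exact h (by simp)
  have := mul_mem_of_local hP hI h1 hy
  rwa [mul_assoc, inv_mul_cancel₀ hy0, mul_one] at this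

end Prufer

end Valuation

end Paper

namespace Paper

section Primes

variable {D : Type*} [CommRing D] [IsDomain D] {K : Type*} [Field K] [Algebra D K]
  [IsFractionRing D K]

local notation "α" => algebraMap D K

variable (D K) in
/-- A semilocal Prüfer domain of finite Krull dimension. -/
structure IsSemilocalPrufer : Prop where
  prufer : IsPrufer D K
  semilocal : IsSemilocal D
  dim : ringKrullDim D < ⊤

/-- The maximal ideals containing `Q`. -/
def above (Q : Ideal D) : Set (Ideal D) := {M | M.IsMaximal ∧ Q ≤ M}

theorem exists_mem_avoid {W : Set (Ideal D)} (hW : W.Finite) (hp : ∀ N ∈ W, N.IsPrime)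
    {I : Ideal D} (h : ∀ N ∈ W, ¬ I ≤ N) : ∃ s ∈ I, s ∈ avoid W := by
  by_contra! hc
  have : (I : Set D) ⊆ ⋃ N ∈ W, (N : Set D) := by
    intro s hs
    have := hc s hs
    simp only [avoid, Submonoid.mem_mk, Subsemigroup.mem_mk, Set.mem_ofPred_eq] at this
    push Not at this
    obtain ⟨N, hN, _, hs⟩ := this
    exact Set.mem_biUnion hN hs
  obtain ⟨N, hN, hle⟩ := (Ideal.subset_union_prime_finite hW (f := id) ⊥ ⊥
    fun N hN _ _ => hp N hN).1 this
  exact h N hN hle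

theorem mem_loc_of_forall {W : Set (Ideal D)} (hW : W.Finite) (hp : ∀ N ∈ W, N.IsPrime)
    {I : Submodule D K} {x : K} (h : ∀ N ∈ W, x ∈ loc {N} I) : x ∈ loc W I := by
  obtain ⟨s, hs, hsW⟩ := exists_mem_avoid hW hp
    (I := I.comap (LinearMap.toSpanSingleton D K x)) fun N hN hle => by
      obtain ⟨s, hs, hx⟩ := h N hN
      exact (mem_avoid_singleton (hp N hN)).1 hs (hle hx)
  exact ⟨s, hsW, hs⟩

theorem finite_primes_le (hD : IsSemilocalPrufer D K) {M : Ideal D} (hM : M.IsPrime) :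
    {P : Ideal D | P.IsPrime ∧ P ≤ M}.Finite := by
  classical
  by_contra hinf
  let X := {P : PrimeSpectrum D // P.asIdeal ≤ M}
  have hX : Infinite X := by
    by_contra hfin
    rw [not_infinite_iff_finite] at hfin
    apply hinf
    refine (Set.finite_range fun P : X => P.1.asIdeal).subset ?_
    rintro P ⟨hP, hPM⟩
    exact ⟨⟨⟨P, hP⟩, hPM⟩, rfl⟩
  let _ : LinearOrder X :=
    { (inferInstance : PartialOrder X) with
      le_total := fun P Q => le_total_of_le_prime hD.prufer hM P.1.2 Q.1.2 P.2 Q.2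
      toDecidableLE := Classical.decRel _ }
  have key : ∀ n : ℕ, (n : WithBot ℕ∞) ≤ ringKrullDim D := by
    intro n
    obtain ⟨t, ht⟩ := Infinite.exists_subset_card_eq X (n + 1)
    let p : LTSeries (PrimeSpectrum D) :=
      { length := n
        toFun := fun i => (t.orderEmbOfFin ht i).1
        step := fun i => by
          exact (t.orderEmbOfFin ht).strictMono (Fin.castSucc_lt_succ (i := i)) }
    exact Order.LTSeries.length_le_krullDim p
  have hfin : FiniteDimensionalOrder (PrimeSpectrum D) := by
    rw [Order.finiteDimensionalOrder_iff_krullDim_ne_bot_and_top]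
    refine ⟨fun h => ?_, hD.dim.ne⟩
    have := key 0
    rw [ringKrullDim, h] at this
    simp at this
  have h1 := key ((LTSeries.longestOf (PrimeSpectrum D)).length + 1)
  rw [ringKrullDim, Order.krullDim_eq_length_of_finiteDimensionalOrder] at h1
  have h2 : (LTSeries.longestOf (PrimeSpectrum D)).length + 1 ≤
    (LTSeries.longestOf (PrimeSpectrum D)).length := by exact_mod_cast h1
  omega

theorem finite_primes (hD : IsSemilocalPrufer D K) : {P : Ideal D | P.IsPrime}.Finite := by
  refine (hD.semilocal.biUnion fun M (hM : M.IsMaximal) =>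
    finite_primes_le hD hM.isPrime).subset fun P (hP : P.IsPrime) => ?_
  obtain ⟨M, hM, hPM⟩ := P.exists_le_maximal hP.ne_top
  exact Set.mem_biUnion hM ⟨hP, hPM⟩

theorem above_finite (hD : IsSemilocalPrufer D K) (Q : Ideal D) : (above Q).Finite :=
  hD.semilocal.subset fun _ h => h.1

theorem above_prime {Q : Ideal D} : ∀ N ∈ above Q, N.IsPrime := fun _ h => h.1.isPrime

theorem avoid_above_le {P : Ideal D} (hP : P.IsPrime) : avoid (above P) ≤ avoid {P} := by
  refine avoid_le ?_
  rintro N hN hNp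
  rw [Set.mem_singleton_iff.1 hN]
  obtain ⟨M, hM, hPM⟩ := P.exists_le_maximal hP.ne_top
  exact ⟨M, ⟨hM, hPM⟩, hM.isPrime, hPM⟩

theorem hiSpec_finite (hD : IsSemilocalPrufer D K) : (hiSpec D).Finite :=
  (finite_primes hD).subset fun _ h => h.1

theorem bot_mem_hiSpec : (⊥ : Ideal D) ∈ hiSpec D := ⟨Ideal.isPrime_bot, Or.inl rfl⟩

variable {P Q Q' N M M' : Ideal D}

theorem exists_directlyBelow (hD : IsSemilocalPrufer D K) (hP : P ∈ hiSpec D) (hM : M.IsMaximal)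
    (h : P < M) : ∃ Q, DirectlyBelow D P Q ∧ Q ≤ M := by
  have hfin : {R | R ∈ hiSpec D ∧ P < R ∧ R ≤ M}.Finite :=
    (hiSpec_finite hD).subset fun _ h => h.1
  obtain ⟨Q, hQ⟩ := hfin.exists_minimal ⟨M, maximal_mem_hiSpec hM, h, le_rfl⟩
  refine ⟨Q, ⟨hP, hQ.1.1, hQ.1.2.1, fun R hR hPR hRQ => ?_⟩, hQ.1.2.2⟩
  exact hRQ.not_ge (hQ.2 ⟨hR, hPR, hRQ.le.trans hQ.1.2.2⟩ hRQ.le)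

theorem children_incomparable (hQ : DirectlyBelow D P Q) (hQ' : DirectlyBelow D P Q')
    (h : Q ≤ Q') : Q = Q' := by
  by_contra hne
  exact hQ'.2.2.2 Q hQ.2.1 hQ.2.2.1 (lt_of_le_of_ne h hne)

theorem le_of_le_children (hD : IsSemilocalPrufer D K) (hQ : DirectlyBelow D P Q)
    (hQ' : DirectlyBelow D P Q') (hne : Q ≠ Q') (hN : N.IsPrime) (hM : M ∈ above Q)
    (hM' : M' ∈ above Q') (h : N ≤ M) (h' : N ≤ M') : N ≤ P := by
  have hQp := hQ.2.1.1
  have hQp' := hQ'.2.1.1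
  have hnc : ∀ X, X.IsPrime → Q ≤ X → Q' ≤ X → False := fun X hX h1 h2 =>
    (le_total_of_le_prime hD.prufer hX hQp hQp' h1 h2).elim
      (fun h => hne (children_incomparable hQ hQ' h))
      (fun h => hne (children_incomparable hQ' hQ h).symm)
  have hNQ : N ≤ Q := (le_total_of_le_prime hD.prufer hM.1.isPrime hN hQp h hM.2).resolve_right
    fun hh => hnc M' hM'.1.isPrime (hh.trans h') hM'.2
  have hNQ' : N ≤ Q' := (le_total_of_le_prime hD.prufer hM'.1.isPrime hN hQp' h' hM'.2).resolve_right
    fun hh => hnc M hM.1.isPrime hM.2 (hh.trans h)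
  have hfin : {R : Ideal D | R.IsPrime ∧ R ≤ Q ∧ R ≤ Q'}.Finite :=
    (finite_primes hD).subset fun _ h => h.1
  obtain ⟨B, hPB, hB⟩ := hfin.exists_le_maximal
    (show P ∈ _ from ⟨hQ.1.1, hQ.2.2.1.le, hQ'.2.2.1.le⟩)
  have hmax : ∀ R : Ideal D, R.IsPrime → R ≤ Q → R ≤ Q' → R ≤ B := by
    intro R hR h1 h2
    rcases le_total_of_le_prime hD.prufer hQp hR hB.1.1 h1 hB.1.2.1 with h | h
    · exact h
    · exact hB.2 ⟨hR, h1, h2⟩ h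
  have hBQ : B ≠ Q := fun h => hnc Q' hQp' (h ▸ hB.1.2.2) le_rfl
  have hBQ' : B ≠ Q' := fun h => hnc Q hQp le_rfl (h ▸ hB.1.2.1)
  have hBhi : B ∈ hiSpec D := by
    refine ⟨hB.1.1, Or.inr (Or.inr ⟨{Q, Q'}, ?_, ?_, ?_, ?_, ?_⟩)⟩
    · rintro X (rfl | rfl) <;> assumption
    · have h1 : ¬ Q ≤ Q' := fun h => hne (children_incomparable hQ hQ' h)
      have h2 : ¬ Q' ≤ Q := fun h => hne (children_incomparable hQ' hQ h).symm
      rintro X (rfl | rfl) Y (rfl | rfl) hXY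
      · exact (hXY rfl).elim
      · exact ⟨h1, h2⟩
      · exact ⟨h2, h1⟩
      · exact (hXY rfl).elim
    · rintro (rfl | rfl)
      · exact hBQ rfl
      · exact hBQ' rfl
    · rintro X (rfl | rfl)
      · exact hB.1.2.1
      · exact hB.1.2.2
    · intro R hR h
      exact hmax R hR (h Q (by simp)) (h Q' (by simp))
  have : P = B := by
    by_contra hne
    exact hQ.2.2.2 B hBhi (lt_of_le_of_ne hPB hne) (lt_of_le_of_ne hB.1.2.1 hBQ)
  rw [this]
  exact hmax N hN hNQ hNQ'

/-- The maximal ideals containing a child of `P` other than `Q`. -/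
def aboveOthers (P Q : Ideal D) : Set (Ideal D) :=
  {M | ∃ Q', DirectlyBelow D P Q' ∧ Q' ≠ Q ∧ M ∈ above Q'}

theorem above_subset_aboveOthers (h : DirectlyBelow D P Q') (hne : Q' ≠ Q) :
    above Q' ⊆ aboveOthers P Q := fun _ hM => ⟨Q', h, hne, hM⟩

theorem avoid_anti {V W : Set (Ideal D)} (h : V ⊆ W) : avoid W ≤ avoid V :=
  avoid_le fun N hN hp => ⟨N, h hN, hp, le_rfl⟩

/-- Localizations at different children of `P` are independent over `D_P`. -/
theorem exists_independent (hD : IsSemilocalPrufer D K) (hQ : DirectlyBelow D P Q) {s : D}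
    (hs : s ∉ P) : ∃ a ∈ avoid (above Q), ∃ b ∈ avoid (aboveOthers P Q), ∃ t, a * b = s * t := by
  by_contra! hc
  have hdisj : Disjoint ((Ideal.span {s} : Ideal D) : Set D)
      ((avoid (above Q) ⊔ avoid (aboveOthers P Q) : Submonoid D) : Set D) := by
    rw [Set.disjoint_left]
    intro x hx hx'
    obtain ⟨t, rfl⟩ := Ideal.mem_span_singleton.1 hx
    obtain ⟨a, ha, b, hb, h⟩ := Submonoid.mem_sup.1 hx'
    exact hc a ha b hb t h
  obtain ⟨N, hN, hsN, hN'⟩ := Ideal.exists_le_prime_disjoint _ _ hdisj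
  have hle : ∀ W : Set (Ideal D), W.Finite → (∀ N ∈ W, N.IsPrime) →
      avoid W ≤ avoid (above Q) ⊔ avoid (aboveOthers P Q) → ∃ M ∈ W, N ≤ M := by
    intro W hW hWp hle
    by_contra! hh
    obtain ⟨x, hx, hx'⟩ := exists_mem_avoid hW hWp hh
    exact Set.disjoint_left.1 hN' hx (hle hx')
  obtain ⟨M, hM, hNM⟩ := hle _ (above_finite hD Q) above_prime le_sup_left
  obtain ⟨M', ⟨Q', hQ', hne, hM'⟩, hNM'⟩ := hle (aboveOthers P Q)
    (hD.semilocal.subset (by rintro M ⟨Q', -, -, h⟩; exact h.1))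
    (by rintro M ⟨Q', -, -, h⟩; exact h.1.isPrime) le_sup_right
  exact hs (le_of_le_children hD hQ hQ' hne.symm hN hM hM' hNM hNM'
    (hsN (Ideal.mem_span_singleton_self s)))

end Primes

end Paper

namespace Paper

section LocalModules

variable {D : Type*} [CommRing D] [IsDomain D] {K : Type*} [Field K] [Algebra D K]
  [IsFractionRing D K]

local notation "α" => algebraMap D K

variable {P Q M : Ideal D} {I J : Submodule D K}

variable (K) in
/-- The submodules strictly between the maximal ideal of `D_P` and `D_P`, the latter included. -/
def XS (P : Ideal D) : Set (Submodule D K) := {I | maxAt K P < I ∧ I ≤ ringAt K P}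

variable (K) in
/-- The elements of `XS K P` that are modules over the semilocalization above `Q`. -/
def ZS (P Q : Ideal D) : Set (Submodule D K) :=
  {I | maxAt K P < I ∧ I ≤ ringAt K P ∧ loc (above Q) I ≤ I}

variable (K) in
/-- The proper elements of `XS K P` that are modules over `D_Q`. -/
def US (P Q : Ideal D) : Set (Submodule D K) :=
  {I | maxAt K P < I ∧ I < ringAt K P ∧ loc {Q} I ≤ I}

theorem ne_zero_of_notMem_submodule {x : K} (hx : x ∉ I) : x ≠ 0 := by
  rintro rfl; exact hx (zero_mem _)

theorem mem_unitAt_of_mem_of_notMem (hP : P.IsPrime) (hI : maxAt K P ≤ I) (hJ : J ≤ ringAt K P)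
    {x : K} (hx : x ∉ I) (hxJ : x ∈ J) : x ∈ unitAt K P :=
  (mem_unitAt hP).2 ⟨hJ hxJ, fun h => hx (hI h)⟩

theorem sInf_mem_ZS {S : Set (Submodule D K)} (hS : S ⊆ ZS K P Q) (hne : S.Nonempty)
    (h : maxAt K P < sInf S) : sInf S ∈ ZS K P Q := by
  obtain ⟨I, hI⟩ := hne
  exact ⟨h, (sInf_le hI).trans (hS hI).2.1, loc_sInf_le fun J hJ => (hS hJ).2.2⟩

theorem ringAt_mem_ZS (hP : P.IsPrime) (hQ : Q.IsPrime) (hPQ : P ≤ Q) :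
    ringAt K P ∈ ZS K P Q := by
  refine ⟨maxAt_lt_ringAt hP, le_rfl, loc_ringAt_le (avoid_le ?_)⟩
  rintro N hN hNp
  rw [Set.mem_singleton_iff.1 hN]
  obtain ⟨M, hM, hQM⟩ := Q.exists_le_maximal hQ.ne_top
  exact ⟨M, ⟨hM, hQM⟩, hM.isPrime, hPQ.trans hQM⟩

theorem sc_mem_ZS (hP : P.IsPrime) {g : K} (hg : g ∈ unitAt K P) (h : I ∈ ZS K P Q) :
    sc g I ∈ ZS K P Q := by
  have hg0 := unitAt_ne_zero hg
  refine ⟨?_, ?_, loc_sc_le hg0 h.2.2⟩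
  · rw [← sc_unit_maxAt hP hg, sc_lt_sc_iff hg0]; exact h.1
  · rw [← sc_unit_ringAt hP hg, sc_le_sc_iff hg0]; exact h.2.1

theorem sc_mem_XS (hP : P.IsPrime) {g : K} (hg : g ∈ unitAt K P) (h : I ∈ XS K P) :
    sc g I ∈ XS K P := by
  have hg0 := unitAt_ne_zero hg
  refine ⟨?_, ?_⟩
  · rw [← sc_unit_maxAt hP hg, sc_lt_sc_iff hg0]; exact h.1
  · rw [← sc_unit_ringAt hP hg, sc_le_sc_iff hg0]; exact h.2

theorem sc_mem_US (hP : P.IsPrime) {g : K} (hg : g ∈ unitAt K P) (h : I ∈ US K P Q) :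
    sc g I ∈ US K P Q := by
  have hg0 := unitAt_ne_zero hg
  refine ⟨?_, ?_, loc_sc_le hg0 h.2.2⟩
  · rw [← sc_unit_maxAt hP hg, sc_lt_sc_iff hg0]; exact h.1
  · rw [← sc_unit_ringAt hP hg, sc_lt_sc_iff hg0]; exact h.2.1

variable (hD : IsSemilocalPrufer D K)
include hD

/-- A module over the semilocalization above `Q` absorbs scalars that are integral at every
maximal ideal above `Q`. -/
theorem mul_mem_of_above (hI : loc (above Q) I ≤ I) {x y : K}
    (hx : ∀ M ∈ above Q, x ∈ ringAt K M) (hy : y ∈ I) : x * y ∈ I := by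
  refine hI (mem_loc_of_forall (above_finite hD Q) above_prime fun M hM => ?_)
  exact mul_mem_of_local hM.1.isPrime (loc_loc_le _ _) (hx M hM) (le_loc _ _ hy)

theorem maxAt_le_ringAt_above (hQ : Q.IsPrime) (hM : M ∈ above Q) : maxAt K Q ≤ ringAt K M :=
  (maxAt_mono hD.prufer hQ hM.1.isPrime hM.2).trans (maxAt_le_ringAt hM.1.isPrime)

theorem exists_div_mem_maxAt (hI : loc (above Q) I ≤ I) {x : K} (hx : x ∉ I) :
    ∃ M ∈ above Q, ∀ y ∈ I, x⁻¹ * y ∈ maxAt K M := by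
  by_contra! hc
  refine hx (hI (mem_loc_of_forall (above_finite hD Q) above_prime fun M hM => ?_))
  obtain ⟨y, hy, hy'⟩ := hc M hM
  by_contra hxM
  exact hy' (div_mem_maxAt_of_local hD.prufer hM.1.isPrime (loc_loc_le _ _) hxM (le_loc _ _ hy))

theorem div_mem_ringAt (hQ : Q.IsPrime) (hI : loc (above Q) I ≤ I) {x y : K} (hx : x ∉ I)
    (hy : y ∈ I) : x⁻¹ * y ∈ ringAt K Q := by
  obtain ⟨M, hM, h⟩ := exists_div_mem_maxAt hD hI hx
  exact ringAt_anti hQ hM.1.isPrime hM.2 (maxAt_le_ringAt hM.1.isPrime (h y hy))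

theorem ringAt_le_or_le (hQ : Q.IsPrime) (hI : loc (above Q) I ≤ I) :
    ringAt K Q ≤ I ∨ I ≤ ringAt K Q := by
  by_contra! hc
  obtain ⟨x, hxI, hxQ⟩ := SetLike.not_le_iff_exists.1 hc.2
  refine hc.1 fun r hr => ?_
  have hx0 := ne_zero_of_notMem_submodule hxQ
  have h : r * x⁻¹ ∈ maxAt K Q := ringAt_mul_maxAt hQ hr (inv_mem_maxAt hD.prufer hQ hxQ)
  have := mul_mem_of_above hD hI (fun M hM => maxAt_le_ringAt_above hD hQ hM h) hxI
  rwa [mul_assoc, inv_mul_cancel₀ hx0, mul_one] at this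

theorem exists_smul_le (hQ : Q.IsPrime) (hP : P.IsPrime) (hPQ : P < Q) (hI : I ∈ ZS K P Q)
    (hJ : J ∈ ZS K P Q) (hne : J ≠ ringAt K P) : ∃ c ∉ P, ∀ y ∈ J, c • y ∈ I := by
  obtain ⟨q, hqQ, hqP⟩ := SetLike.exists_of_lt hPQ
  obtain ⟨z, hzR, hzJ⟩ := SetLike.exists_of_lt (lt_of_le_of_ne hJ.2.1 hne)
  obtain ⟨a, haP, haI⟩ := exists_notMem_of_maxAt_lt hP hI.1 hI.2.1
  have hz := mem_unitAt_of_mem_of_notMem hP hJ.1.le le_rfl hzJ hzR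
  obtain ⟨c, d, hc, hd, h⟩ := unitAt_mul hP (map_mem_unitAt hP (hP.mul_notMem hqP haP)) (unitAt_inv hz)
  refine ⟨c, hc, fun y hy => ?_⟩
  have h1 : (z⁻¹ * y) * α q ∈ maxAt K Q :=
    ringAt_mul_maxAt hQ (div_mem_ringAt hD hQ hJ.2.2 hzJ hy) ((map_mem_maxAt hQ).2 hqQ)
  have h2 := mul_mem_of_above hD hI.2.2 (fun M hM => maxAt_le_ringAt_above hD hQ hM h1) haI
  have h3 : c • y = d • (z⁻¹ * y * α q * α a) := by
    have hd0 : α d ≠ 0 := map_ne_zero_of_notMem hd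
    rw [eq_div_iff hd0] at h
    rw [Algebra.smul_def, Algebra.smul_def, ← h, map_mul]; ring
  rw [h3]; exact I.smul_mem _ h2

theorem mem_of_forall_child (hP : P ∈ hiSpec D) (hI : I ∈ XS K P) {x : K} (hx : x ∈ ringAt K P)
    (h : ∀ Q, DirectlyBelow D P Q → x ∈ loc (above Q) I) : x ∈ I := by
  have hPp := hP.1
  by_contra hxI
  let C : Ideal D := I.comap (LinearMap.toSpanSingleton D K x)
  have hC : C ≠ ⊤ := fun hC => hxI <| by
    have : (1 : D) ∈ C := hC ▸ Submodule.mem_top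
    simpa [C] using this
  obtain ⟨M, hM, hCM⟩ := C.exists_le_maximal hC
  obtain ⟨a, haP, haI⟩ := exists_notMem_of_maxAt_lt hPp hI.1 hI.2
  obtain ⟨b, s, hs, rfl⟩ := (mem_ringAt hPp).1 hx
  have hPC : P ≤ C := fun p hp => hI.1.le (by
    have := ringAt_mul_maxAt hPp hx ((map_mem_maxAt (K := K) hPp).2 hp)
    rw [mul_comm, ← Algebra.smul_def] at this
    exact this)
  have hsa : s * a ∈ C := by
    change (s * a) • (α b / α s) ∈ I
    have : (s * a) • (α b / α s) = b • α a := by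
      rw [Algebra.smul_def, Algebra.smul_def, map_mul]
      field_simp [map_ne_zero_of_notMem (K := K) hs]
    rw [this]; exact I.smul_mem _ haI
  have hPM : P < M := lt_of_le_of_ne (hPC.trans hCM) fun h =>
    hPp.mul_notMem hs haP (h ▸ hCM hsa)
  obtain ⟨Q, hQ, hQM⟩ := exists_directlyBelow hD hP hM hPM
  obtain ⟨d, hd, hdx⟩ := h Q hQ
  exact hd M ⟨hM, hQM⟩ hM.isPrime (hCM hdx)

theorem loc_mem_ZS (hP : P.IsPrime) (hQ : Q.IsPrime) (hPQ : P ≤ Q) (hI : I ∈ XS K P) :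
    loc (above Q) I ∈ ZS K P Q :=
  ⟨hI.1.trans_le (le_loc _ _), (loc_mono hI.2).trans (ringAt_mem_ZS hP hQ hPQ).2.2, loc_loc_le _ _⟩

/-- Elements of `XS K Q` are modules over the semilocalization above `Q`. -/
theorem local_of_mem_XS (hP : P ∈ hiSpec D) (hI : I ∈ XS K P) : loc (above P) I ≤ I := by
  intro x hx
  refine mem_of_forall_child hD hP hI ?_ fun Q hQ => ?_
  · exact ((loc_mono hI.2).trans (loc_ringAt_le (avoid_above_le hP.1))) hx
  · exact loc_le_loc (avoid_anti (V := above Q) (W := above P) fun M hM => ⟨hM.1, hQ.2.2.1.le.trans hM.2⟩) _ hx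

end LocalModules

end Paper

namespace Paper

section Systems

variable {D : Type*} [CommRing D] {K : Type*} [Field K] [Algebra D K]

/-- A set of submodules of `K` inside `X` that is stable under the scalars of `G` and under
the infima of nonempty families that lie in `X`. -/
structure IsSys (X : Set (Submodule D K)) (G : Set K) (C : Set (Submodule D K)) : Prop where
  sub : C ⊆ X
  act : ∀ g ∈ G, ∀ I ∈ C, sc g I ∈ C
  inf : ∀ S ⊆ C, S.Nonempty → sInf S ∈ X → sInf S ∈ C

variable {Y : Type*} [PartialOrder Y] (f : Y ↪o Submodule D K) {X : Set (Submodule D K)}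
  (hr : Set.range f = X)
  (hX : ∀ S ⊆ X, S.Nonempty → ∀ I ∈ X, I ≤ sInf S → sInf S ∈ X) {G : Set K} {a : G → Y → Y}
  (ha : ∀ g y, f (a g y) = sc g.1 (f y))

include hr hX in
theorem isGLB_iff_sInf_image {S : Set Y} (hS : S.Nonempty) {y : Y} :
    IsGLB S y ↔ f y = sInf (f '' S) := by
  have hmem : ∀ y, f y ∈ X := fun y => hr ▸ Set.mem_range_self y
  constructor
  · intro h
    have hle : f y ≤ sInf (f '' S) := le_sInf (by
      rintro _ ⟨x, hx, rfl⟩; exact f.le_iff_le.2 (h.1 hx))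
    refine le_antisymm hle ?_
    have : sInf (f '' S) ∈ X := hX _ (by rintro _ ⟨x, _, rfl⟩; exact hmem x) (hS.image f) _
      (hmem y) hle
    rw [← hr] at this
    obtain ⟨z, hz⟩ := this
    rw [← hz, f.le_iff_le]
    refine h.2 fun x hx => f.le_iff_le.1 ?_
    rw [hz]; exact sInf_le ⟨x, hx, rfl⟩
  · intro h
    refine ⟨fun x hx => f.le_iff_le.1 (h ▸ sInf_le ⟨x, hx, rfl⟩), fun z hz => f.le_iff_le.1 ?_⟩
    rw [h]
    exact le_sInf (by rintro _ ⟨x, hx, rfl⟩; exact f.le_iff_le.2 (hz hx))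

include hr hX ha in
theorem isSys_image {C : Set Y} (h : IsInfSystem a C) : IsSys X G (f '' C) := by
  refine ⟨?_, ?_, ?_⟩
  · rintro _ ⟨y, _, rfl⟩; exact hr ▸ Set.mem_range_self y
  · rintro g hg _ ⟨y, hy, rfl⟩
    exact ⟨_, h.act ⟨g, hg⟩ y hy, ha _ _⟩
  · intro S hS hne hinf
    rw [← hr] at hinf
    obtain ⟨y, hy⟩ := hinf
    have hS' : f '' (f ⁻¹' S) = S := Set.image_preimage_eq_of_subset (hS.trans
      (Set.image_subset_range _ _))
    have hne' : (f ⁻¹' S).Nonempty := by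
      rw [← hS'] at hne; exact hne.of_image
    refine ⟨y, h.glb (f ⁻¹' S) ?_ hne' y
      ((isGLB_iff_sInf_image f hr hX hne').2 (by rw [hS', hy])), hy⟩
    intro x hx
    obtain ⟨z, hz, hzx⟩ := hS hx
    rwa [← f.injective hzx]

include hr hX ha in
theorem isInfSystem_preimage {C : Set (Submodule D K)} (h : IsSys X G C) :
    IsInfSystem a (f ⁻¹' C) := by
  refine ⟨fun g x hx => ?_, fun S hS hne y hy => ?_⟩
  · rw [Set.mem_preimage, ha]; exact h.act _ g.2 _ hx
  · have hyy := (isGLB_iff_sInf_image f hr hX hne).1 hy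
    rw [Set.mem_preimage, hyy]
    refine h.inf _ (by rintro _ ⟨x, hx, rfl⟩; exact hS hx) (hne.image f) ?_
    rw [← hyy, ← hr]; exact Set.mem_range_self y

/-- Inf-systems of a poset embedded in the submodules of `K` as systems of submodules. -/
def sysIso (p : Set Y → Prop) (q : Set (Submodule D K) → Prop) (hpq : ∀ C, p C ↔ q (f '' C)) :
    {C : Set Y // IsInfSystem a C ∧ p C} ≃o
      {C : Set (Submodule D K) // IsSys X G C ∧ q C} where
  toFun C := ⟨f '' C.1, isSys_image f hr hX ha C.2.1, (hpq _).1 C.2.2⟩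
  invFun C := ⟨f ⁻¹' C.1, isInfSystem_preimage f hr hX ha C.2.1, by
    rw [hpq, Set.image_preimage_eq_of_subset (hr ▸ C.2.1.sub)]; exact C.2.2⟩
  left_inv C := Subtype.ext (Set.preimage_image_eq _ f.injective)
  right_inv C := Subtype.ext (Set.image_preimage_eq_of_subset (hr ▸ C.2.1.sub))
  map_rel_iff' := by
    intro C C'
    exact Set.image_subset_image_iff f.injective

end Systems

section Decomposition

variable {D : Type*} [CommRing D] [IsDomain D] {K : Type*} [Field K] [Algebra D K]
  [IsFractionRing D K]

local notation "α" => algebraMap D K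

variable {P Q : Ideal D}

variable (K) in
/-- The systems in `XS K P` that contain `D_P`. -/
abbrev SS (P : Ideal D) : Type _ :=
  {C : Set (Submodule D K) // IsSys (XS K P) (unitAt K P) C ∧ ringAt K P ∈ C}

variable (K) in
/-- The systems in `ZS K P Q` that do not contain `D_P`. -/
abbrev FS (P Q : Ideal D) : Type _ :=
  {C : Set (Submodule D K) // IsSys (ZS K P Q) (unitAt K P) C ∧ ringAt K P ∉ C}

theorem XS_nice : ∀ S ⊆ XS K P, S.Nonempty → ∀ I ∈ XS K P, I ≤ sInf S → sInf S ∈ XS K P :=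
  fun _ hS ⟨_, hJ⟩ _ hI h => ⟨hI.1.trans_le h, (sInf_le hJ).trans (hS hJ).2⟩

theorem ZS_nice : ∀ S ⊆ ZS K P Q, S.Nonempty → ∀ I ∈ ZS K P Q, I ≤ sInf S → sInf S ∈ ZS K P Q :=
  fun _ hS hne _ hI h => sInf_mem_ZS hS hne (hI.1.trans_le h)

instance [h : Fact (DirectlyBelow D P Q)] : OrderTop (ZS K P Q) where
  top := ⟨ringAt K P, ringAt_mem_ZS h.out.1.1 h.out.2.1.1 h.out.2.2.1.le⟩
  le_top I := I.2.2.1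

theorem ZS_top_val [h : Fact (DirectlyBelow D P Q)] : (⊤ : ZS K P Q).1 = ringAt K P := rfl

/-- The action of the units of `D_P` on `ZS K P Q`. -/
def zAct [h : Fact (DirectlyBelow D P Q)] (g : unitAt K P) (I : ZS K P Q) : ZS K P Q :=
  ⟨sc g.1 I.1, sc_mem_ZS h.out.1.1 g.2 I.2⟩

theorem ZS_eq_top_iff [h : Fact (DirectlyBelow D P Q)] {I : ZS K P Q} :
    I = ⊤ ↔ I.1 = ringAt K P := Subtype.ext_iff

/-- An enumeration of the elements of `hiSpec D` directly above `P`. -/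
structure IsChildEnum {ι : Type*} (P : Ideal D) (e : ι → Ideal D) : Prop where
  child : ∀ i, DirectlyBelow D P (e i)
  inj : Function.Injective e
  surj : ∀ Q, DirectlyBelow D P Q → ∃ i, e i = Q

variable {ι : Type*} {e : ι → Ideal D} [hF : ∀ i, Fact (DirectlyBelow D P (e i))]

/-- The intersection of a family of modules over the semilocalizations above the children. -/
def glue (z : ∀ i, ZS K P (e i)) : Submodule D K := ringAt K P ⊓ ⨅ i, (z i).1

theorem mem_glue {z : ∀ i, ZS K P (e i)} {x : K} :
    x ∈ glue z ↔ x ∈ ringAt K P ∧ ∀ i, x ∈ (z i).1 := by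
  simp [glue, Submodule.mem_iInf]

theorem glue_act (hP : P.IsPrime) (g : unitAt K P) (z : ∀ i, ZS K P (e i)) :
    glue (piAct (fun i => zAct (Q := e i)) g z) = sc g.1 (glue z) := by
  ext x
  have hg := unitAt_ne_zero g.2
  rw [mem_sc hg, mem_glue, mem_glue, ← mem_sc hg, sc_unit_ringAt hP g.2]
  refine and_congr_right fun _ => forall_congr' fun i => ?_
  rw [← mem_sc hg]; rfl

variable (hD : IsSemilocalPrufer D K) (hP : P ∈ hiSpec D) (he : IsChildEnum P e)
include hD hP he

theorem zAct_isPushing [Finite ι] : IsPushing (fun i => zAct (K := K) (P := P) (Q := e i)) := by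
  have hPp := hP.1
  refine ⟨fun i g z => ?_, fun i z w => ?_, fun i z w hzw => ?_, fun i x y hxy => ?_⟩
  · rw [ZS_eq_top_iff, ZS_eq_top_iff]
    change sc g.1 z.1 = _ ↔ _
    conv_lhs => rw [← sc_unit_ringAt hPp g.2]
    have hg := unitAt_ne_zero g.2
    constructor
    · intro h
      rw [← sc_inv_sc hg z.1, h, sc_inv_sc hg]
    · intro h; rw [h]
  · obtain ⟨s, hs, hsz⟩ := exists_notMem_of_maxAt_lt hPp z.2.1 z.2.2.1
    obtain ⟨t, ht, htw⟩ := exists_notMem_of_maxAt_lt hPp w.2.1 w.2.2.1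
    have hmem : sInf {z.1, w.1} ∈ ZS K P (e i) := by
      refine sInf_mem_ZS (by rintro _ (rfl | rfl) <;> simp) (by simp) ?_
      refine lt_of_le_of_ne (le_sInf (by rintro _ (rfl | rfl); exacts [z.2.1.le, w.2.1.le])) ?_
      intro h
      apply hPp.mul_notMem hs ht
      rw [← map_mem_maxAt (K := K) hPp, h, sInf_pair, map_mul, Submodule.mem_inf]
      constructor
      · rw [mul_comm, ← Algebra.smul_def]; exact z.1.smul_mem _ hsz
      · rw [← Algebra.smul_def]; exact w.1.smul_mem _ htw
    refine ⟨⟨_, hmem⟩, fun I hI => ?_, fun I hI => ?_⟩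
    · change sInf {z.1, w.1} ≤ I.1
      apply sInf_le
      rcases hI with rfl | rfl <;> simp
    · change I.1 ≤ sInf {z.1, w.1}
      refine le_sInf ?_
      rintro _ (rfl | rfl)
      · exact hI (Set.mem_insert _ _)
      · exact hI (Set.mem_insert_of_mem _ rfl)
  · have hch := he.child i
    by_cases hz : z = ⊤
    · refine ⟨⟨1, unitAt_one hPp⟩, ?_⟩
      rw [hzw hz]
      change z.1 ≤ sc 1 (ringAt K P)
      rw [sc_one]; exact z.2.2.1
    · obtain ⟨c, hc, hle⟩ := exists_smul_le hD hch.2.1.1 hPp hch.2.2.1 w.2 z.2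
        (fun h => hz (ZS_eq_top_iff.2 h))
      have hcu := map_mem_unitAt (K := K) hPp hc
      refine ⟨⟨(α c)⁻¹, unitAt_inv hcu⟩, fun v hv => ?_⟩
      change v ∈ sc (α c)⁻¹ w.1
      rw [mem_sc (inv_ne_zero (unitAt_ne_zero hcu)), inv_inv, ← Algebra.smul_def]
      exact hle v hv
  · have hs : ∀ j, ∃ s ∉ P, ∀ v ∈ (y j).1, s • v ∈ (x j).1 := by
      intro j
      have hch := he.child j
      by_cases hy : y j = ⊤
      · refine ⟨1, hPp.one_notMem, fun v hv => ?_⟩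
        rw [hxy j hy, one_smul]
        exact (y j).2.2.1 hv
      · exact exists_smul_le hD hch.2.1.1 hPp hch.2.2.1 (x j).2 (y j).2
          (fun h => hy (ZS_eq_top_iff.2 h))
    choose s hsP hs using hs
    classical
    have := Fintype.ofFinite ι
    have hprod : ∏ j, s j ∉ P := fun h => by
      obtain ⟨j, _, hj⟩ := (Ideal.IsPrime.prod_mem_iff (hp := hPp)).1 h
      exact hsP j hj
    obtain ⟨a, ha, b, hb, t, hab⟩ := exists_independent hD (he.child i) hprod
    have hch := he.child i
    have haQ : a ∉ e i := (mem_avoid_singleton hch.2.1.1).1 (avoid_above_le hch.2.1.1 ha)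
    have haP : a ∉ P := fun h => haQ (hch.2.2.1.le h)
    have hau := map_mem_unitAt (K := K) hPp haP
    have ha0 := inv_ne_zero (unitAt_ne_zero hau)
    refine ⟨⟨(α a)⁻¹, unitAt_inv hau⟩, fun z => Subtype.ext (le_antisymm ?_ ?_), fun j hj => ?_⟩
    · intro v hv
      change v ∈ sc (α a)⁻¹ z.1 at hv
      rw [mem_sc ha0, inv_inv, ← Algebra.smul_def] at hv
      exact z.2.2.2 ⟨a, ha, hv⟩
    · intro v hv
      change v ∈ sc (α a)⁻¹ z.1
      rw [mem_sc ha0, inv_inv, ← Algebra.smul_def]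
      exact z.1.smul_mem _ hv
    · intro v hv
      change v ∈ sc (α a)⁻¹ (x j).1
      rw [mem_sc ha0, inv_inv, ← Algebra.smul_def]
      refine (x j).2.2.2 ⟨b, ?_, ?_⟩
      · exact avoid_anti (above_subset_aboveOthers (he.child j) fun h => hj (he.inj h)) hb
      · rw [← mul_smul, mul_comm b, hab, ← Finset.mul_prod_erase _ _ (Finset.mem_univ j),
          mul_assoc, mul_comm, mul_smul]
        exact Submodule.smul_mem _ _ (hs j v hv)

theorem exists_mem_of_notMem [Finite ι] (z : ∀ i, ZS K P (e i)) {y : K} (hy : y ∈ ringAt K P) :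
    ∃ s ∉ P, ∀ i, s • y ∈ (z i).1 := by
  have hPp := hP.1
  have hs : ∀ j, ∃ s ∉ P, s • y ∈ (z j).1 := by
    intro j
    obtain ⟨a, haP, ha⟩ := exists_notMem_of_maxAt_lt hPp (z j).2.1 (z j).2.2.1
    obtain ⟨b, t, ht, rfl⟩ := (mem_ringAt hPp).1 hy
    refine ⟨t * a, hPp.mul_notMem ht haP, ?_⟩
    have : (t * a) • (α b / α t) = b • α a := by
      rw [Algebra.smul_def, Algebra.smul_def, map_mul]
      field_simp [map_ne_zero_of_notMem (K := K) ht]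
    rw [this]; exact Submodule.smul_mem _ _ ha
  choose s hsP hs using hs
  classical
  have := Fintype.ofFinite ι
  refine ⟨∏ j, s j, fun h => ?_, fun i => ?_⟩
  · obtain ⟨j, _, hj⟩ := (Ideal.IsPrime.prod_mem_iff (hp := hPp)).1 h
    exact hsP j hj
  · rw [← Finset.mul_prod_erase _ _ (Finset.mem_univ i), mul_comm, mul_smul]
    exact Submodule.smul_mem _ _ (hs i)

theorem glue_mem_XS [Finite ι] (z : ∀ i, ZS K P (e i)) : glue z ∈ XS K P := by
  have hPp := hP.1
  refine ⟨lt_of_le_of_ne (le_inf (maxAt_le_ringAt hPp) (le_iInf fun i => (z i).2.1.le)) ?_,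
    inf_le_left⟩
  intro h
  obtain ⟨s, hs, hsz⟩ := exists_mem_of_notMem hD hP he z (one_mem_ringAt (K := K) hPp)
  apply hs
  rw [← map_mem_maxAt (K := K) hPp, h, mem_glue]
  refine ⟨map_mem_ringAt hPp s, fun i => ?_⟩
  have := hsz i
  rwa [Algebra.smul_def, mul_one] at this

theorem loc_glue [Finite ι] (z : ∀ i, ZS K P (e i)) (i : ι) :
    loc (above (e i)) (glue z) = (z i).1 := by
  have hPp := hP.1
  apply le_antisymm
  · exact (loc_mono (inf_le_right.trans (iInf_le _ i))).trans (z i).2.2.2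
  · intro y hy
    have hyR := (z i).2.2.1 hy
    obtain ⟨s, hs, hsz⟩ := exists_mem_of_notMem hD hP he z hyR
    obtain ⟨a, ha, b, hb, t, hab⟩ := exists_independent hD (he.child i) hs
    refine ⟨a, ha, mem_glue.2 ⟨Submodule.smul_mem _ _ hyR, fun j => ?_⟩⟩
    by_cases hj : j = i
    · subst hj; exact Submodule.smul_mem _ _ hy
    · refine (z j).2.2.2 ⟨b, ?_, ?_⟩
      · exact avoid_anti (above_subset_aboveOthers (he.child j) fun h => hj (he.inj h)) hb
      · rw [← mul_smul, mul_comm b, hab, mul_comm, mul_smul]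
        exact Submodule.smul_mem _ _ (hsz j)

omit [∀ i, Fact (DirectlyBelow D P (e i))] in
theorem eq_inf_loc {I : Submodule D K} (hI : I ∈ XS K P) :
    I = ringAt K P ⊓ ⨅ i, loc (above (e i)) I := by
  apply le_antisymm
  · exact le_inf hI.2 (le_iInf fun i => le_loc _ _)
  · intro x hx
    rw [Submodule.mem_inf, Submodule.mem_iInf] at hx
    refine mem_of_forall_child hD hP hI hx.1 fun Q hQ => ?_
    obtain ⟨i, rfl⟩ := he.surj Q hQ
    exact hx.2 i

/-- The systems in `XS K P` are described by families of systems in the `ZS K P Q`. -/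
theorem exists_famIso [Finite ι] :
    ∃ Φ : SS K P ≃o {c : Set ι → ∀ i, FS K P (e i) // IsFam c}, ∀ C S,
      S ∈ FamSupp (Φ C).1 ↔ ∃ I ∈ C.1, {i | loc (above (e i)) I ≠ ringAt K P} = S := by
  have hPp := hP.1
  have hch := he.child
  let f : (∀ i, ZS K P (e i)) ↪o Submodule D K := OrderEmbedding.ofMapLEIff glue (by
    intro z w
    constructor
    · intro h i
      change (z i).1 ≤ (w i).1
      rw [← loc_glue hD hP he z i, ← loc_glue hD hP he w i]
      exact loc_mono h
    · intro h
      exact inf_le_inf_left _ (iInf_mono h))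
  have hr : Set.range f = XS K P := by
    ext I
    constructor
    · rintro ⟨z, rfl⟩; exact glue_mem_XS hD hP he z
    · intro hI
      exact ⟨fun i => ⟨loc (above (e i)) I, loc_mem_ZS hD hPp (hch i).2.1.1 (hch i).2.2.1.le hI⟩,
        (eq_inf_loc hD hP he hI).symm⟩
  have hftop : f ⊤ = ringAt K P := by
    change ringAt K P ⊓ _ = _
    rw [inf_eq_left]
    exact le_iInf fun i => le_rfl
  let Ψ := sysIso f hr XS_nice (a := piAct fun i => zAct (K := K) (P := P) (Q := e i))
    (fun g z => glue_act hPp g z) (⊤ ∈ ·) (ringAt K P ∈ ·) (fun C => by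
      rw [← hftop, f.injective.mem_set_image])
  let Ψ' : ∀ i, ProperSystem (zAct (K := K) (P := P) (Q := e i)) ≃o FS K P (e i) := fun i =>
    sysIso (OrderEmbedding.subtype (· ∈ ZS K P (e i))) (by simp) ZS_nice (fun g z => rfl)
      (⊤ ∉ ·) (ringAt K P ∉ ·) (fun C => by
        rw [← ZS_top_val (Q := e i)]
        exact (Subtype.val_injective.mem_set_image).not.symm)
  have hpush := zAct_isPushing hD hP he
  refine ⟨(Ψ.symm.trans hpush.orderIso).trans (famCongr Ψ'), fun C S => ?_⟩
  change S ∈ FamSupp (fun S i => Ψ' i (hpush.fam (Ψ.symm C) S i)) ↔ _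
  rw [famSupp_congr, hpush.mem_famSupp]
  have key : ∀ z : ∀ i, ZS K P (e i), properSet z = {i | loc (above (e i)) (glue z) ≠ ringAt K P} := by
    intro z
    ext i
    simp only [properSet, Set.mem_ofPred_eq, loc_glue hD hP he z, ne_eq, ZS_eq_top_iff]
  constructor
  · rintro ⟨z, hz, rfl⟩
    exact ⟨glue z, hz, (key z).symm⟩
  · rintro ⟨I, hI, rfl⟩
    have : I ∈ Set.range f := hr ▸ C.2.1.sub hI
    obtain ⟨z, rfl⟩ := this
    exact ⟨z, hI, key z⟩

end Decomposition

end Paper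

namespace Paper

section Splitting

variable {D : Type*} [CommRing D] [IsDomain D] {K : Type*} [Field K] [Algebra D K]
  [IsFractionRing D K]

local notation "α" => algebraMap D K

variable {P Q : Ideal D} {I J : Submodule D K} {C : Set (Submodule D K)}

variable (K) in
/-- The systems of proper `D_Q`-modules in `XS K P`. -/
abbrev CS (P Q : Ideal D) : Type _ :=
  {C : Set (Submodule D K) // IsSys (US K P Q) (unitAt K P) C}

theorem ringAt_lt (hP : P.IsPrime) (hQ : Q.IsPrime) (h : P < Q) : ringAt K Q < ringAt K P := by
  refine lt_of_le_not_ge (ringAt_anti hP hQ h.le) fun hle => ?_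
  obtain ⟨q, hqQ, hqP⟩ := SetLike.exists_of_lt h
  have h1 : (α q)⁻¹ ∈ ringAt K P :=
    ((mem_unitAt hP).1 (unitAt_inv (map_mem_unitAt hP hqP))).1
  exact inv_notMem_ringAt hQ ((map_mem_maxAt hQ).2 hqQ) (map_ne_zero_of_notMem hqP) (hle h1)

theorem US_subset_ZS (hQ : Q.IsPrime) : US K P Q ⊆ ZS K P Q :=
  fun _ h => ⟨h.1, h.2.1.le, (loc_le_loc (avoid_above_le hQ) _).trans h.2.2⟩

theorem isSys_US (hP : P.IsPrime) : IsSys (US K P Q) (unitAt K P) (US K P Q) :=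
  ⟨subset_rfl, fun _ hg _ hI => sc_mem_US hP hg hI, fun _ _ _ h => h⟩

theorem CS_isTop_iff (hP : P.IsPrime) (B : CS K P Q) : IsTop B ↔ B.1 = US K P Q := by
  constructor
  · intro h
    exact B.2.sub.antisymm (h ⟨_, isSys_US hP⟩)
  · intro h A
    change A.1 ⊆ B.1
    rw [h]; exact A.2.sub

theorem isSys_singleton (hQ : Q.IsPrime) : IsSys (XS K Q) (unitAt K Q) {ringAt K Q} := by
  refine ⟨?_, ?_, ?_⟩
  · rintro _ rfl; exact ⟨maxAt_lt_ringAt hQ, le_rfl⟩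
  · rintro g hg _ rfl; exact sc_unit_ringAt hQ hg
  · intro S hS hne _
    rw [(Set.Nonempty.subset_singleton_iff hne).1 hS]; simp

theorem SS_isBot_iff (hQ : Q.IsPrime) (A : SS K Q) : IsBot A ↔ A.1 = {ringAt K Q} := by
  constructor
  · intro h
    have hle : A.1 ⊆ {ringAt K Q} := h ⟨_, isSys_singleton hQ, rfl⟩
    exact hle.antisymm (by rintro _ rfl; exact A.2.2)
  · intro h B
    change A.1 ⊆ B.1
    rw [h]; rintro _ rfl; exact B.2.2

/-- If `J` is an intersection of multiples of `I`, up to elements outside `D_P`, then every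
system containing `I` contains `J`. -/
theorem IsSys.mem_of_forall_exists {X : Set (Submodule D K)} (hC : IsSys X (unitAt K P) C)
    (hX : ∀ I ∈ X, I ≤ ringAt K P) (hI : I ∈ C) (hJ : J ∈ X) (hJP : J ≠ ringAt K P)
    (h : ∀ x ∈ ringAt K P, x ∉ J → ∃ g ∈ unitAt K P, J ≤ sc g I ∧ x ∉ sc g I) : J ∈ C := by
  have hS : {L | ∃ g ∈ unitAt K P, J ≤ sc g I ∧ L = sc g I} ⊆ C := by
    rintro _ ⟨g, hg, _, rfl⟩; exact hC.act g hg I hI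
  obtain ⟨x, hx, hxJ⟩ := SetLike.exists_of_lt (lt_of_le_of_ne (hX J hJ) hJP)
  obtain ⟨g, hg, hJg, _⟩ := h x hx hxJ
  have hne : {L | ∃ g ∈ unitAt K P, J ≤ sc g I ∧ L = sc g I}.Nonempty := ⟨_, g, hg, hJg, rfl⟩
  have : sInf {L | ∃ g ∈ unitAt K P, J ≤ sc g I ∧ L = sc g I} = J := by
    apply le_antisymm
    · intro y hy
      by_contra hyJ
      have hyR : y ∈ ringAt K P :=
        hX _ (hC.sub (hC.act g hg I hI)) ((Submodule.mem_sInf.1 hy) _ ⟨g, hg, hJg, rfl⟩)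
      obtain ⟨g', hg', hJg', hy'⟩ := h y hyR hyJ
      exact hy' ((Submodule.mem_sInf.1 hy) _ ⟨g', hg', hJg', rfl⟩)
    · refine le_sInf ?_
      rintro _ ⟨g, _, h, rfl⟩; exact h
  rw [← this] at hJ ⊢
  exact hC.inf _ hS hne hJ

theorem not_local_of_mem_XS (hQ : Q.IsPrime) (hI : I ∈ XS K Q) (hne : I ≠ ringAt K Q) :
    ¬ loc {Q} I ≤ I := by
  intro h
  obtain ⟨a, ha, haI⟩ := exists_notMem_of_maxAt_lt hQ hI.1 hI.2
  have hau := map_mem_unitAt (K := K) hQ ha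
  refine hne (le_antisymm hI.2 fun r hr => ?_)
  have := mul_mem_of_local hQ h (ringAt_mul hQ hr ((mem_unitAt hQ).1 (unitAt_inv hau)).1) haI
  rwa [mul_assoc, inv_mul_cancel₀ (unitAt_ne_zero hau), mul_one] at this

theorem mem_unitAt_of_mem_XS (hQ : Q.IsPrime) {g : K} (hI : I ∈ XS K Q) (hg0 : g ≠ 0)
    (hgI : sc g I ∈ XS K Q) : g ∈ unitAt K Q := by
  have key : ∀ {g : K} {I : Submodule D K}, I ∈ XS K Q → sc g I ≤ ringAt K Q →
      g ∈ ringAt K Q := by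
    intro g I hI hgI
    obtain ⟨a, ha, haI⟩ := exists_notMem_of_maxAt_lt hQ hI.1 hI.2
    have hau := map_mem_unitAt (K := K) hQ ha
    have := ringAt_mul hQ (hgI (mul_mem_sc haI)) ((mem_unitAt hQ).1 (unitAt_inv hau)).1
    rwa [mul_assoc, mul_inv_cancel₀ (unitAt_ne_zero hau), mul_one] at this
  refine (mem_unitAt hQ).2 ⟨key hI hgI.2, fun h => ?_⟩
  refine inv_notMem_ringAt hQ h hg0 (key hgI ?_)
  rw [sc_inv_sc hg0]; exact hI.2

variable (hD : IsSemilocalPrufer D K)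
include hD

theorem XS_subset_ZS (h : DirectlyBelow D P Q) : XS K Q ⊆ ZS K P Q := fun _ hI =>
  ⟨(maxAt_mono hD.prufer h.1.1 h.2.1.1 h.2.2.1.le).trans_lt hI.1,
    hI.2.trans (ringAt_anti h.1.1 h.2.1.1 h.2.2.1.le), local_of_mem_XS hD h.2.1 hI⟩

theorem exists_sc_mem_XS (h : DirectlyBelow D P Q) (hI : I ∈ ZS K P Q) (hnl : ¬ loc {Q} I ≤ I) :
    ∃ g ∈ unitAt K P, sc g I ∈ XS K Q ∧ sc g I ≠ ringAt K Q := by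
  have hP := h.1.1
  have hQ := h.2.1.1
  obtain ⟨x, hx, hxI⟩ := SetLike.not_le_iff_exists.1 hnl
  have hxR : x ∈ ringAt K P := ((loc_mono hI.2.1).trans (loc_ringAt_le (avoid_le (by
    rintro N hN hNp
    rw [Set.mem_singleton_iff.1 hN]
    exact ⟨Q, rfl, hQ, h.2.2.1.le⟩)))) hx
  have hxu := mem_unitAt_of_mem_of_notMem hP hI.1.le le_rfl hxI hxR
  have hx0 := unitAt_ne_zero hxu
  obtain ⟨s, hs, hsx⟩ := hx
  rw [mem_avoid_singleton hQ] at hs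
  have hsI : α s ∈ sc x⁻¹ I := by
    rw [mem_sc (inv_ne_zero hx0), inv_inv, mul_comm, ← Algebra.smul_def]; exact hsx
  refine ⟨x⁻¹, unitAt_inv hxu, ⟨lt_of_le_of_ne ?_ ?_, ?_⟩, ?_⟩
  · intro m hm
    have hs0 := map_ne_zero_of_notMem (K := K) hs
    have h1 : (α s)⁻¹ * m ∈ maxAt K Q :=
      ringAt_mul_maxAt hQ ((mem_unitAt hQ).1 (unitAt_inv (map_mem_unitAt hQ hs))).1 hm
    have h2 := mul_mem_of_above hD (loc_sc_le (inv_ne_zero hx0) hI.2.2)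
      (fun M hM => maxAt_le_ringAt_above hD hQ hM h1) hsI
    rwa [mul_comm, mul_inv_cancel_left₀ hs0] at h2
  · intro heq
    rw [← heq, map_mem_maxAt hQ] at hsI
    exact hs hsI
  · intro y hy
    rw [mem_sc (inv_ne_zero hx0), inv_inv] at hy
    have := div_mem_ringAt hD hQ hI.2.2 hxI hy
    rwa [inv_mul_cancel_left₀ hx0] at this
  · intro heq
    have := heq ▸ one_mem_ringAt (K := K) hQ
    rw [mem_sc (inv_ne_zero hx0), inv_inv, mul_one] at this
    exact hxI this

theorem US_subset_of_not_local (h : DirectlyBelow D P Q) (hC : IsSys (ZS K P Q) (unitAt K P) C)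
    (hI : I ∈ C) (hnl : ¬ loc {Q} I ≤ I) : US K P Q ⊆ C := by
  have hP := h.1.1
  have hQ := h.2.1.1
  obtain ⟨g, hg, hgX, hgne⟩ := exists_sc_mem_XS hD h (hC.sub hI) hnl
  obtain ⟨z, hz, hzI⟩ := SetLike.exists_of_lt (lt_of_le_of_ne hgX.2 hgne)
  have hzu := mem_unitAt_of_mem_of_notMem hQ hgX.1.le le_rfl hzI hz
  have hz0 := unitAt_ne_zero hzu
  intro J hJ
  refine hC.mem_of_forall_exists (fun I hI => hI.2.1) (hC.act g hg I hI) (US_subset_ZS hQ hJ)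
    hJ.2.1.ne fun x hx hxJ => ?_
  have hxu := mem_unitAt_of_mem_of_notMem hP hJ.1.le le_rfl hxJ hx
  have hx0 := unitAt_ne_zero hxu
  have hxz : x * z⁻¹ ≠ 0 := mul_ne_zero hx0 (inv_ne_zero hz0)
  refine ⟨x * z⁻¹, unitAt_mul hP hxu (unitAt_anti h.2.2.1.le (unitAt_inv hzu)), ?_, ?_⟩
  · intro y hy
    rw [mem_sc hxz]
    apply hgX.1.le
    have : (x * z⁻¹)⁻¹ * y = z * (x⁻¹ * y) := by rw [mul_inv, inv_inv]; ring
    rw [this]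
    exact ringAt_mul_maxAt hQ hz (div_mem_maxAt_of_local hD.prufer hQ hJ.2.2 hxJ hy)
  · rw [mem_sc hxz]
    have : (x * z⁻¹)⁻¹ * x = z := by field_simp
    rwa [this]

omit hD

/-- The part of a system in `ZS K P Q` between the maximal ideal of `D_Q` and `D_Q`. -/
def lowerPart (Q : Ideal D) (C : Set (Submodule D K)) : Set (Submodule D K) :=
  {I | I = ringAt K Q ∨ I ∈ C ∧ I ∈ XS K Q ∧ I ≠ ringAt K Q}

/-- The system in `ZS K P Q` with prescribed lower part and part of `D_Q`-modules. -/
def assemble (P Q : Ideal D) (A B : Set (Submodule D K)) : Set (Submodule D K) :=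
  {J | J ∈ ZS K P Q ∧ J ≠ ringAt K P ∧ (loc {Q} J ≤ J → J ∈ B) ∧
    ∀ g ∈ unitAt K P, sc g J ∈ XS K Q → sc g J ≠ ringAt K Q → sc g J ∈ A}

include hD

theorem isSys_lowerPart (h : DirectlyBelow D P Q) (hC : IsSys (ZS K P Q) (unitAt K P) C) :
    IsSys (XS K Q) (unitAt K Q) (lowerPart Q C) := by
  have hQ := h.2.1.1
  refine ⟨?_, ?_, ?_⟩
  · rintro I (rfl | hI)
    · exact ⟨maxAt_lt_ringAt hQ, le_rfl⟩
    · exact hI.2.1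
  · rintro g hg I (rfl | hI)
    · exact Or.inl (sc_unit_ringAt hQ hg)
    · refine Or.inr ⟨hC.act g (unitAt_anti h.2.2.1.le hg) I hI.1, sc_mem_XS hQ hg hI.2.1, ?_⟩
      intro heq
      apply hI.2.2
      rw [← sc_inv_sc (unitAt_ne_zero hg) I, heq, sc_unit_ringAt hQ (unitAt_inv hg)]
  · intro S hS hne hinf
    by_cases hS' : (S \ {ringAt K Q}).Nonempty
    · have hsub : S \ {ringAt K Q} ⊆ C := fun I hI => ((hS hI.1).resolve_left hI.2).1
      have heq : sInf S = sInf (S \ {ringAt K Q}) := by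
        apply le_antisymm (sInf_le_sInf Set.sdiff_subset)
        refine le_sInf fun I hI => ?_
        by_cases hIQ : I = ringAt K Q
        · obtain ⟨L, hL⟩ := hS'
          exact (sInf_le hL).trans (hIQ ▸ ((hS hL.1).resolve_left hL.2).2.1.2)
        · exact sInf_le ⟨hI, hIQ⟩
      refine Or.inr ⟨?_, hinf, ?_⟩
      · rw [heq] at hinf ⊢
        exact hC.inf _ hsub hS' (XS_subset_ZS hD h hinf)
      · intro he
        obtain ⟨L, hL⟩ := hS'
        have hL' := (hS hL.1).resolve_left hL.2
        exact hL'.2.2 (le_antisymm hL'.2.1.2 (he ▸ sInf_le hL.1))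
    · rw [Set.not_nonempty_iff_eq_empty, Set.sdiff_eq_empty] at hS'
      rw [(Set.Nonempty.subset_singleton_iff hne).1 hS']
      left; simp

omit hD in
theorem isSys_inter_US (hP : P.IsPrime) (hQ : Q.IsPrime) (hC : IsSys (ZS K P Q) (unitAt K P) C) :
    IsSys (US K P Q) (unitAt K P) (C ∩ US K P Q) :=
  ⟨Set.inter_subset_right, fun g hg _ hI => ⟨hC.act g hg _ hI.1, sc_mem_US hP hg hI.2⟩,
    fun S hS hne h => ⟨hC.inf S (fun _ hI => (hS hI).1) hne (US_subset_ZS hQ h), h⟩⟩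

theorem isSys_assemble (h : DirectlyBelow D P Q) {A B : Set (Submodule D K)}
    (hA : IsSys (XS K Q) (unitAt K Q) A) (hB : IsSys (US K P Q) (unitAt K P) B)
    (hAB : A = {ringAt K Q} ∨ B = US K P Q) :
    IsSys (ZS K P Q) (unitAt K P) (assemble P Q A B) := by
  have hP := h.1.1
  have hQ := h.2.1.1
  refine ⟨fun J hJ => hJ.1, ?_, ?_⟩
  · rintro g hg J ⟨h1, h2, h3, h4⟩
    have hg0 := unitAt_ne_zero hg
    refine ⟨sc_mem_ZS hP hg h1, fun heq => ?_, fun hl => ?_, fun g' hg' hX hne => ?_⟩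
    · apply h2
      rw [← sc_inv_sc hg0 J, heq, sc_unit_ringAt hP (unitAt_inv hg)]
    · rw [loc_sc hg0, sc_le_sc_iff hg0] at hl
      exact hB.act g hg J (h3 hl)
    · rw [sc_sc] at hX hne ⊢
      exact h4 _ (unitAt_mul hP hg' hg) hX hne
  · intro S hS hne hinf
    have hltP : sInf S ≠ ringAt K P := fun heq => by
      obtain ⟨L, hL⟩ := hne
      exact (hS hL).2.1 (le_antisymm (hS hL).1.2.1 (heq ▸ sInf_le hL))
    refine ⟨hinf, hltP, fun hl => ?_, fun g hg hX hgne => ?_⟩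
    · have hU : sInf S ∈ US K P Q := ⟨hinf.1, lt_of_le_of_ne hinf.2.1 hltP, hl⟩
      rcases hAB with hAB | hAB
      · refine hB.inf S (fun J hJ => ?_) hne hU
        obtain ⟨h1, h2, h3, h4⟩ := hS hJ
        apply h3
        by_contra hnl
        obtain ⟨g, hg, hgX, hgne⟩ := exists_sc_mem_XS hD h h1 hnl
        have := h4 g hg hgX hgne
        rw [hAB] at this
        exact hgne this
      · rwa [hAB]
    · have hg0 := unitAt_ne_zero hg
      have hT : sc g (sInf S) = sInf ({X | X ∈ sc g '' S ∧ X < ringAt K Q}) := by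
        rw [sc_sInf hg0]
        apply le_antisymm (sInf_le_sInf fun X hX => hX.1)
        refine le_sInf ?_
        rintro _ ⟨J, hJ, rfl⟩
        have hgJ := sc_mem_ZS hP hg (hS hJ).1
        by_cases hlt : sc g J < ringAt K Q
        · exact sInf_le ⟨⟨J, hJ, rfl⟩, hlt⟩
        · have hge : ringAt K Q ≤ sc g J := (ringAt_le_or_le hD hQ hgJ.2.2).elim id
            fun hle => (eq_of_le_of_not_lt hle hlt).ge
          have hex : ∃ J' ∈ S, sc g J' < ringAt K Q := by
            by_contra! hall
            apply hgne
            apply le_antisymm hX.2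
            rw [sc_sInf hg0]
            refine le_sInf ?_
            rintro _ ⟨J', hJ', rfl⟩
            exact (ringAt_le_or_le hD hQ (sc_mem_ZS hP hg (hS hJ').1).2.2).elim id
              fun hle => (eq_of_le_of_not_lt hle (hall J' hJ')).ge
          obtain ⟨J', hJ', hlt'⟩ := hex
          exact (sInf_le (show sc g J' ∈ {X | X ∈ sc g '' S ∧ X < ringAt K Q} from
            ⟨⟨J', hJ', rfl⟩, hlt'⟩)).trans (hlt'.le.trans hge)
      have hne' : {X | X ∈ sc g '' S ∧ X < ringAt K Q}.Nonempty := by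
        rw [Set.nonempty_iff_ne_empty]
        intro hemp
        rw [hemp, sInf_empty] at hT
        rw [hT] at hX hgne
        exact hgne (le_antisymm hX.2 le_top)
      rw [hT] at hX ⊢
      refine hA.inf _ ?_ hne' hX
      rintro _ ⟨⟨J, hJ, rfl⟩, hlt⟩
      refine (hS hJ).2.2.2 g hg ⟨hX.1.trans_le (sInf_le ⟨⟨J, hJ, rfl⟩, hlt⟩), hlt.le⟩ hlt.ne

/-- A system in `ZS K P Q` avoiding `D_P` is determined by its lower part and its part of
`D_Q`-modules. -/
def splitIso (h : DirectlyBelow D P Q) :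
    FS K P Q ≃o {p : SS K Q × CS K P Q // IsBot p.1 ∨ IsTop p.2} :=
  Equiv.toOrderIso
    { toFun := fun C => ⟨⟨⟨lowerPart Q C.1, isSys_lowerPart hD h C.2.1, Or.inl rfl⟩,
        ⟨C.1 ∩ US K P Q, isSys_inter_US h.1.1 h.2.1.1 C.2.1⟩⟩, by
          rw [SS_isBot_iff h.2.1.1, CS_isTop_iff h.1.1, or_iff_not_imp_left]
          intro hne
          refine Set.inter_eq_right.2 ?_
          obtain ⟨I, hI⟩ : ∃ I, I ∈ C.1 ∧ I ∈ XS K Q ∧ I ≠ ringAt K Q := by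
            by_contra! hc
            apply hne
            ext I
            exact ⟨fun hI => hI.elim id fun hI => (hI.2.2 (hc I hI.1 hI.2.1)).elim, Or.inl⟩
          exact US_subset_of_not_local hD h C.2.1 hI.1
            (not_local_of_mem_XS h.2.1.1 hI.2.1 hI.2.2)⟩
      invFun := fun p => ⟨assemble P Q p.1.1.1 p.1.2.1, isSys_assemble hD h p.1.1.2.1 p.1.2.2
        ((SS_isBot_iff h.2.1.1 _).symm.or (CS_isTop_iff h.1.1 _).symm |>.2 p.2),
        fun hh => hh.2.1 rfl⟩
      left_inv := by
        intro C
        apply Subtype.ext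
        ext J
        constructor
        · rintro ⟨h1, h2, h3, h4⟩
          by_cases hl : loc {Q} J ≤ J
          · exact (h3 hl).1
          · obtain ⟨g, hg, hgX, hgne⟩ := exists_sc_mem_XS hD h h1 hl
            have := ((h4 g hg hgX hgne).resolve_left hgne).1
            have := C.2.1.act _ (unitAt_inv hg) _ this
            rwa [sc_inv_sc (unitAt_ne_zero hg)] at this
        · intro hJ
          have hJZ := C.2.1.sub hJ
          have hne : J ≠ ringAt K P := fun hh => C.2.2 (hh ▸ hJ)
          exact ⟨hJZ, hne, fun hl => ⟨hJ, hJZ.1, lt_of_le_of_ne hJZ.2.1 hne, hl⟩,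
            fun g hg hX hgne => Or.inr ⟨C.2.1.act g hg J hJ, hX, hgne⟩⟩
      right_inv := by
        rintro ⟨⟨A, B⟩, hAB⟩
        have hP := h.1.1
        have hQ := h.2.1.1
        apply Subtype.ext
        refine Prod.ext (Subtype.ext ?_) (Subtype.ext ?_)
        · ext I
          constructor
          · rintro (rfl | ⟨hI, hX, hne⟩)
            · exact A.2.2
            · have := hI.2.2.2 1 (unitAt_one hP)
              rw [sc_one] at this
              exact this hX hne
          · intro hI
            by_cases hIQ : I = ringAt K Q
            · exact Or.inl hIQ
            · have hX := A.2.1.sub hI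
              refine Or.inr ⟨⟨XS_subset_ZS hD h hX, ?_, ?_, ?_⟩, hX, hIQ⟩
              · exact (hX.2.trans_lt (ringAt_lt hP hQ h.2.2.1)).ne
              · intro hl
                exact (not_local_of_mem_XS hQ hX hIQ hl).elim
              · intro g hg hgX _
                exact A.2.1.act g (mem_unitAt_of_mem_XS hQ hX (unitAt_ne_zero hg) hgX) I hI
        · ext J
          constructor
          · rintro ⟨hJ, hU⟩
            exact hJ.2.2.1 hU.2.2
          · intro hJ
            have hU := B.2.sub hJ
            refine ⟨⟨US_subset_ZS hQ hU, hU.2.1.ne, fun _ => hJ, fun g hg hX hne => ?_⟩, hU⟩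
            exact (not_local_of_mem_XS hQ hX hne (loc_sc_le (unitAt_ne_zero hg) hU.2.2)).elim }
    (fun C C' hC => ⟨fun I hI => hI.imp_right fun hI => ⟨hC hI.1, hI.2⟩,
      Set.inter_subset_inter_left _ hC⟩)
    (fun p p' hp J hJ => ⟨hJ.1, hJ.2.1, fun hl => hp.2 (hJ.2.2.1 hl),
      fun g hg hX hne => hp.1 (hJ.2.2.2 g hg hX hne)⟩)

end Splitting

/-- Isomorphic factors give isomorphic posets of pairs with bottom first or top second entry. -/
def botTopCongr {A A' B B' : Type*} [PartialOrder A] [PartialOrder A'] [PartialOrder B]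
    [PartialOrder B'] (e : A ≃o A') (f : B ≃o B') :
    {p : A × B // IsBot p.1 ∨ IsTop p.2} ≃o {p : A' × B' // IsBot p.1 ∨ IsTop p.2} where
  toEquiv := (Equiv.prodCongr e.toEquiv f.toEquiv).subtypeEquiv fun p => by
    change _ ↔ IsBot (e p.1) ∨ IsTop (f p.2)
    rw [isBot_orderIso, isTop_orderIso]
  map_rel_iff' := and_congr e.le_iff_le f.le_iff_le

end Paper

namespace Paper

section Chain

variable {D : Type*} [CommRing D] [IsDomain D] {K : Type*} [Field K] [Algebra D K]
  [IsFractionRing D K]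

local notation "α" => algebraMap D K

variable {P Q p : Ideal D} {I J : Submodule D K} {C : Set (Submodule D K)}

theorem le_total_of_local (hp : IsPrufer D K) (hQ : Q.IsPrime) (hI : loc {Q} I ≤ I)
    (hJ : loc {Q} J ≤ J) : I ≤ J ∨ J ≤ I := by
  by_contra! hc
  obtain ⟨x, hxI, hxJ⟩ := SetLike.not_le_iff_exists.1 hc.1
  refine hc.2 fun y hy => ?_
  have := mul_mem_of_local hQ hI
    (maxAt_le_ringAt hQ (div_mem_maxAt_of_local hp hQ hJ hxJ hy)) hxI
  rwa [mul_comm, mul_inv_cancel_left₀ (ne_zero_of_notMem_submodule hxJ)] at this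

theorem exists_of_notMem_sys (hP : P.IsPrime) (hC : IsSys (US K P Q) (unitAt K P) C) (hI : I ∈ C)
    (hJ : J ∈ US K P Q) (hJC : J ∉ C) :
    ∃ x ∈ unitAt K P, x ∉ J ∧ ∀ g ∈ unitAt K P, J ≤ sc g I → x ∈ sc g I := by
  by_contra! hc
  refine hJC (hC.mem_of_forall_exists (fun I hI => hI.2.1.le) hI hJ hJ.2.1.ne fun x hx hxJ => ?_)
  exact hc x (mem_unitAt_of_mem_of_notMem hP hJ.1.le le_rfl hxJ hx) hxJ

theorem CS_le_total (hp : IsPrufer D K) (hP : P.IsPrime) (hQ : Q.IsPrime) (C C' : CS K P Q) :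
    C ≤ C' ∨ C' ≤ C := by
  rw [or_iff_not_imp_left]
  intro hCC I hI
  obtain ⟨J, hJC, hJC'⟩ := Set.not_subset.1 hCC
  by_contra hIC
  have hIU := C'.2.sub hI
  have hJU := C.2.sub hJC
  obtain ⟨x, hx, hxI, hxg⟩ := exists_of_notMem_sys hP C.2 hJC hIU hIC
  obtain ⟨y, hy, hyJ, hyg⟩ := exists_of_notMem_sys hP C'.2 hI hJU hJC'
  have hx0 := unitAt_ne_zero hx
  have hy0 := unitAt_ne_zero hy
  rcases le_total_of_local hp hQ (loc_sc_le (inv_ne_zero hx0) hIU.2.2)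
    (loc_sc_le (inv_ne_zero hy0) hJU.2.2) with h | h
  · have h1 := hxg (x * y⁻¹) (unitAt_mul hP hx (unitAt_inv hy)) (by
      rw [← sc_sc, le_sc_iff hx0]; exact h)
    rw [mem_sc (mul_ne_zero hx0 (inv_ne_zero hy0))] at h1
    apply hyJ
    have : (x * y⁻¹)⁻¹ * x = y := by field_simp
    rwa [this] at h1
  · have h1 := hyg (y * x⁻¹) (unitAt_mul hP hy (unitAt_inv hx)) (by
      rw [← sc_sc, le_sc_iff hy0]; exact h)
    rw [mem_sc (mul_ne_zero hy0 (inv_ne_zero hx0))] at h1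
    apply hxI
    have : (y * x⁻¹)⁻¹ * y = x := by field_simp
    rwa [this] at h1

/-- The elements `d` of `D` with `dI ≠ I`. -/
def shrinking (I : Submodule D K) : Set D := {d | ¬ I ≤ sc (α d) I}

theorem sc_map_le (d : D) (I : Submodule D K) : sc (α d) I ≤ I := by
  intro y hy
  obtain ⟨z, hz, rfl⟩ := Submodule.mem_span_singleton_mul.1 hy
  rw [← Algebra.smul_def]; exact I.smul_mem d hz

theorem sc_eq_of_notMem_shrinking {d : D} (h : d ∉ shrinking I) : sc (α d) I = I :=
  le_antisymm (sc_map_le d I) (not_not.1 h)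

theorem sc_inv_eq_self {g : K} (hg : g ≠ 0) (h : sc g I = I) : sc g⁻¹ I = I := by
  nth_rewrite 1 [← h]
  exact sc_inv_sc hg I

theorem exists_shrinking_eq (hp : IsPrufer D K) (hQ : Q.IsPrime) (hI : I ∈ US K P Q) :
    ∃ p : Ideal D, p.IsPrime ∧ (p : Set D) = shrinking I := by
  have hmul : ∀ {d e : D}, d ∈ shrinking I → e * d ∈ shrinking I := by
    intro d e hd hle
    rw [mul_comm, map_mul, ← sc_sc] at hle
    exact hd (hle.trans (sc_mono _ (sc_map_le e I)))
  let p : Ideal D :=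
    { carrier := shrinking I
      zero_mem' := by
        intro h
        rw [map_zero, sc, Submodule.span_zero_singleton, Submodule.bot_mul] at h
        exact not_lt_bot (hI.1.trans_le h)
      add_mem' := by
        have key : ∀ {d e : D}, e ∈ shrinking I → sc (α d) I ≤ sc (α e) I →
            d + e ∈ shrinking I := by
          intro d e he hle hh
          refine he (hh.trans fun y hy => ?_)
          obtain ⟨z, hz, rfl⟩ := Submodule.mem_span_singleton_mul.1 hy
          rw [map_add, add_mul]
          exact add_mem (hle (mul_mem_sc hz)) (mul_mem_sc hz)
        intro d e hd he
        by_cases hd0 : d = 0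
        · rwa [hd0, zero_add]
        by_cases he0 : e = 0
        · rwa [he0, add_zero]
        have inj : ∀ {d : D}, d ≠ 0 → α d ≠ 0 := fun h =>
          (map_ne_zero_iff _ (IsFractionRing.injective D K)).2 h
        rcases le_total_of_local hp hQ (loc_sc_le (inj hd0) hI.2.2)
          (loc_sc_le (inj he0) hI.2.2) with h | h
        · exact key he h
        · rw [add_comm]; exact key hd h
      smul_mem' := fun e d hd => hmul hd }
  refine ⟨p, ⟨?_, ?_⟩, rfl⟩
  · rw [Ne, Ideal.eq_top_iff_one]
    intro h
    apply h
    rw [map_one, sc_one]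
  · intro d e hde
    by_contra! hc
    apply hde
    rw [map_mul, ← sc_sc, sc_eq_of_notMem_shrinking hc.2, sc_eq_of_notMem_shrinking hc.1]

theorem eq_maxAt_of_notMem_sys (hp : IsPrufer D K) (hP : P.IsPrime) (hQ : Q.IsPrime)
    (hpp : p.IsPrime) (hC : IsSys (US K P Q) (unitAt K P) C) (hI : I ∈ C)
    (hJ : J ∈ US K P Q) (hJC : J ∉ C) (hpI : (p : Set D) = shrinking I)
    (hpJ : (p : Set D) = shrinking J) : ∃ x ∈ unitAt K P, J = sc x (maxAt K p) := by
  obtain ⟨x, hx, hxJ, hxg⟩ := exists_of_notMem_sys hP hC hI hJ hJC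
  have hx0 := unitAt_ne_zero hx
  have hIU := hC.sub hI
  have hpQ : p ≤ Q := by
    intro d hd
    by_contra hdQ
    have : d ∈ shrinking I := hpI ▸ hd
    exact this (sc_unit_of_local hQ hIU.2.2 (map_mem_unitAt hQ hdQ)).ge
  have hPp : P ≤ p := by
    intro d hd
    by_contra hdp
    have h : d ∉ shrinking I := hpI ▸ hdp
    refine not_le_of_gt hIU.1 ((sc_eq_of_notMem_shrinking h).symm.le.trans fun y hy => ?_)
    obtain ⟨z, hz, rfl⟩ := Submodule.mem_span_singleton_mul.1 hy
    rw [mul_comm]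
    exact ringAt_mul_maxAt hP (hIU.2.1.le hz) ((map_mem_maxAt hP).2 hd)
  have hJ'U := sc_mem_US hP (unitAt_inv hx) hJ
  have honeJ : (1 : K) ∉ sc x⁻¹ J := by
    rw [mem_sc (inv_ne_zero hx0), inv_inv, mul_one]; exact hxJ
  have hlt : ∀ h ∈ unitAt K P, h ∉ I → I ≤ sc h (sc x⁻¹ J) := by
    intro h hh hhI
    have hh0 := unitAt_ne_zero hh
    rcases le_total_of_local hp hQ hIU.2.2 (loc_sc_le hh0 hJ'U.2.2) with hle | hle
    · exact hle
    · rw [sc_sc, sc_le_iff (mul_ne_zero hh0 (inv_ne_zero hx0))] at hle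
      have := hxg _ (unitAt_inv (unitAt_mul hP hh (unitAt_inv hx))) hle
      rw [mem_sc (inv_ne_zero (mul_ne_zero hh0 (inv_ne_zero hx0))), inv_inv,
        inv_mul_cancel_right₀ hx0] at this
      exact (hhI this).elim
  refine ⟨x, hx, ?_⟩
  rw [← sc_sc_inv hx0 J]
  congr 1
  apply le_antisymm
  · intro y hy
    by_contra hyp
    have hy0 := ne_zero_of_notMem_submodule hyp
    have hyQ : y ∈ ringAt K Q := by
      have := div_mem_maxAt_of_local hp hQ hJ'U.2.2 honeJ hy
      rw [inv_one, one_mul] at this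
      exact maxAt_le_ringAt hQ this
    obtain ⟨d, s, hs, rfl⟩ := (mem_ringAt hQ).1 hyQ
    have hdp : d ∉ p := fun hd => hyp ((mem_maxAt hpp).2 ⟨d, hd, s, fun h => hs (hpQ h), rfl⟩)
    have hdJ : sc (α d) J = J := sc_eq_of_notMem_shrinking (hpJ ▸ hdp)
    have hsJ := sc_unit_of_local hQ hJ.2.2 (map_mem_unitAt hQ hs)
    have hd0 := map_ne_zero_of_notMem (K := K) hdp
    have hs0 := map_ne_zero_of_notMem (K := K) hs
    have : sc (α d / α s) J = J := by
      rw [div_eq_mul_inv, ← sc_sc, sc_inv_eq_self hs0 hsJ, hdJ]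
    apply honeJ
    rw [← this, sc_sc, mul_comm, ← sc_sc, mem_sc hy0] at hy
    rwa [inv_mul_cancel₀ hy0] at hy
  · intro z hz
    by_contra hzJ
    have hz0 := ne_zero_of_notMem_submodule hzJ
    have hzR : z ∈ ringAt K P :=
      ringAt_anti hP hpp hPp (maxAt_le_ringAt hpp hz)
    have hzu := mem_unitAt_of_mem_of_notMem hP hJ'U.1.le le_rfl hzJ hzR
    obtain ⟨d, hd, s, hs, rfl⟩ := (mem_maxAt hpp).1 hz
    have hs0 := map_ne_zero_of_notMem (K := K) hs
    have hsI : sc (α s) I = I := sc_eq_of_notMem_shrinking (hpI ▸ hs)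
    have hdI : ¬ I ≤ sc (α d) I := by
      have : d ∈ shrinking I := hpI ▸ hd
      exact this
    have hzI : sc (α d / α s) I = sc (α d) I := by
      rw [div_eq_mul_inv, ← sc_sc, sc_inv_eq_self hs0 hsI]
    rw [← hzI] at hdI
    obtain ⟨h, hhI, hhz⟩ := SetLike.not_le_iff_exists.1 hdI
    have hu : h ∈ unitAt K P :=
      mem_unitAt_of_mem_of_notMem hP (sc_mem_US hP hzu hIU).1.le hIU.2.1.le hhz hhI
    rw [mem_sc hz0] at hhz
    have := hlt _ (unitAt_mul hP (unitAt_inv hzu) hu) hhz hhI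
    rw [mul_comm, ← sc_sc, mem_sc (unitAt_ne_zero hu), inv_mul_cancel₀ (unitAt_ne_zero hu),
      mem_sc (inv_ne_zero hz0), inv_inv, mul_one] at this
    exact hzJ this

/-- The invariants determining a system in `US K P Q`. -/
def sysKey (P : Ideal D) (C : Set (Submodule D K)) : Set (Ideal D × Prop) :=
  {k | k.1.IsPrime ∧ ∃ I ∈ C, (k.1 : Set D) = shrinking I ∧
    (k.2 ↔ ∃ x ∈ unitAt K P, I = sc x (maxAt K k.1))}

theorem subset_of_sysKey_subset (hp : IsPrufer D K) (hP : P.IsPrime) (hQ : Q.IsPrime)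
    {C' : Set (Submodule D K)} (hC : IsSys (US K P Q) (unitAt K P) C)
    (hC' : IsSys (US K P Q) (unitAt K P) C') (h : sysKey P C ⊆ sysKey P C') : C ⊆ C' := by
  intro J hJ
  obtain ⟨p, hpp, hpJ⟩ := exists_shrinking_eq hp hQ (hC.sub hJ)
  obtain ⟨_, I, hI, hpI, hiff⟩ :=
    h (show (p, ∃ x ∈ unitAt K P, J = sc x (maxAt K p)) ∈ sysKey P C from
      ⟨hpp, J, hJ, hpJ, Iff.rfl⟩)
  by_contra hJC
  obtain ⟨x, hx, hxJ⟩ := eq_maxAt_of_notMem_sys hp hP hQ hpp hC' hI (hC.sub hJ) hJC hpI hpJ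
  obtain ⟨y, hy, hyI⟩ := hiff.1 ⟨x, hx, hxJ⟩
  apply hJC
  have := hC'.act _ (unitAt_mul hP hx (unitAt_inv hy)) _ hI
  rwa [hyI, sc_sc, inv_mul_cancel_right₀ (unitAt_ne_zero hy), ← hxJ] at this

theorem finite_CS (hD : IsSemilocalPrufer D K) (hP : P.IsPrime) (hQ : Q.IsPrime) :
    Finite (CS K P Q) := by
  have hfin : ({p : Ideal D | p.IsPrime} ×ˢ (Set.univ : Set Prop)).Finite :=
    (finite_primes hD).prod Set.finite_univ
  have := hfin.finite_subsets.to_subtype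
  refine Finite.of_injective (fun C : CS K P Q => (⟨sysKey P C.1, fun k hk => ⟨hk.1, trivial⟩⟩ :
    {S | S ⊆ {p : Ideal D | p.IsPrime} ×ˢ (Set.univ : Set Prop)})) fun C C' h => ?_
  have h' := Subtype.ext_iff.1 h
  exact Subtype.ext ((subset_of_sysKey_subset hD.prufer hP hQ C.2 C'.2 h'.le).antisymm
    (subset_of_sysKey_subset hD.prufer hP hQ C'.2 C.2 h'.ge))

end Chain

end Paper

namespace Paper

section Residue

variable {D : Type*} [CommRing D] [IsDomain D] {K : Type*} [Field K] [Algebra D K]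
  [IsFractionRing D K] {Z : Type*} [CommRing Z] [IsDomain Z]

local notation "α" => algebraMap D K

variable {P Q : Ideal D} {I J : Submodule D K} {C : Set (Submodule D K)}

/-- The fractional ideals of a domain, in its field of fractions. -/
abbrev FracIdeals (Z : Type*) [CommRing Z] [IsDomain Z] :=
  FractionalIdeal (nonZeroDivisors Z) (FractionRing Z)

/-- A map from `K` whose restriction to `D_P` is a surjective ring homomorphism to the fraction
field of `Z` with kernel the maximal ideal, under which `D_Q` is the preimage of `Z`. -/
structure IsResidueMap (P Q : Ideal D) (φ : K → FractionRing Z) : Prop where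
  map_add : ∀ x ∈ ringAt K P, ∀ y ∈ ringAt K P, φ (x + y) = φ x + φ y
  map_mul : ∀ x ∈ ringAt K P, ∀ y ∈ ringAt K P, φ (x * y) = φ x * φ y
  surj : ∀ u, ∃ x ∈ ringAt K P, φ x = u
  eq_zero : ∀ x ∈ ringAt K P, (φ x = 0 ↔ x ∈ maxAt K P)
  lift : ∀ z : Z, ∃ r ∈ ringAt K Q, φ r = algebraMap Z (FractionRing Z) z
  integer : ∀ r ∈ ringAt K Q, ∃ z : Z, algebraMap Z (FractionRing Z) z = φ r

namespace IsResidueMap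

variable {φ : K → FractionRing Z} (h : IsResidueMap P Q φ) (hp : IsPrufer D K) (hP : P.IsPrime)
  (hQ : Q.IsPrime) (hPQ : P < Q)
include h

theorem map_zero : φ 0 = 0 := (h.eq_zero 0 (zero_mem _)).2 (zero_mem _)

include hP in
theorem map_one : φ 1 = 1 := by
  have h1 := h.map_mul 1 (one_mem_ringAt hP) 1 (one_mem_ringAt hP)
  rw [mul_one] at h1
  exact (mul_eq_left₀ fun h0 => one_notMem_maxAt hP ((h.eq_zero 1 (one_mem_ringAt hP)).1 h0)).1
    h1.symm

theorem sub_mem {x y : K} (hx : x ∈ ringAt K P) (hy : y ∈ ringAt K P) (hxy : φ x = φ y) :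
    x - y ∈ maxAt K P := by
  have h1 := h.map_add (x - y) (_root_.sub_mem hx hy) y hy
  rw [sub_add_cancel, hxy, eq_comm, add_eq_right] at h1
  exact (h.eq_zero _ (_root_.sub_mem hx hy)).1 h1

include hP in
theorem exists_unit {u : (FractionRing Z)} (hu : u ≠ 0) : ∃ g ∈ unitAt K P, φ g = u := by
  obtain ⟨x, hx, rfl⟩ := h.surj u
  exact ⟨x, (mem_unitAt hP).2 ⟨hx, fun hm => hu ((h.eq_zero x hx).2 hm)⟩, rfl⟩

include hP in
theorem map_unit_ne_zero {g : K} (hg : g ∈ unitAt K P) : φ g ≠ 0 := fun h0 =>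
  ((mem_unitAt hP).1 hg).2 ((h.eq_zero g ((mem_unitAt hP).1 hg).1).1 h0)

include hP in
theorem map_inv {g : K} (hg : g ∈ unitAt K P) : φ g⁻¹ = (φ g)⁻¹ := by
  have h1 := h.map_mul g ((mem_unitAt hP).1 hg).1 _ ((mem_unitAt hP).1 (unitAt_inv hg)).1
  rw [mul_inv_cancel₀ (unitAt_ne_zero hg), h.map_one hP] at h1
  exact (inv_eq_of_mul_eq_one_right h1.symm).symm

/-- The preimage of a fractional ideal of `Z`. -/
def pull (h : IsResidueMap P Q φ) (hQ : Q.IsPrime) (_ : P < Q) (hP : P.IsPrime) (J : FracIdeals Z) :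
    Submodule D K where
  carrier := {x | x ∈ ringAt K P ∧ φ x ∈ J}
  zero_mem' := ⟨zero_mem _, h.map_zero ▸ zero_mem (J : Submodule Z (FractionRing Z))⟩
  add_mem' := fun {x y} hx hy => ⟨add_mem hx.1 hy.1, by
    rw [h.map_add x hx.1 y hy.1]; exact (J : Submodule Z (FractionRing Z)).add_mem hx.2 hy.2⟩
  smul_mem' := fun d x hx => ⟨Submodule.smul_mem _ d hx.1, by
    obtain ⟨z, hz⟩ := h.integer _ (map_mem_ringAt hQ d)
    rw [Algebra.smul_def, h.map_mul _ (map_mem_ringAt hP d) x hx.1, ← hz, ← Algebra.smul_def]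
    exact (J : Submodule Z (FractionRing Z)).smul_mem z hx.2⟩

theorem mem_pull {J : FracIdeals Z} {x : K} :
    x ∈ h.pull hQ hPQ hP J ↔ x ∈ ringAt K P ∧ φ x ∈ J := Iff.rfl

theorem pull_le_pull {J J' : FracIdeals Z} :
    h.pull hQ hPQ hP J ≤ h.pull hQ hPQ hP J' ↔ J ≤ J' := by
  constructor
  · intro hle u hu
    obtain ⟨x, hx, rfl⟩ := h.surj u
    exact (hle ⟨hx, hu⟩).2
  · exact fun hle x hx => ⟨hx.1, hle hx.2⟩

theorem pull_inj {J J' : FracIdeals Z} (hJ : h.pull hQ hPQ hP J = h.pull hQ hPQ hP J') : J = J' :=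
  le_antisymm ((h.pull_le_pull hP hQ hPQ).1 hJ.le) ((h.pull_le_pull hP hQ hPQ).1 hJ.ge)

theorem pull_smul {g : K} (hg : g ∈ unitAt K P) (J : FracIdeals Z) :
    h.pull hQ hPQ hP (FractionalIdeal.spanSingleton (nonZeroDivisors Z) (φ g) * J) =
      sc g (h.pull hQ hPQ hP J) := by
  ext x
  have hgi := ((mem_unitAt hP).1 (unitAt_inv hg)).1
  have hgr := ((mem_unitAt hP).1 hg).1
  rw [mem_sc (unitAt_ne_zero hg), mem_pull, mem_pull, FractionalIdeal.mem_singleton_mul]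
  constructor
  · rintro ⟨hx, y, hy, hxy⟩
    refine ⟨ringAt_mul hP hgi hx, ?_⟩
    rwa [h.map_mul _ hgi x hx, h.map_inv hP hg, hxy,
      inv_mul_cancel_left₀ (h.map_unit_ne_zero hP hg)]
  · rintro ⟨hx, hy⟩
    have h1 : x = g * (g⁻¹ * x) := by rw [mul_inv_cancel_left₀ (unitAt_ne_zero hg)]
    refine ⟨by rw [h1]; exact ringAt_mul hP hgr hx, _, hy, ?_⟩
    rw [← h.map_mul g hgr _ hx, ← h1]

include hp hP hQ hPQ in
theorem exists_ne_integer : ∃ x ∈ ringAt K P, ∀ z : Z, algebraMap Z (FractionRing Z) z ≠ φ x := by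
  obtain ⟨q, hqQ, hqP⟩ := SetLike.exists_of_lt hPQ
  have hq := (mem_unitAt hP).1 (unitAt_inv (map_mem_unitAt (K := K) hP hqP))
  refine ⟨_, hq.1, fun z hz => ?_⟩
  obtain ⟨r, hr, hrz⟩ := h.lift z
  have h1 := h.sub_mem hq.1 (ringAt_anti hP hQ hPQ.le hr) (hz.symm.trans hrz.symm)
  have h2 := add_mem (maxAt_le_ringAt hQ (maxAt_mono hp hP hQ hPQ.le h1)) hr
  rw [sub_add_cancel] at h2
  exact inv_notMem_ringAt hQ ((map_mem_maxAt hQ).2 hqQ) (map_ne_zero_of_notMem hqP) h2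

include hp in
theorem pull_mem_US {J : FracIdeals Z} (hJ : J ≠ 0) : h.pull hQ hPQ hP J ∈ US K P Q := by
  refine ⟨lt_of_le_not_ge (fun x hx => ⟨maxAt_le_ringAt hP hx, ?_⟩) fun hle => hJ ?_,
    lt_of_le_not_ge (fun x hx => hx.1) fun hle => ?_, ?_⟩
  · rw [(h.eq_zero x (maxAt_le_ringAt hP hx)).2 hx]
    exact zero_mem (J : Submodule Z (FractionRing Z))
  · rw [FractionalIdeal.eq_zero_iff]
    intro u hu
    obtain ⟨x, hx, rfl⟩ := h.surj u
    exact (h.eq_zero x hx).2 (hle ⟨hx, hu⟩)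
  · obtain ⟨a, ha, haJ⟩ := J.2
    have ha0 : algebraMap Z (FractionRing Z) a ≠ 0 := IsFractionRing.to_map_ne_zero_of_mem_nonZeroDivisors ha
    obtain ⟨x, hx, hxz⟩ := h.exists_ne_integer hp hP hQ hPQ
    obtain ⟨y, hy, hyu⟩ := h.surj ((algebraMap Z (FractionRing Z) a)⁻¹ * φ x)
    have := haJ _ (hle hy).2
    rw [hyu, Algebra.smul_def, mul_inv_cancel_left₀ ha0] at this
    obtain ⟨z, hz⟩ := this
    exact hxz z hz
  · rintro x ⟨s, hs, hsx⟩
    rw [mem_avoid_singleton hQ] at hs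
    have hsi := ((mem_unitAt hQ).1 (unitAt_inv (map_mem_unitAt (K := K) hQ hs))).1
    have hs0 := map_ne_zero_of_notMem (K := K) hs
    obtain ⟨z, hz⟩ := h.integer _ hsi
    have h1 : x = (α s)⁻¹ * s • x := by rw [Algebra.smul_def, inv_mul_cancel_left₀ hs0]
    rw [h1]
    refine ⟨ringAt_mul hP (ringAt_anti hP hQ hPQ.le hsi) hsx.1, ?_⟩
    rw [h.map_mul _ (ringAt_anti hP hQ hPQ.le hsi) _ hsx.1, ← hz, ← Algebra.smul_def]
    exact (J : Submodule Z (FractionRing Z)).smul_mem z hsx.2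

include hp in
theorem exists_pull_eq (hI : I ∈ US K P Q) : ∃ J : FracIdeals Z, J ≠ 0 ∧ h.pull hQ hPQ hP J = I := by
  have hIP : ∀ {x}, x ∈ I → x ∈ ringAt K P := fun hx => hI.2.1.le hx
  let J : Submodule Z (FractionRing Z) :=
    { carrier := φ '' I
      zero_mem' := ⟨0, zero_mem _, h.map_zero⟩
      add_mem' := by
        rintro _ _ ⟨x, hx, rfl⟩ ⟨y, hy, rfl⟩
        exact ⟨x + y, add_mem hx hy, h.map_add x (hIP hx) y (hIP hy)⟩
      smul_mem' := by
        rintro z _ ⟨x, hx, rfl⟩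
        obtain ⟨r, hr, hrz⟩ := h.lift z
        refine ⟨r * x, mul_mem_of_local hQ hI.2.2 hr hx, ?_⟩
        rw [h.map_mul r (ringAt_anti hP hQ hPQ.le hr) x (hIP hx), hrz, Algebra.smul_def] }
  have hJ : IsFractional (nonZeroDivisors Z) J := by
    obtain ⟨y, hy, hyI⟩ := SetLike.exists_of_lt hI.2.1
    have hyu := mem_unitAt_of_mem_of_notMem hP hI.1.le le_rfl hyI hy
    obtain ⟨a, b, hb, hab⟩ := IsFractionRing.div_surjective (A := Z) (φ y)
    have hb0 : algebraMap Z (FractionRing Z) b ≠ 0 := IsFractionRing.to_map_ne_zero_of_mem_nonZeroDivisors hb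
    have ha0 : algebraMap Z (FractionRing Z) a ≠ 0 := fun ha => h.map_unit_ne_zero hP hyu (by
      rw [← hab, ha, zero_div])
    refine ⟨b, hb, ?_⟩
    rintro _ ⟨x, hx, rfl⟩
    obtain ⟨c, hc⟩ := h.integer _
      (maxAt_le_ringAt hQ (div_mem_maxAt_of_local hp hQ hI.2.2 hyI hx))
    rw [h.map_mul _ ((mem_unitAt hP).1 (unitAt_inv hyu)).1 x (hIP hx), h.map_inv hP hyu,
      ← hab] at hc
    refine ⟨a * c, ?_⟩
    rw [_root_.map_mul, hc, Algebra.smul_def]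
    field_simp
  have hpull : h.pull hQ hPQ hP ⟨J, hJ⟩ = I := by
    ext x
    constructor
    · rintro ⟨hx, y, hy, hxy⟩
      have := h.sub_mem hx (hIP hy) hxy.symm
      have := add_mem (hI.1.le this) hy
      rwa [sub_add_cancel] at this
    · exact fun hx => ⟨hIP hx, x, hx, rfl⟩
  refine ⟨⟨J, hJ⟩, fun h0 => ?_, hpull⟩
  obtain ⟨x, hx, hxm⟩ := SetLike.exists_of_lt hI.1
  rw [← hpull, h0] at hx
  exact hxm ((h.eq_zero x hx.1).1 ((FractionalIdeal.mem_zero_iff _).1 hx.2))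

include hp hP hQ hPQ in
theorem fracStar_zero (f : AFracStar Z) : f.toFun 0 = 0 := by
  by_contra hne
  have hU := h.pull_mem_US hp hP hQ hPQ hne
  obtain ⟨x, hx, hxm⟩ := SetLike.exists_of_lt hU.1
  obtain ⟨y, hy, hyU⟩ := SetLike.exists_of_lt hU.2.1
  have hxu := (mem_unitAt hP).2 ⟨hx.1, hxm⟩
  have hyu := mem_unitAt_of_mem_of_notMem hP hU.1.le le_rfl hyU hy
  have hg := unitAt_mul hP hyu (unitAt_inv hxu)
  have h1 := f.smul' (φ (y * x⁻¹)) (h.map_unit_ne_zero hP hg) 0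
  rw [mul_zero] at h1
  apply hyU
  rw [h1, h.pull_smul hP hQ hPQ hg, mem_sc (unitAt_ne_zero hg)]
  have hx0 := unitAt_ne_zero hxu
  have hy0 := unitAt_ne_zero hyu
  have : (y * x⁻¹)⁻¹ * y = x := by field_simp
  rwa [this]

/-- The preimages of the closed fractional ideals. -/
def closedSys (f : AFracStar Z) : Set (Submodule D K) :=
  {I | ∃ J, J ≠ 0 ∧ h.pull hQ hPQ hP J = I ∧ f.toFun J = J}

theorem isSys_closedSys (hp : IsPrufer D K) (f : AFracStar Z) :
    IsSys (US K P Q) (unitAt K P) (h.closedSys hP hQ hPQ f) := by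
  refine ⟨?_, ?_, ?_⟩
  · rintro _ ⟨J, hJ, rfl, _⟩
    exact h.pull_mem_US hp hP hQ hPQ hJ
  · rintro g hg _ ⟨J, hJ, rfl, hf⟩
    have h1 := h.pull_smul hP hQ hPQ hg J
    refine ⟨_, fun h0 => ?_, h1, ?_⟩
    · have h2 := (sc_mem_US hP hg (h.pull_mem_US hp hP hQ hPQ hJ)).1
      rw [← h1, h0] at h2
      exact h2.not_ge fun x hx => (h.eq_zero x hx.1).1 ((FractionalIdeal.mem_zero_iff _).1 hx.2)
    · rw [f.smul' _ (h.map_unit_ne_zero hP hg), hf]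
  · intro S hS hne hinf
    obtain ⟨J, hJ, hJS⟩ := h.exists_pull_eq hp hP hQ hPQ hinf
    refine ⟨J, hJ, hJS, le_antisymm ?_ (f.le_star' J)⟩
    rw [← h.pull_le_pull hP hQ hPQ, hJS]
    refine le_sInf fun I hI => ?_
    obtain ⟨J', hJ', rfl, hf⟩ := hS hI
    rw [← hf, h.pull_le_pull hP hQ hPQ]
    apply f.mono'
    rw [← h.pull_le_pull hP hQ hPQ, hJS]
    exact sInf_le hI

include hp in
theorem closedSys_injective : Function.Injective (h.closedSys hP hQ hPQ) := by
  have key : ∀ f g : AFracStar Z, h.closedSys hP hQ hPQ f ⊆ h.closedSys hP hQ hPQ g →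
      ∀ J, J ≠ 0 → g.toFun J ≤ f.toFun J := by
    intro f g hfg J hJ
    have hf0 : f.toFun J ≠ 0 := fun h0 => hJ (le_antisymm (h0 ▸ f.le_star' J) zero_le)
    obtain ⟨J', _, hJJ', hg⟩ := hfg ⟨f.toFun J, hf0, rfl, f.idem' J⟩
    rw [h.pull_inj hP hQ hPQ hJJ'] at hg
    rw [← hg]
    exact g.mono' (f.le_star' J)
  intro f g hfg
  refine AFracStar.ext' (funext fun J => ?_)
  by_cases hJ : J = 0
  · rw [hJ, h.fracStar_zero hp hP hQ hPQ, h.fracStar_zero hp hP hQ hPQ]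
  · exact le_antisymm (key g f hfg.ge J hJ) (key f g hfg.le J hJ)

omit h in
theorem sInf_mem_sys (hp : IsPrufer D K) (hP : P.IsPrime) (hQ : Q.IsPrime)
    (hC : IsSys (US K P Q) (unitAt K P) C) (hne : C.Nonempty) (hI : I ∈ US K P Q) :
    sInf {L | L ∈ C ∧ I ≤ L} ∈ C := by
  obtain ⟨L, hL⟩ := hne
  obtain ⟨a, ha, haL⟩ := exists_notMem_of_maxAt_lt hP (hC.sub hL).1 (hC.sub hL).2.1.le
  obtain ⟨y, hy, hyI⟩ := SetLike.exists_of_lt hI.2.1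
  have hyu := mem_unitAt_of_mem_of_notMem hP hI.1.le le_rfl hyI hy
  have hau := map_mem_unitAt (K := K) hP ha
  have hg := unitAt_mul hP hyu (unitAt_inv hau)
  have hLg : sc (y * (α a)⁻¹) L ∈ {L | L ∈ C ∧ I ≤ L} := by
    refine ⟨hC.act _ hg L hL, fun x hx => ?_⟩
    rw [mem_sc (unitAt_ne_zero hg)]
    have := mul_mem_of_local hQ (hC.sub hL).2.2
      (maxAt_le_ringAt hQ (div_mem_maxAt_of_local hp hQ hI.2.2 hyI hx)) haL
    have h2 : (y * (α a)⁻¹)⁻¹ * x = y⁻¹ * x * α a := by rw [mul_inv, inv_inv]; ring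
    rwa [h2]
  refine hC.inf _ (fun _ h => h.1) ⟨_, hLg⟩ ⟨hI.1.trans_le (le_sInf fun _ h => h.2),
    (sInf_le hLg).trans_lt (hC.sub hLg.1).2.1, loc_sInf_le fun L hL => (hC.sub hL.1).2.2⟩

theorem closedSys_surjective (hp : IsPrufer D K) (hC : IsSys (US K P Q) (unitAt K P) C)
    (hne : C.Nonempty) : ∃ f, h.closedSys hP hQ hPQ f = C := by
  let cl : Submodule D K → Submodule D K := fun I => sInf {L | L ∈ C ∧ I ≤ L}
  have hcl : ∀ {I}, I ∈ US K P Q → cl I ∈ C := sInf_mem_sys hp hP hQ hC hne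
  have le_cl : ∀ I, I ≤ cl I := fun I => le_sInf fun _ h => h.2
  have cl_le : ∀ {I L}, L ∈ C → I ≤ L → cl I ≤ L := fun hL h => sInf_le ⟨hL, h⟩
  have pU : ∀ {J : FracIdeals Z}, J ≠ 0 → h.pull hQ hPQ hP J ∈ US K P Q := h.pull_mem_US hp hP hQ hPQ
  have hex : ∀ J : FracIdeals Z, ∃ J' : FracIdeals Z, (J = 0 → J' = 0) ∧
      (J ≠ 0 → J' ≠ 0 ∧ h.pull hQ hPQ hP J' = cl (h.pull hQ hPQ hP J)) := by
    intro J
    by_cases hJ : J = 0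
    · exact ⟨0, fun _ => rfl, fun hh => (hh hJ).elim⟩
    · obtain ⟨J', hJ'⟩ := h.exists_pull_eq hp hP hQ hPQ (hC.sub (hcl (pU hJ)))
      exact ⟨J', fun hh => (hJ hh).elim, fun _ => hJ'⟩
  choose f hf0 hf using hex
  have hle : ∀ J, J ≤ f J := by
    intro J
    by_cases hJ : J = 0
    · rw [hJ]; exact zero_le
    · rw [← h.pull_le_pull hP hQ hPQ, (hf J hJ).2]; exact le_cl _
  have hclosed : ∀ J, J ≠ 0 → (f J = J ↔ h.pull hQ hPQ hP J ∈ C) := by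
    intro J hJ
    constructor
    · intro hfJ
      have := (hf J hJ).2
      rw [hfJ] at this
      rw [this]; exact hcl (pU hJ)
    · intro hJC
      refine le_antisymm ?_ (hle J)
      rw [← h.pull_le_pull hP hQ hPQ, (hf J hJ).2]
      exact cl_le hJC le_rfl
  refine ⟨⟨f, hle, ?_, ?_, ?_⟩, ?_⟩
  · intro J J' hJJ
    by_cases hJ : J = 0
    · rw [hf0 J hJ]; exact zero_le
    have hJ' : J' ≠ 0 := fun h0 => hJ (le_antisymm (h0 ▸ hJJ) zero_le)
    rw [← h.pull_le_pull hP hQ hPQ, (hf J hJ).2, (hf J' hJ').2]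
    exact cl_le (hcl (pU hJ')) (((h.pull_le_pull hP hQ hPQ).2 hJJ).trans (le_cl _))
  · intro J
    by_cases hJ : J = 0
    · rw [hf0 J hJ, hf0 0 rfl]
    · rw [hclosed _ (hf J hJ).1, (hf J hJ).2]
      exact hcl (pU hJ)
  · intro x hx J
    by_cases hJ : J = 0
    · rw [hf0 J hJ, hJ, mul_zero, hf0 0 rfl]
    obtain ⟨g, hg, rfl⟩ := h.exists_unit hP hx
    have hg0 := unitAt_ne_zero hg
    have hgJ : FractionalIdeal.spanSingleton (nonZeroDivisors Z) (φ g) * J ≠ 0 := by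
      intro h0
      apply hJ
      rw [← one_mul J, ← FractionalIdeal.spanSingleton_one, ← inv_mul_cancel₀ hx,
        ← FractionalIdeal.spanSingleton_mul_spanSingleton, mul_assoc, h0, mul_zero]
    apply h.pull_inj hP hQ hPQ
    rw [(hf _ hgJ).2, h.pull_smul hP hQ hPQ hg, h.pull_smul hP hQ hPQ hg, (hf J hJ).2]
    apply le_antisymm
    · exact cl_le (hC.act g hg _ (hcl (pU hJ))) (sc_mono g (le_cl _))
    · rw [sc_le_iff hg0]
      have hgU := sc_mem_US hP hg (pU hJ)
      refine cl_le (hC.act _ (unitAt_inv hg) _ (hcl hgU)) ?_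
      rw [← sc_le_iff hg0]
      exact le_cl _
  · ext I
    constructor
    · rintro ⟨J, hJ, rfl, hfJ⟩
      exact (hclosed J hJ).1 hfJ
    · intro hI
      obtain ⟨J, hJ, rfl⟩ := h.exists_pull_eq hp hP hQ hPQ (hC.sub hI)
      exact ⟨J, hJ, rfl, (hclosed J hJ).2 hI⟩

include hp hP hQ hPQ in
theorem card_eq : Nat.card {C : CS K P Q // C.1.Nonempty} = Nat.card (AFracStar Z) := by
  symm
  refine Nat.card_eq_of_bijective
    (fun f => ⟨⟨h.closedSys hP hQ hPQ f, h.isSys_closedSys hP hQ hPQ hp f⟩, ?_⟩) ⟨?_, ?_⟩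
  · have h1 : f.toFun 1 ≠ 0 := fun h0 =>
      one_ne_zero (le_antisymm (h0 ▸ f.le_star' 1) zero_le)
    exact ⟨_, f.toFun 1, h1, rfl, f.idem' 1⟩
  · intro f g hfg
    exact h.closedSys_injective hp hP hQ hPQ (congrArg (fun C => C.1.1) hfg)
  · rintro ⟨⟨C, hC⟩, hne⟩
    obtain ⟨f, hf⟩ := h.closedSys_surjective hP hQ hPQ hp hC hne
    exact ⟨f, by simp only [hf]⟩

end IsResidueMap

end Residue

end Paper

namespace Paper

section ResidueField

variable {D : Type*} [CommRing D] [IsDomain D] {K : Type*} [Field K] [Algebra D K]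
  [IsFractionRing D K] {Z : Type*} [CommRing Z] [IsDomain Z]

local notation "α" => algebraMap D K

variable {P Q : Ideal D}

theorem exists_isResidueMap (hP : P.IsPrime) (hQ : Q.IsPrime) (hPQ : P < Q)
    (ψ : D →+* FractionRing Z) (hker : ∀ d, ψ d = 0 ↔ d ∈ P)
    (hlift : ∀ z : Z, ∃ a s, s ∉ Q ∧ algebraMap Z (FractionRing Z) z = ψ a / ψ s)
    (hint : ∀ a s, s ∉ Q → ∃ z : Z, algebraMap Z (FractionRing Z) z = ψ a / ψ s) :
    ∃ φ : K → FractionRing Z, IsResidueMap P Q φ := by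
  classical
  let φ : K → FractionRing Z := fun x =>
    if h : ∃ a s, s ∉ P ∧ x = α a / α s then ψ h.choose / ψ h.choose_spec.choose else 0
  have hψ : ∀ {s}, s ∉ P → ψ s ≠ 0 := fun hs h0 => hs ((hker _).1 h0)
  have inj := IsFractionRing.injective D K
  have hφ : ∀ a s, s ∉ P → φ (α a / α s) = ψ a / ψ s := by
    intro a s hs
    have h : ∃ a' s', s' ∉ P ∧ α a / α s = α a' / α s' := ⟨a, s, hs, rfl⟩
    change (if h : ∃ a' s', s' ∉ P ∧ α a / α s = α a' / α s' then
      ψ h.choose / ψ h.choose_spec.choose else 0) = _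
    rw [dif_pos h]
    obtain ⟨h1, h2⟩ := h.choose_spec.choose_spec
    rw [div_eq_div_iff (map_ne_zero_of_notMem hs) (map_ne_zero_of_notMem h1), ← map_mul,
      ← map_mul] at h2
    rw [div_eq_div_iff (hψ h1) (hψ hs), ← map_mul, ← map_mul, ← inj h2]
  have hQP : ∀ {s}, s ∉ Q → s ∉ P := fun hs h => hs (hPQ.le h)
  have hmul : ∀ {s t : D}, s ∉ P → t ∉ P → s * t ∉ P := fun hs ht h =>
    (hP.mem_or_mem h).elim hs ht
  refine ⟨φ, ?_, ?_, ?_, ?_, ?_, ?_⟩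
  · intro x hx y hy
    obtain ⟨a, s, hs, rfl⟩ := (mem_ringAt hP).1 hx
    obtain ⟨b, t, ht, rfl⟩ := (mem_ringAt hP).1 hy
    rw [div_add_div _ _ (map_ne_zero_of_notMem hs) (map_ne_zero_of_notMem ht), ← map_mul,
      ← map_mul, ← map_mul, ← map_add, hφ _ _ (hmul hs ht), hφ _ _ hs, hφ _ _ ht,
      div_add_div _ _ (hψ hs) (hψ ht)]
    simp only [map_mul, map_add]
  · intro x hx y hy
    obtain ⟨a, s, hs, rfl⟩ := (mem_ringAt hP).1 hx
    obtain ⟨b, t, ht, rfl⟩ := (mem_ringAt hP).1 hy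
    rw [div_mul_div_comm, ← map_mul, ← map_mul, hφ _ _ (hmul hs ht), hφ _ _ hs, hφ _ _ ht,
      div_mul_div_comm, map_mul, map_mul]
  · intro u
    obtain ⟨z, w, hw, rfl⟩ := IsFractionRing.div_surjective (A := Z) u
    have hw0 : algebraMap Z (FractionRing Z) w ≠ 0 :=
      IsFractionRing.to_map_ne_zero_of_mem_nonZeroDivisors hw
    obtain ⟨a, s, hs, hz⟩ := hlift z
    obtain ⟨b, t, ht, hw'⟩ := hlift w
    have hb : b ∉ P := fun hb => hw0 (by rw [hw', (hker b).2 hb, zero_div])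
    refine ⟨α (a * t) / α (s * b), (mem_ringAt hP).2 ⟨_, _, hmul (hQP hs) hb, rfl⟩, ?_⟩
    rw [hφ _ _ (hmul (hQP hs) hb), hz, hw', div_div_div_eq, map_mul, map_mul]
  · intro x hx
    obtain ⟨a, s, hs, rfl⟩ := (mem_ringAt hP).1 hx
    rw [hφ _ _ hs, div_eq_zero_iff, or_iff_left (hψ hs), hker]
    constructor
    · exact fun ha => (mem_maxAt hP).2 ⟨a, ha, s, hs, rfl⟩
    · intro ha
      obtain ⟨b, hb, t, ht, h⟩ := (mem_maxAt hP).1 ha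
      rw [div_eq_div_iff (map_ne_zero_of_notMem hs) (map_ne_zero_of_notMem ht), ← map_mul,
        ← map_mul] at h
      have h' : a * t ∈ P := inj h ▸ P.mul_mem_right _ hb
      exact (hP.mem_or_mem h').resolve_right ht
  · intro z
    obtain ⟨a, s, hs, hz⟩ := hlift z
    exact ⟨α a / α s, (mem_ringAt hQ).2 ⟨a, s, hs, rfl⟩, by rw [hφ _ _ (hQP hs), hz]⟩
  · intro r hr
    obtain ⟨a, s, hs, rfl⟩ := (mem_ringAt hQ).1 hr
    obtain ⟨z, hz⟩ := hint a s hs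
    exact ⟨z, by rw [hφ _ _ (hQP hs), hz]⟩

theorem card_nonempty_CS (hp : IsPrufer D K) (hP : P.IsPrime) (hQ : Q.IsPrime) (hPQ : P < Q) :
    Nat.card {C : CS K P Q // C.1.Nonempty} = omegaAt D Q P hQ := by
  have hdisj : Disjoint (Q.primeCompl : Set D) (P : Set D) :=
    Set.disjoint_left.2 fun s hs hsP => hs (hPQ.le hsP)
  have hprime : (P.map (algebraMap D (locRing D Q hQ))).IsPrime :=
    IsLocalization.isPrime_of_isPrime_disjoint Q.primeCompl _ P hP hdisj
  have hcomap : (P.map (algebraMap D (locRing D Q hQ))).comap (algebraMap D (locRing D Q hQ)) = P :=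
    IsLocalization.under_map_of_isPrime_disjoint Q.primeCompl _ hP hdisj
  let mk := Ideal.Quotient.mk (P.map (algebraMap D (locRing D Q hQ)))
  have : IsDomain (Zring D Q P hQ) := Ideal.Quotient.isDomain _
  let ι := algebraMap (Zring D Q P hQ) (FractionRing (Zring D Q P hQ))
  have hι : Function.Injective ι := IsFractionRing.injective _ _
  let ψ := ι.comp (mk.comp (algebraMap D (locRing D Q hQ)))
  have hker : ∀ d, ψ d = 0 ↔ d ∈ P := by
    intro d
    change ι (mk _) = 0 ↔ _
    rw [map_eq_zero_iff _ hι, Ideal.Quotient.eq_zero_iff_mem, ← Ideal.mem_comap, hcomap]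
  have hdiv : ∀ a (s : Q.primeCompl),
      ι (mk (IsLocalization.mk' (locRing D Q hQ) a s)) = ψ a / ψ s := by
    intro a s
    rw [eq_div_iff fun h0 => s.2 (hPQ.le ((hker _).1 h0))]
    change ι (mk _) * ι (mk _) = ι (mk _)
    rw [← map_mul, ← map_mul, IsLocalization.mk'_spec]
  obtain ⟨φ, hφ⟩ := exists_isResidueMap (K := K) hP hQ hPQ ψ hker
    (by
      intro z
      obtain ⟨r, rfl⟩ := Ideal.Quotient.mk_surjective z
      obtain ⟨a, s, rfl⟩ := IsLocalization.exists_mk'_eq Q.primeCompl r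
      exact ⟨a, s, s.2, hdiv a s⟩)
    (fun a s hs => ⟨_, hdiv a ⟨s, hs⟩⟩)
  exact hφ.card_eq hp hP hQ hPQ

theorem card_CS (hD : IsSemilocalPrufer D K) (hP : P.IsPrime) (hQ : Q.IsPrime) (hPQ : P < Q) :
    Nat.card (CS K P Q) = omegaAt D Q P hQ + 1 := by
  classical
  have := finite_CS hD hP hQ
  rw [← card_nonempty_CS hD.prufer hP hQ hPQ, ← Finite.card_option]
  refine Nat.card_congr
    { toFun := fun C => if h : C.1.Nonempty then some ⟨C, h⟩ else none
      invFun := fun o => o.elim ⟨∅, Set.empty_subset _, by simp, fun S hS hne _ =>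
        (hne.ne_empty (Set.subset_empty_iff.1 hS)).elim⟩ Subtype.val
      left_inv := fun C => ?_
      right_inv := fun o => ?_ }
  · by_cases h : C.1.Nonempty
    · simp only [dif_pos h, Option.elim_some]
    · simp only [dif_neg h, Option.elim_none]
      exact Subtype.ext (Set.not_nonempty_iff_eq_empty.1 h).symm
  · rcases o with _ | ⟨C, h⟩
    · simp
    · exact dif_pos h

end ResidueField

theorem nonempty_orderIso_of_card_eq {A B : Type*} [PartialOrder A] [PartialOrder B] [Finite A]
    [Finite B] (hA : ∀ a b : A, a ≤ b ∨ b ≤ a) (hB : ∀ a b : B, a ≤ b ∨ b ≤ a)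
    (h : Nat.card A = Nat.card B) : Nonempty (A ≃o B) := by
  classical
  have := Fintype.ofFinite A
  have := Fintype.ofFinite B
  let _ : LinearOrder A := { (inferInstance : PartialOrder A) with
    le_total := hA, toDecidableLE := Classical.decRel _ }
  let _ : LinearOrder B := { (inferInstance : PartialOrder B) with
    le_total := hB, toDecidableLE := Classical.decRel _ }
  rw [Nat.card_eq_fintype_card, Nat.card_eq_fintype_card] at h
  exact ⟨(Fintype.orderIsoFinOfCardEq A h).symm.trans (Fintype.orderIsoFinOfCardEq B rfl)⟩

section Induction

variable {D₁ : Type*} [CommRing D₁] [IsDomain D₁] {K₁ : Type*} [Field K₁] [Algebra D₁ K₁]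
  [IsFractionRing D₁ K₁] {D₂ : Type*} [CommRing D₂] [IsDomain D₂] {K₂ : Type*} [Field K₂]
  [Algebra D₂ K₂] [IsFractionRing D₂ K₂]

theorem nonempty_CS_orderIso (hD₁ : IsSemilocalPrufer D₁ K₁) (hD₂ : IsSemilocalPrufer D₂ K₂)
    {P Q : Ideal D₁} {P' Q' : Ideal D₂} (hP : P.IsPrime) (hQ : Q.IsPrime) (hPQ : P < Q)
    (hP' : P'.IsPrime) (hQ' : Q'.IsPrime) (hPQ' : P' < Q')
    (h : omegaAt D₁ Q P hQ = omegaAt D₂ Q' P' hQ') : Nonempty (CS K₁ P Q ≃o CS K₂ P' Q') := by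
  have := finite_CS hD₁ hP hQ
  have := finite_CS hD₂ hP' hQ'
  refine nonempty_orderIso_of_card_eq (CS_le_total hD₁.prufer hP hQ)
    (CS_le_total hD₂.prufer hP' hQ') ?_
  rw [card_CS hD₁ hP hQ hPQ, card_CS hD₂ hP' hQ' hPQ', h]

theorem directlyBelow_iff_covBy {P Q : ↥(hiSpec D₁)} :
    DirectlyBelow D₁ P.1 Q.1 ↔ P ⋖ Q :=
  ⟨fun h => ⟨h.2.2.1, fun R h1 h2 => h.2.2.2 R.1 R.2 h1 h2⟩,
    fun h => ⟨P.2, Q.2, h.1, fun R hR h1 h2 => h.2 (c := ⟨R, hR⟩) h1 h2⟩⟩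

theorem directlyBelow_orderIso (ν : ↥(hiSpec D₁) ≃o ↥(hiSpec D₂)) {P Q : ↥(hiSpec D₁)} :
    DirectlyBelow D₂ (ν P).1 (ν Q).1 ↔ DirectlyBelow D₁ P.1 Q.1 := by
  rw [directlyBelow_iff_covBy, directlyBelow_iff_covBy, apply_covBy_apply_iff]

variable (K₁) in
/-- The index sets of the children of `P` above which some module of `C` is proper. -/
def suppAt {ι : Type*} (P : Ideal D₁) (e : ι → Ideal D₁) (C : Set (Submodule D₁ K₁)) :
    Set (Set ι) :=
  {S | ∃ I ∈ C, {i | loc (above (e i)) I ≠ ringAt K₁ P} = S}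

theorem exists_SS_orderIso_of_children (hD₁ : IsSemilocalPrufer D₁ K₁)
    (hD₂ : IsSemilocalPrufer D₂ K₂) {P : Ideal D₁} {P' : Ideal D₂} (hP : P ∈ hiSpec D₁)
    (hP' : P' ∈ hiSpec D₂) {ι : Type*} [Finite ι] {e : ι → Ideal D₁} {e' : ι → Ideal D₂}
    (he : IsChildEnum P e) (he' : IsChildEnum P' e')
    (hS : ∀ i, Nonempty (SS K₁ (e i) ≃o SS K₂ (e' i)))
    (hω : ∀ i, omegaAt D₁ (e i) P (mem_hiSpec_prime (he.child i).2.1) =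
      omegaAt D₂ (e' i) P' (mem_hiSpec_prime (he'.child i).2.1)) :
    ∃ Ψ : SS K₁ P ≃o SS K₂ P', ∀ C, suppAt K₂ P' e' (Ψ C).1 = suppAt K₁ P e C.1 := by
  have : ∀ i, Fact (DirectlyBelow D₁ P (e i)) := fun i => ⟨he.child i⟩
  have : ∀ i, Fact (DirectlyBelow D₂ P' (e' i)) := fun i => ⟨he'.child i⟩
  have hC := fun i => nonempty_CS_orderIso hD₁ hD₂ hP.1 (he.child i).2.1.1 (he.child i).2.2.1
    hP'.1 (he'.child i).2.1.1 (he'.child i).2.2.1 (hω i)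
  let F : ∀ i, FS K₁ P (e i) ≃o FS K₂ P' (e' i) := fun i =>
    (splitIso hD₁ (he.child i)).trans ((botTopCongr (hS i).some (hC i).some).trans
      (splitIso hD₂ (he'.child i)).symm)
  obtain ⟨Φ, hΦ⟩ := exists_famIso hD₁ hP he
  obtain ⟨Φ', hΦ'⟩ := exists_famIso hD₂ hP' he'
  refine ⟨Φ.trans ((famCongr F).trans Φ'.symm), fun C => ?_⟩
  ext S
  change (∃ I ∈ _, _ = S) ↔ ∃ I ∈ _, _ = S
  rw [← hΦ', ← hΦ]
  simp only [OrderIso.trans_apply, OrderIso.apply_symm_apply]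
  change S ∈ FamSupp (fun S i => F i ((Φ C).1 S i)) ↔ _
  rw [famSupp_congr]

theorem finite_childIndex (hD₁ : IsSemilocalPrufer D₁ K₁) (P : ↥(hiSpec D₁)) :
    Finite {Q : ↥(hiSpec D₁) // DirectlyBelow D₁ P.1 Q.1} := by
  have := (hiSpec_finite hD₁).to_subtype
  infer_instance

theorem isChildEnum_subtype (P : ↥(hiSpec D₁)) :
    IsChildEnum P.1 fun i : {Q : ↥(hiSpec D₁) // DirectlyBelow D₁ P.1 Q.1} => i.1.1 :=
  ⟨fun i => i.2, fun _ _ h => Subtype.ext (Subtype.ext h),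
    fun Q h => ⟨⟨⟨Q, h.2.1⟩, h⟩, rfl⟩⟩

theorem isChildEnum_orderIso (ν : ↥(hiSpec D₁) ≃o ↥(hiSpec D₂)) (P : ↥(hiSpec D₁)) :
    IsChildEnum (ν P).1
      fun i : {Q : ↥(hiSpec D₁) // DirectlyBelow D₁ P.1 Q.1} => (ν i.1).1 := by
  refine ⟨fun i => (directlyBelow_orderIso ν).2 i.2, fun i j h => Subtype.ext
    (ν.injective (Subtype.ext h)), fun Q h => ⟨⟨ν.symm ⟨Q, h.2.1⟩, ?_⟩, by simp⟩⟩
  rw [← directlyBelow_orderIso ν, ν.apply_symm_apply]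
  exact h

theorem exists_SS_orderIso (hD₁ : IsSemilocalPrufer D₁ K₁) (hD₂ : IsSemilocalPrufer D₂ K₂)
    (ν : ↥(hiSpec D₁) ≃o ↥(hiSpec D₂))
    (hω : ∀ P Q : ↥(hiSpec D₁), DirectlyBelow D₁ Q.1 P.1 →
      omegaAt D₁ P.1 Q.1 (mem_hiSpec_prime P.2) =
        omegaAt D₂ (ν P).1 (ν Q).1 (mem_hiSpec_prime (ν P).2)) (P : ↥(hiSpec D₁)) :
    ∃ Ψ : SS K₁ P.1 ≃o SS K₂ (ν P).1, ∀ C,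
      suppAt K₂ (ν P).1
        (fun i : {Q : ↥(hiSpec D₁) // DirectlyBelow D₁ P.1 Q.1} => (ν i.1).1) (Ψ C).1 =
      suppAt K₁ P.1 (fun i => i.1.1) C.1 := by
  have := (hiSpec_finite hD₁).to_subtype
  induction P using WellFoundedGT.induction with
  | _ P ih =>
    have := finite_childIndex hD₁ P
    exact exists_SS_orderIso_of_children hD₁ hD₂ P.2 (ν P).2 (isChildEnum_subtype P)
      (isChildEnum_orderIso ν P) (fun i => ⟨(ih i.1 i.2.2.2.1).choose⟩)
      (fun i => hω i.1 P i.2)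

end Induction

end Paper

namespace Paper

section ClosedModules

variable {D : Type*} [CommRing D] {K : Type*} [Field K] [Algebra D K]

/-- The sets of submodules that are closed under infima and under nonzero scalars. -/
structure IsClosedSystem (C : Set (Submodule D K)) : Prop where
  inf : ∀ S ⊆ C, sInf S ∈ C
  act : ∀ g : K, g ≠ 0 → ∀ I ∈ C, sc g I ∈ C

/-- The submodules fixed by a semistar operation. -/
def Semistar.closed (s : Semistar D K) : Set (Submodule D K) := {I | s.toFun I = I}

theorem Semistar.toFun_mem_closed (s : Semistar D K) (I : Submodule D K) :
    s.toFun I ∈ s.closed := s.idem' I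

theorem Semistar.toFun_eq_sInf (s : Semistar D K) (I : Submodule D K) :
    s.toFun I = sInf {J | J ∈ s.closed ∧ I ≤ J} :=
  le_antisymm (le_sInf fun _ hJ => (s.mono' hJ.2).trans_eq hJ.1)
    (sInf_le ⟨s.toFun_mem_closed I, s.le_star' I⟩)

theorem Semistar.isClosedSystem (s : Semistar D K) : IsClosedSystem s.closed where
  inf _ hS := le_antisymm (le_sInf fun _ hJ => (s.mono' (sInf_le hJ)).trans_eq (hS hJ))
    (s.le_star' _)
  act g hg I hI := (s.smul' g hg I).trans (congrArg _ hI)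

/-- The semistar operation with a given set of closed modules. -/
def IsClosedSystem.semistar {C : Set (Submodule D K)} (h : IsClosedSystem C) :
    Semistar D K where
  toFun I := sInf {J | J ∈ C ∧ I ≤ J}
  le_star' _ := le_sInf fun _ hJ => hJ.2
  mono' _ _ hIJ := sInf_le_sInf fun _ hJ => ⟨hJ.1, hIJ.trans hJ.2⟩
  idem' I := le_antisymm (sInf_le ⟨h.inf _ fun _ hJ => hJ.1, le_rfl⟩)
    (le_sInf fun _ hJ => hJ.2)
  smul' g hg I := by
    have key : ∀ (g : K), g ≠ 0 → ∀ I,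
        sInf {J | J ∈ C ∧ sc g I ≤ J} ≤ sc g (sInf {J | J ∈ C ∧ I ≤ J}) := fun g hg I =>
      sInf_le ⟨h.act g hg _ (h.inf _ fun _ hJ => hJ.1),
        sc_mono g (le_sInf fun _ hJ => hJ.2)⟩
    refine le_antisymm (key g hg I) ?_
    have := key g⁻¹ (inv_ne_zero hg) (sc g I)
    rw [sc_inv_sc hg] at this
    exact (sc_le_iff hg).2 this

theorem IsClosedSystem.closed_semistar {C : Set (Submodule D K)} (h : IsClosedSystem C) :
    h.semistar.closed = C := by
  ext I
  constructor
  · intro hI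
    have : sInf {J | J ∈ C ∧ I ≤ J} = I := hI
    exact this ▸ h.inf _ fun _ hJ => hJ.1
  · exact fun hI => le_antisymm (sInf_le ⟨hI, le_rfl⟩) (le_sInf fun _ hJ => hJ.2)

theorem Semistar.le_iff_closed_subset (s t : Semistar D K) : s ≤ t ↔ t.closed ⊆ s.closed := by
  constructor
  · exact fun h I hI => le_antisymm ((h I).trans_eq hI) (s.le_star' I)
  · intro h I
    rw [s.toFun_eq_sInf, t.toFun_eq_sInf]
    exact sInf_le_sInf fun J hJ => ⟨h hJ.1, hJ.2⟩

variable (D K) in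
/-- Semistar operations correspond to their sets of closed modules. -/
def closedIso : Semistar D K ≃o {C : Set (Submodule D K) // IsClosedSystem C}ᵒᵈ where
  toFun s := OrderDual.toDual ⟨s.closed, s.isClosedSystem⟩
  invFun C := (OrderDual.ofDual C).2.semistar
  left_inv s := le_antisymm
    ((Semistar.le_iff_closed_subset _ _).2 s.isClosedSystem.closed_semistar.ge)
    ((Semistar.le_iff_closed_subset _ _).2 s.isClosedSystem.closed_semistar.le)
  right_inv C := Subtype.ext (OrderDual.ofDual C).2.closed_semistar
  map_rel_iff' := fun {s t} => (Semistar.le_iff_closed_subset s t).symm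

end ClosedModules

section Root

variable {D : Type*} [CommRing D] [IsDomain D] {K : Type*} [Field K] [Algebra D K]
  [IsFractionRing D K]

theorem mem_XS_bot {I : Submodule D K} : I ∈ XS K (⊥ : Ideal D) ↔ I ≠ ⊥ := by
  simp only [XS, Set.mem_ofPred_eq, maxAt_bot, ringAt_bot, le_top, and_true, bot_lt_iff_ne_bot]

theorem sc_ne_bot {g : K} (hg : g ≠ 0) {I : Submodule D K} (hI : I ≠ ⊥) : sc g I ≠ ⊥ := by
  rw [← bot_lt_iff_ne_bot] at *
  have := (sc_lt_sc_iff hg).2 hI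
  exact bot_le.trans_lt this

theorem sc_bot (g : K) : sc g (⊥ : Submodule D K) = ⊥ := Submodule.mul_bot _

theorem sc_top {g : K} (hg : g ≠ 0) : sc g (⊤ : Submodule D K) = ⊤ :=
  eq_top_iff.2 ((le_sc_iff hg).2 le_top)

theorem IsClosedSystem.top_mem {C : Set (Submodule D K)} (h : IsClosedSystem C) : ⊤ ∈ C := by
  simpa using h.inf ∅ (Set.empty_subset _)

theorem IsClosedSystem.eq_top_of_bot_notMem {C : Set (Submodule D K)} (h : IsClosedSystem C)
    (hb : ⊥ ∉ C) {I : Submodule D K} (hI : I ∈ C) : I = ⊤ := by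
  have hJ := h.inf C subset_rfl
  have hJ0 : sInf C ≠ ⊥ := fun h0 => hb (h0 ▸ hJ)
  obtain ⟨x, hx, hx0⟩ := Submodule.exists_mem_ne_zero_of_ne_bot hJ0
  refine eq_top_iff.2 fun y _ => sInf_le hI (?_ : y ∈ sInf C)
  rcases eq_or_ne y 0 with rfl | hy
  · exact zero_mem _
  · have hg : x / y ≠ 0 := div_ne_zero hx0 hy
    have := (mem_sc hg).1 (sInf_le (h.act _ hg _ hJ) hx)
    rwa [inv_div, div_mul_cancel₀ _ hx0] at this

theorem IsClosedSystem.isSys_diff {C : Set (Submodule D K)} (h : IsClosedSystem C) :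
    IsSys (XS K (⊥ : Ideal D)) (unitAt K (⊥ : Ideal D)) (C \ {⊥}) where
  sub _ hI := mem_XS_bot.2 hI.2
  act g hg I hI := ⟨h.act g (mem_unitAt_bot.1 hg) I hI.1, sc_ne_bot (mem_unitAt_bot.1 hg) hI.2⟩
  inf S hS _ hI := ⟨h.inf S fun _ hJ => (hS hJ).1, mem_XS_bot.1 hI⟩

theorem IsClosedSystem.ringAt_mem_diff {C : Set (Submodule D K)} (h : IsClosedSystem C) :
    ringAt K (⊥ : Ideal D) ∈ C \ {⊥} := by
  rw [ringAt_bot]; exact ⟨h.top_mem, top_ne_bot⟩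

theorem IsClosedSystem.diff_eq_of_bot_notMem {C : Set (Submodule D K)} (h : IsClosedSystem C)
    (hb : ⊥ ∉ C) : C \ {⊥} = {ringAt K (⊥ : Ideal D)} :=
  Set.eq_singleton_iff_unique_mem.2 ⟨h.ringAt_mem_diff, fun I hI => by
    rw [ringAt_bot]; exact h.eq_top_of_bot_notMem hb hI.1⟩

theorem isClosedSystem_union (A : SS K (⊥ : Ideal D)) {q : Prop} (h : IsBot A ∨ q) :
    IsClosedSystem (A.1 ∪ {I | I = ⊥ ∧ q}) where
  inf S hS := by
    have htop : ⊤ ∈ A.1 := ringAt_bot (D := D) (K := K) ▸ A.2.2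
    by_cases h0 : sInf S = ⊥
    · refine Or.inr ⟨h0, ?_⟩
      by_contra hq
      have hA := (SS_isBot_iff Ideal.isPrime_bot A).1 (h.resolve_right hq)
      have : (⊤ : Submodule D K) ≤ sInf S := le_sInf fun J hJ => by
        rcases hS hJ with hJ' | hJ'
        · rw [hA, ringAt_bot] at hJ'; exact hJ'.ge
        · exact absurd hJ'.2 hq
      exact top_ne_bot (le_bot_iff.1 (this.trans_eq h0))
    · rcases S.eq_empty_or_nonempty with rfl | hne
      · rw [sInf_empty]; exact Or.inl htop
      · refine Or.inl (A.2.1.inf S (fun J hJ => (hS hJ).resolve_right ?_) hne (mem_XS_bot.2 h0))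
        rintro ⟨rfl, -⟩
        exact h0 (le_bot_iff.1 (sInf_le hJ))
  act g hg I hI := by
    rcases hI with hI | ⟨rfl, hq⟩
    · exact Or.inl (A.2.1.act g (mem_unitAt_bot.2 hg) I hI)
    · exact Or.inr ⟨sc_bot g, hq⟩

variable (D K) in
/-- A closed system is given by its nonzero members and by whether `⊥` belongs to it. -/
def closedSplitIso : {C : Set (Submodule D K) // IsClosedSystem C} ≃o
    {p : SS K (⊥ : Ideal D) × Prop // IsBot p.1 ∨ IsTop p.2} :=
  Equiv.toOrderIso
    { toFun := fun C => ⟨(⟨C.1 \ {⊥}, C.2.isSys_diff, C.2.ringAt_mem_diff⟩,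
          ⊥ ∈ C.1), by
        by_cases hb : ⊥ ∈ C.1
        · exact Or.inr fun _ _ => hb
        · refine Or.inl ((SS_isBot_iff Ideal.isPrime_bot _).2 ?_)
          exact C.2.diff_eq_of_bot_notMem hb⟩
      invFun := fun p => ⟨p.1.1.1 ∪ {I | I = ⊥ ∧ p.1.2},
        isClosedSystem_union p.1.1 (p.2.imp_right fun h => h True trivial)⟩
      left_inv := fun C => by
        ext I
        by_cases hI : I = ⊥
        · simp [hI]
        · simp [hI]
      right_inv := fun p => by
        have hb : ⊥ ∉ p.1.1.1 := fun h => mem_XS_bot.1 (p.1.1.2.1.sub h) rfl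
        refine Subtype.ext (Prod.ext (Subtype.ext ?_) (propext ?_))
        · ext I
          by_cases hI : I = ⊥
          · simp [hI, hb]
          · simp [hI]
        · simp [hb] }
    (fun C C' h => ⟨Set.sdiff_subset_sdiff_left h, fun hb => h hb⟩)
    (fun p p' h => Set.union_subset_union h.1 fun I hI => ⟨hI.1, h.2 hI.2⟩)

variable (D K) in
/-- Semistar operations in terms of the systems of nonzero closed modules. -/
def semistarIso : Semistar D K ≃o {p : SS K (⊥ : Ideal D) × Prop // IsBot p.1 ∨ IsTop p.2}ᵒᵈ :=
  (closedIso D K).trans (closedSplitIso D K).dual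

theorem semistarIso_apply (s : Semistar D K) :
    (OrderDual.ofDual (semistarIso D K s)).1.1.1 = s.closed \ {⊥} := rfl

end Root

section RootIso

variable {D₁ : Type*} [CommRing D₁] [IsDomain D₁] {K₁ : Type*} [Field K₁] [Algebra D₁ K₁]
  [IsFractionRing D₁ K₁] {D₂ : Type*} [CommRing D₂] [IsDomain D₂] {K₂ : Type*} [Field K₂]
  [Algebra D₂ K₂] [IsFractionRing D₂ K₂]

theorem exists_semistar_orderIso (Ψ : SS K₁ (⊥ : Ideal D₁) ≃o SS K₂ (⊥ : Ideal D₂)) :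
    ∃ b : Semistar D₁ K₁ ≃o Semistar D₂ K₂, ∀ s, ∃ C : SS K₁ (⊥ : Ideal D₁),
      s.closed \ {⊥} = C.1 ∧ (b s).closed \ {⊥} = (Ψ C).1 := by
  refine ⟨(semistarIso D₁ K₁).trans
    ((botTopCongr Ψ (OrderIso.refl Prop)).dual.trans (semistarIso D₂ K₂).symm), fun s =>
    ⟨(OrderDual.ofDual (semistarIso D₁ K₁ s)).1.1, rfl, ?_⟩⟩
  rw [← semistarIso_apply]
  simp only [OrderIso.trans_apply, OrderIso.apply_symm_apply]
  rfl

end RootIso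

end Paper

namespace Paper

section Skeleton

variable {D : Type*} [CommRing D] [IsDomain D] {K : Type*} [Field K] [Algebra D K]
  [IsFractionRing D K]

local notation "α" => algebraMap D K

variable (K) in
/-- The intersection of the localizations at the maximal ideals above `Q`. -/
def aboveAlg (Q : Ideal D) : Subalgebra D K :=
  sInf {A | ∃ (N : Ideal D) (hN : N.IsMaximal), Q ≤ N ∧ A = locAt D K N hN.isPrime}

variable {ι : Type*} {e : ι → Ideal D}

variable (K) in
/-- The intersection of the rings `aboveAlg K (e i)` for `i ∈ S`. -/
def skelAlg (e : ι → Ideal D) (S : Set ι) : Subalgebra D K := ⨅ i ∈ S, aboveAlg K (e i)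

theorem skelAlg_empty : skelAlg K e ∅ = ⊤ := by simp [skelAlg]

theorem skelAlg_singleton (i : ι) : skelAlg K e {i} = aboveAlg K (e i) := by simp [skelAlg]

theorem skelAlg_anti {S S' : Set ι} (h : S ⊆ S') : skelAlg K e S' ≤ skelAlg K e S :=
  biInf_mono h

theorem one_mem_skelAlg (S : Set ι) : (1 : K) ∈ Subalgebra.toSubmodule (skelAlg K e S) :=
  (skelAlg K e S).one_mem

theorem one_submodule_ne_bot : (1 : Submodule D K) ≠ ⊥ := fun h =>
  one_ne_zero ((Submodule.mem_bot D).1 (h ▸ Submodule.one_le.1 le_rfl : (1 : K) ∈ _))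

theorem skelAlg_ne_bot (S : Set ι) : Subalgebra.toSubmodule (skelAlg K e S) ≠ ⊥ := fun h =>
  one_ne_zero ((Submodule.mem_bot D).1 (h ▸ one_mem_skelAlg S))

variable (hD : IsSemilocalPrufer D K) (he : IsChildEnum ⊥ e)
include hD

theorem mem_aboveAlg {Q : Ideal D} {x : K} : x ∈ aboveAlg K Q ↔ x ∈ loc (above Q) 1 := by
  simp only [aboveAlg, Algebra.mem_sInf, Set.mem_ofPred_eq]
  constructor
  · intro h
    refine mem_loc_of_forall (above_finite hD Q) above_prime fun N hN => ?_
    exact (mem_locAt hN.1.isPrime).1 (h _ ⟨N, hN.1, hN.2, rfl⟩)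
  · rintro h _ ⟨N, hN, hQN, rfl⟩
    exact (mem_locAt hN.isPrime).2 (loc_le_loc (avoid_anti
      (Set.singleton_subset_iff.2 (show N ∈ above Q from ⟨hN, hQN⟩))) _ h)

theorem exists_maximal_above (Q : Ideal D) (hQ : Q.IsPrime) : ∃ M, M ∈ above Q := by
  obtain ⟨M, hM, h⟩ := Ideal.exists_le_maximal Q hQ.ne_top
  exact ⟨M, hM, h⟩

theorem loc_above_one_ne_top {Q : Ideal D} (hQ : DirectlyBelow D ⊥ Q) :
    loc (above Q) (1 : Submodule D K) ≠ ⊤ := by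
  intro h
  obtain ⟨M, hM⟩ := exists_maximal_above hD Q hQ.2.1.1
  obtain ⟨d, hd, hd0⟩ := Submodule.exists_mem_ne_zero_of_ne_bot hQ.2.2.1.ne'
  have hd' : α d ≠ 0 := map_ne_zero_of_notMem (P := ⊥) hd0
  have hmem : (α d)⁻¹ ∈ loc (above Q) (1 : Submodule D K) := h ▸ Submodule.mem_top
  have := loc_le_loc (avoid_anti (Set.singleton_subset_iff.2 hM)) _ hmem
  exact inv_notMem_ringAt hM.1.isPrime ((map_mem_maxAt hM.1.isPrime).2 (hM.2 hd)) hd' this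

include he

theorem loc_mem_ZS_bot (i : ι) {I : Submodule D K} (hI : I ≠ ⊥) :
    loc (above (e i)) I ∈ ZS K ⊥ (e i) :=
  loc_mem_ZS hD Ideal.isPrime_bot (he.child i).2.1.1 bot_le (mem_XS_bot.2 hI)

theorem loc_skelAlg [Finite ι] (S : Set ι) (i : ι) :
    (i ∈ S → loc (above (e i)) (Subalgebra.toSubmodule (skelAlg K e S)) = loc (above (e i)) 1) ∧
    (i ∉ S → loc (above (e i)) (Subalgebra.toSubmodule (skelAlg K e S)) = ⊤) := by
  classical
  have : ∀ i, Fact (DirectlyBelow D ⊥ (e i)) := fun i => ⟨he.child i⟩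
  let z : ∀ i, ZS K ⊥ (e i) := fun i =>
    if i ∈ S then ⟨loc (above (e i)) 1, loc_mem_ZS_bot hD he i
      one_submodule_ne_bot⟩ else ⊤
  have hz : glue z = Subalgebra.toSubmodule (skelAlg K e S) := by
    ext x
    rw [mem_glue, ringAt_bot]
    simp only [Submodule.mem_top, true_and, Subalgebra.mem_toSubmodule, skelAlg, Algebra.mem_iInf,
      mem_aboveAlg hD]
    refine forall_congr' fun i => ?_
    by_cases hi : i ∈ S
    · simp [z, hi]
    · simp [z, hi, ZS_top_val, ringAt_bot]
  rw [← hz, loc_glue hD bot_mem_hiSpec he]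
  refine ⟨fun hi => by simp [z, hi], fun hi => by simp [z, hi, ZS_top_val, ringAt_bot]⟩

theorem loc_skelAlg_ne_top_iff [Finite ι] (S : Set ι) (i : ι) :
    loc (above (e i)) (Subalgebra.toSubmodule (skelAlg K e S)) ≠ ⊤ ↔ i ∈ S := by
  by_cases hi : i ∈ S
  · simp only [hi, iff_true, (loc_skelAlg hD he S i).1 hi]
    exact loc_above_one_ne_top hD (he.child i)
  · simp [hi, (loc_skelAlg hD he S i).2 hi]

theorem skelAlg_le_iff [Finite ι] {S S' : Set ι} :
    skelAlg K e S ≤ skelAlg K e S' ↔ S' ⊆ S := by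
  refine ⟨fun h i hi => ?_, skelAlg_anti⟩
  rw [← loc_skelAlg_ne_top_iff hD he] at hi ⊢
  exact fun htop => hi (eq_top_iff.2 (htop.ge.trans (loc_mono h)))

theorem mem_iff_forall_loc {I : Submodule D K} (hI : I ≠ ⊥) {x : K} :
    x ∈ I ↔ ∀ i, x ∈ loc (above (e i)) I := by
  refine ⟨fun h i => le_loc _ _ h, fun h => ?_⟩
  refine mem_of_forall_child hD bot_mem_hiSpec (mem_XS_bot.2 hI)
    (by rw [ringAt_bot]; exact Submodule.mem_top) fun Q hQ => ?_
  obtain ⟨i, rfl⟩ := he.surj Q hQ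
  exact h i

theorem skelAlg_univ : skelAlg K e Set.univ = ⊥ := by
  refine eq_bot_iff.2 fun x hx => ?_
  have : x ∈ (1 : Submodule D K) := by
    rw [mem_iff_forall_loc hD he one_submodule_ne_bot]
    simpa [skelAlg, Algebra.mem_iInf, mem_aboveAlg hD] using hx
  obtain ⟨a, rfl⟩ := Submodule.mem_one.1 this
  exact Subalgebra.algebraMap_mem _ a

theorem TOf_eq_aboveAlg {M : Ideal D} (hM : M.IsMaximal) {i : ι} (hi : e i ≤ M) :
    TOf D K M = aboveAlg K (e i) := by
  have key : ∀ N : Ideal D, N.IsMaximal → (Dependent D M N ↔ e i ≤ N) := by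
    intro N hN
    constructor
    · rintro ⟨P, hP, hP0, hPM, hPN⟩
      obtain ⟨Q, hQ, hQN⟩ := exists_directlyBelow hD bot_mem_hiSpec hN
        ((bot_lt_iff_ne_bot.2 hP0).trans_le hPN)
      by_cases h : e i = Q
      · rwa [h]
      · exact absurd (le_bot_iff.1 (le_of_le_children hD (he.child i) hQ h hP ⟨hM, hi⟩ ⟨hN, hQN⟩
          hPM hPN)) hP0
    · exact fun h => ⟨e i, (he.child i).2.1.1, (he.child i).2.2.1.ne', hi, h⟩
  refine congrArg sInf (Set.ext fun A => ?_)
  exact exists_congr fun N => exists_congr fun hN => and_congr_left fun _ => key N hN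

theorem TOf_of_isEmpty [IsEmpty ι] (M : Ideal D) : TOf D K M = ⊤ := by
  refine eq_top_iff.2 (le_sInf ?_)
  rintro _ ⟨N, hN, ⟨P, hP, hP0, hPM, hPN⟩, rfl⟩
  obtain ⟨Q, hQ, -⟩ := exists_directlyBelow hD bot_mem_hiSpec hN
    ((bot_lt_iff_ne_bot.2 hP0).trans_le hPN)
  obtain ⟨i, -⟩ := he.surj Q hQ
  exact isEmptyElim i

theorem exists_le_of_nonempty [hne : Nonempty ι] {M : Ideal D} (hM : M.IsMaximal) :
    ∃ i, e i ≤ M := by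
  have hM0 : M ≠ ⊥ := by
    rintro rfl
    obtain ⟨i⟩ := hne
    have hi := he.child i
    exact hi.2.1.1.ne_top (hM.1.2 _ hi.2.2.1)
  obtain ⟨Q, hQ, hQM⟩ := exists_directlyBelow hD bot_mem_hiSpec hM (bot_lt_iff_ne_bot.2 hM0)
  obtain ⟨i, rfl⟩ := he.surj Q hQ
  exact ⟨i, hQM⟩

theorem mem_stdDecomp_iff {A : Subalgebra D K} :
    A ∈ stdDecomp D K ↔ (∃ i, A = skelAlg K e {i}) ∨ IsEmpty ι ∧ A = skelAlg K e ∅ := by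
  simp only [skelAlg_singleton, skelAlg_empty]
  constructor
  · rintro ⟨M, hM, rfl⟩
    rcases isEmpty_or_nonempty ι with h | h
    · exact Or.inr ⟨h, TOf_of_isEmpty hD he M⟩
    · obtain ⟨i, hi⟩ := exists_le_of_nonempty hD he hM
      exact Or.inl ⟨i, TOf_eq_aboveAlg hD he hM hi⟩
  · rintro (⟨i, rfl⟩ | ⟨h, rfl⟩)
    · obtain ⟨M, hM⟩ := exists_maximal_above hD (e i) (he.child i).2.1.1
      exact ⟨M, hM.1, (TOf_eq_aboveAlg hD he hM.1 hM.2).symm⟩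
    · obtain ⟨M, hM⟩ := Ideal.exists_maximal D
      exact ⟨M, hM, (TOf_of_isEmpty hD he M).symm⟩

theorem mem_SkOver_iff {A : Subalgebra D K} : A ∈ SkOver D K ↔ ∃ S, skelAlg K e S = A := by
  constructor
  · rintro ⟨𝒮, h𝒮, rfl⟩
    refine ⟨{i | aboveAlg K (e i) ∈ 𝒮}, le_antisymm (le_sInf fun A hA => ?_)
      (le_iInf₂ fun i hi => sInf_le hi)⟩
    rcases (mem_stdDecomp_iff hD he).1 (h𝒮 hA) with ⟨i, rfl⟩ | ⟨-, rfl⟩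
    · rw [skelAlg_singleton] at hA ⊢
      exact iInf₂_le i hA
    · exact skelAlg_anti (Set.empty_subset _)
  · rintro ⟨S, rfl⟩
    refine ⟨(fun i => aboveAlg K (e i)) '' S, ?_, sInf_image.symm⟩
    rintro _ ⟨i, -, rfl⟩
    exact (mem_stdDecomp_iff hD he).2 (Or.inl ⟨i, (skelAlg_singleton i).symm⟩)

theorem skelAlg_injective [Finite ι] : Function.Injective (skelAlg K e) := fun _ _ h =>
  Set.Subset.antisymm ((skelAlg_le_iff hD he).1 h.ge) ((skelAlg_le_iff hD he).1 h.le)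

/-- The skeleton is anti-isomorphic to the power set of the index set. -/
def skelIso [Finite ι] : (Set ι)ᵒᵈ ≃o ↥(SkOver D K) where
  toEquiv := Equiv.ofBijective
    (fun S => ⟨skelAlg K e (OrderDual.ofDual S), (mem_SkOver_iff hD he).2 ⟨_, rfl⟩⟩)
    ⟨fun _ _ h => skelAlg_injective hD he (congrArg Subtype.val h), fun A => by
      obtain ⟨S, hS⟩ := (mem_SkOver_iff hD he).1 A.2
      exact ⟨OrderDual.toDual S, Subtype.ext hS⟩⟩
  map_rel_iff' := skelAlg_le_iff hD he

end Skeleton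

end Paper

namespace Paper

section Support

variable {D : Type*} [CommRing D] [IsDomain D] {K : Type*} [Field K] [Algebra D K]
  [IsFractionRing D K]

local notation "α" => algebraMap D K

theorem Semistar.toFun_sc (s : Semistar D K) {x : K} (hx : x ≠ 0) (I : Submodule D K) :
    s.toFun (sc x I) = sc x (s.toFun I) := s.smul' x hx I

theorem sc_le_iff_forall {d : K} {I J : Submodule D K} : sc d I ≤ J ↔ ∀ x ∈ I, d * x ∈ J := by
  refine ⟨fun h x hx => h (mul_mem_sc hx), fun h => ?_⟩
  rw [sc, Submodule.mul_le]
  intro m hm n hn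
  obtain ⟨a, rfl⟩ := Submodule.mem_span_singleton.1 hm
  rw [smul_mul_assoc]
  exact J.smul_mem a (h n hn)

theorem isFracOf_iff {A : Subalgebra D K} {I : Submodule D K} : IsFracOf D K A I ↔
    (∀ a ∈ A, ∀ x ∈ I, a * x ∈ I) ∧ ∃ d : K, d ≠ 0 ∧ sc d I ≤ Subalgebra.toSubmodule A := by
  simp only [sc_le_iff_forall]; rfl

theorem Semistar.mul_mem (s : Semistar D K) (A : Subalgebra D K) {a x : K} (ha : a ∈ A)
    (hx : x ∈ s.toFun (Subalgebra.toSubmodule A)) :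
    a * x ∈ s.toFun (Subalgebra.toSubmodule A) := by
  rcases eq_or_ne a 0 with rfl | h0
  · rw [zero_mul]; exact zero_mem _
  · have h := s.mono' (sc_le_iff_forall.2 fun y hy => A.mul_mem ha hy :
      sc a (Subalgebra.toSubmodule A) ≤ Subalgebra.toSubmodule A)
    rw [s.toFun_sc h0] at h
    exact h (mul_mem_sc hx)

variable {ι : Type*} {e : ι → Ideal D} (hD : IsSemilocalPrufer D K) (he : IsChildEnum ⊥ e)
include hD he

theorem exists_sc_le_skelAlg [Finite ι] {I : Submodule D K} (hI : I ≠ ⊥) {S : Set ι}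
    (hS : ∀ i ∈ S, loc (above (e i)) I ≠ ⊤) :
    ∃ d : K, d ≠ 0 ∧ sc d I ≤ Subalgebra.toSubmodule (skelAlg K e S) := by
  classical
  have := Fintype.ofFinite ι
  have h1 : ∀ i, ∃ c : D, c ≠ 0 ∧ (i ∈ S → ∀ y ∈ I, c • y ∈ loc (above (e i)) (1 : Submodule D K)) := by
    intro i
    by_cases hi : i ∈ S
    · obtain ⟨c, hc, h⟩ := exists_smul_le hD (he.child i).2.1.1 Ideal.isPrime_bot
        (he.child i).2.2.1 (loc_mem_ZS_bot hD he i one_submodule_ne_bot) (loc_mem_ZS_bot hD he i hI)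
        (by rw [ringAt_bot]; exact hS i hi)
      exact ⟨c, hc, fun _ y hy => h y (le_loc _ _ hy)⟩
    · exact ⟨1, one_ne_zero, fun h => (hi h).elim⟩
  choose c hc hcI using h1
  refine ⟨α (∏ i, c i), ?_, sc_le_iff_forall.2 fun y hy => ?_⟩
  · exact map_ne_zero_of_notMem (P := ⊥) (Finset.prod_ne_zero_iff.2 fun i _ => hc i)
  · simp only [skelAlg, Subalgebra.mem_toSubmodule, Algebra.mem_iInf, mem_aboveAlg hD]
    intro i hi
    rw [← Finset.prod_erase_mul _ _ (Finset.mem_univ i), ← Algebra.smul_def, mul_smul]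
    exact Submodule.smul_mem _ _ (hcI i hi y hy)

theorem skelAlg_le_of_one_mem {I : Submodule D K} (h1 : (1 : K) ∈ I) {S : Set ι}
    (hS : ∀ i ∉ S, loc (above (e i)) I = ⊤) : Subalgebra.toSubmodule (skelAlg K e S) ≤ I := by
  intro x hx
  have hI : I ≠ ⊥ := fun h => one_ne_zero ((Submodule.mem_bot D).1 (h ▸ h1))
  rw [mem_iff_forall_loc hD he hI]
  intro i
  by_cases hi : i ∈ S
  · simp only [skelAlg, Subalgebra.mem_toSubmodule, Algebra.mem_iInf, mem_aboveAlg hD] at hx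
    exact loc_mono (Submodule.one_le.2 h1) (hx i hi)
  · rw [hS i hi]; exact Submodule.mem_top

theorem isFracOf_skelAlg_iff [Finite ι] (s : Semistar D K) (S : Set ι) :
    IsFracOf D K (skelAlg K e S) (s.toFun (Subalgebra.toSubmodule (skelAlg K e S))) ↔
      S ∈ suppAt K ⊥ e (s.closed \ {⊥}) := by
  simp only [suppAt, Set.mem_ofPred_eq, ringAt_bot, isFracOf_iff]
  constructor
  · rintro ⟨-, d, hd, hdI⟩
    refine ⟨s.toFun (Subalgebra.toSubmodule (skelAlg K e S)), ⟨s.toFun_mem_closed _, fun h => ?_⟩, ?_⟩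
    · exact skelAlg_ne_bot S (le_bot_iff.1 ((s.le_star' _).trans_eq h))
    · ext i
      rw [← loc_skelAlg_ne_top_iff hD he S i]
      refine not_congr ⟨fun h => ?_, fun h => eq_top_iff.2 (h.ge.trans (loc_mono (s.le_star' _)))⟩
      have := loc_mono (W := above (e i)) hdI
      rw [loc_sc hd, h, sc_top hd] at this
      exact top_le_iff.1 this
  · rintro ⟨I, ⟨hI, hI0⟩, rfl⟩
    refine ⟨fun a ha x hx => s.mul_mem _ ha hx, ?_⟩
    obtain ⟨x, hx, hx0⟩ := Submodule.exists_mem_ne_zero_of_ne_bot hI0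
    have hle := skelAlg_le_of_one_mem hD he (I := sc x⁻¹ I) (S := {i | loc (above (e i)) I ≠ ⊤})
      (inv_mul_cancel₀ hx0 ▸ mul_mem_sc hx) (fun i hi => by
        rw [loc_sc (inv_ne_zero hx0), not_not.1 hi, sc_top (inv_ne_zero hx0)])
    obtain ⟨d, hd, h⟩ := exists_sc_le_skelAlg hD he hI0
      (S := {i | loc (above (e i)) I ≠ ⊤}) fun i hi => hi
    have h2 := s.mono' hle
    rw [s.toFun_sc (inv_ne_zero hx0), show s.toFun I = I from hI] at h2
    refine ⟨d * x, mul_ne_zero hd hx0, le_trans ?_ h⟩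
    rw [← sc_sc]
    exact sc_mono d ((sc_le_iff hx0).2 h2)

theorem supp_eq_image [Finite ι] (s : Semistar D K) :
    supp D K s = skelAlg K e '' suppAt K ⊥ e (s.closed \ {⊥}) := by
  ext A
  simp only [supp, Set.mem_ofPred_eq, mem_SkOver_iff hD he]
  constructor
  · rintro ⟨⟨S, rfl⟩, h⟩
    exact ⟨S, (isFracOf_skelAlg_iff hD he s S).1 h, rfl⟩
  · rintro ⟨S, hS, rfl⟩
    exact ⟨⟨S, rfl⟩, (isFracOf_skelAlg_iff hD he s S).2 hS⟩

end Support

section Fractional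

variable {D : Type*} [CommRing D] [IsDomain D] {K : Type*} [Field K] [Algebra D K]
  [IsFractionRing D K]

theorem isFracOf_bot_iff {I : Submodule D K} :
    IsFracOf D K ⊥ I ↔ ∃ d : K, d ≠ 0 ∧ sc d I ≤ Subalgebra.toSubmodule ⊥ := by
  rw [isFracOf_iff, and_iff_right]
  rintro a ha x hx
  obtain ⟨r, rfl⟩ := Algebra.mem_bot.1 ha
  rw [← Algebra.smul_def]
  exact I.smul_mem r hx

theorem IsFracOf.mono {I J : Submodule D K} (hJ : IsFracOf D K ⊥ J) (h : I ≤ J) :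
    IsFracOf D K ⊥ I := by
  rw [isFracOf_bot_iff] at *
  obtain ⟨d, hd, hdJ⟩ := hJ
  exact ⟨d, hd, (sc_mono d h).trans hdJ⟩

theorem isFracOf_sc_iff {x : K} (hx : x ≠ 0) {I : Submodule D K} :
    IsFracOf D K ⊥ (sc x I) ↔ IsFracOf D K ⊥ I := by
  have key : ∀ (x : K), x ≠ 0 → ∀ I : Submodule D K, IsFracOf D K ⊥ I → IsFracOf D K ⊥ (sc x I) := by
    intro x hx I hI
    rw [isFracOf_bot_iff] at *
    obtain ⟨d, hd, hdJ⟩ := hI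
    exact ⟨d * x⁻¹, mul_ne_zero hd (inv_ne_zero hx), by rw [← sc_sc, sc_inv_sc hx]; exact hdJ⟩
  refine ⟨fun h => ?_, key x hx I⟩
  have := key x⁻¹ (inv_ne_zero hx) _ h
  rwa [sc_inv_sc hx] at this

theorem isFracOf_bot_self : IsFracOf D K ⊥ (Subalgebra.toSubmodule ⊥) :=
  isFracOf_bot_iff.2 ⟨1, one_ne_zero, (sc_one _).le⟩

open Classical in
/-- The extension of a fractional star operation that sends all other modules to `K`. -/
def FracStar.extend (f : FracStar D K ⊥) : Semistar D K where
  toFun I := if h : IsFracOf D K ⊥ I then (f.toFun ⟨I, h⟩).1 else ⊤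
  le_star' I := by
    split_ifs with h
    · exact f.le_star' ⟨I, h⟩
    · exact le_top
  mono' I J hIJ := by
    split_ifs with h h'
    · exact f.mono' _ _ hIJ
    · exact le_top
    · exact absurd (IsFracOf.mono ‹_› hIJ) h
    · exact le_rfl
  idem' I := by
    by_cases h : IsFracOf D K ⊥ I
    · simp only [dif_pos h, dif_pos (f.toFun ⟨I, h⟩).2]
      exact congrArg Subtype.val (f.idem' ⟨I, h⟩)
    · simp only [dif_neg h]
      rw [dif_neg fun h' => h (IsFracOf.mono h' le_top)]
  smul' x hx I := by
    by_cases h : IsFracOf D K ⊥ I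
    · have h' : IsFracOf D K ⊥ (sc x I) := (isFracOf_sc_iff hx).2 h
      rw [dif_pos h, dif_pos h']
      exact f.smul' x hx ⟨I, h⟩ ⟨_, h'⟩ rfl
    · have h' : ¬ IsFracOf D K ⊥ (sc x I) := fun h' => h ((isFracOf_sc_iff hx).1 h')
      rw [dif_neg h, dif_neg h']
      exact (sc_top hx).symm

theorem FracStar.extend_apply (f : FracStar D K ⊥) (I : {I : Submodule D K // IsFracOf D K ⊥ I}) :
    f.extend.toFun I.1 = (f.toFun I).1 := dif_pos I.2

theorem FracStar.extend_of_not (f : FracStar D K ⊥) {I : Submodule D K}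
    (h : ¬ IsFracOf D K ⊥ I) : f.extend.toFun I = ⊤ := dif_neg h

theorem Semistar.isFracOf_toFun (s : Semistar D K)
    (hs : IsFracOf D K ⊥ (s.toFun (Subalgebra.toSubmodule ⊥))) {I : Submodule D K}
    (hI : IsFracOf D K ⊥ I) : IsFracOf D K ⊥ (s.toFun I) := by
  obtain ⟨d, hd, h⟩ := isFracOf_bot_iff.1 hI
  have := s.mono' h
  rw [s.toFun_sc hd] at this
  exact (isFracOf_sc_iff hd).1 (hs.mono this)

/-- The restriction of a semistar operation to fractional ideals. -/
def Semistar.restrict (s : Semistar D K)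
    (hs : IsFracOf D K ⊥ (s.toFun (Subalgebra.toSubmodule ⊥))) : FracStar D K ⊥ where
  toFun I := ⟨s.toFun I.1, s.isFracOf_toFun hs I.2⟩
  le_star' I := s.le_star' I.1
  mono' _ _ h := s.mono' h
  idem' I := Subtype.ext (s.idem' I.1)
  smul' x hx I J h := by
    change s.toFun J.1 = _
    rw [h]; exact s.smul' x hx I.1

variable {ι : Type*} [Finite ι] {e : ι → Ideal D} (hD : IsSemilocalPrufer D K)
  (he : IsChildEnum ⊥ e)
include hD he

theorem suppAt_extend (f : FracStar D K ⊥) :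
    suppAt K ⊥ e (f.extend.closed \ {⊥}) = {Set.univ, ∅} := by
  ext S
  rw [← isFracOf_skelAlg_iff hD he, Set.mem_insert_iff, Set.mem_singleton_iff]
  constructor
  · intro h
    by_cases hS : IsFracOf D K ⊥ (Subalgebra.toSubmodule (skelAlg K e S))
    · left
      obtain ⟨d, hd, h⟩ := isFracOf_bot_iff.1 hS
      refine Set.eq_univ_of_forall fun i => ?_
      rw [← loc_skelAlg_ne_top_iff hD he S i]
      intro htop
      have := loc_mono (W := above (e i)) h
      rw [loc_sc hd, htop, sc_top hd, ← skelAlg_univ hD he, top_le_iff] at this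
      exact (loc_skelAlg_ne_top_iff hD he Set.univ i).2 trivial this
    · right
      rw [f.extend_of_not hS] at h
      obtain ⟨d, hd, h⟩ := (isFracOf_iff.1 h).2
      rw [sc_top hd, top_le_iff, Algebra.toSubmodule_eq_top, ← skelAlg_empty (e := e)] at h
      exact skelAlg_injective hD he h
  · rintro (rfl | rfl)
    · rw [skelAlg_univ hD he, f.extend_apply ⟨_, isFracOf_bot_self⟩]
      exact Subtype.prop _
    · rw [skelAlg_empty, isFracOf_iff]
      refine ⟨fun a ha x hx => f.extend.mul_mem _ ha hx, 1, one_ne_zero, ?_⟩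
      rw [Algebra.top_toSubmodule]; exact le_top

theorem isFracOf_toFun_bot {s : Semistar D K}
    (hs : suppAt K ⊥ e (s.closed \ {⊥}) = {Set.univ, ∅}) :
    IsFracOf D K ⊥ (s.toFun (Subalgebra.toSubmodule ⊥)) := by
  rw [← skelAlg_univ hD he, isFracOf_skelAlg_iff hD he, hs]
  exact Or.inl rfl

theorem toFun_eq_top_of_suppAt {s : Semistar D K}
    (hs : suppAt K ⊥ e (s.closed \ {⊥}) = {Set.univ, ∅}) {I : Submodule D K}
    (hI : ¬ IsFracOf D K ⊥ I) : s.toFun I = ⊤ := by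
  have hI0 : s.toFun I ≠ ⊥ := by
    intro h
    refine hI (isFracOf_bot_iff.2 ⟨1, one_ne_zero, ?_⟩)
    rw [sc_one, le_bot_iff.1 ((s.le_star' I).trans_eq h)]
    exact bot_le
  have hmem : {i | loc (above (e i)) (s.toFun I) ≠ ⊤} ∈ suppAt K ⊥ e (s.closed \ {⊥}) :=
    ⟨s.toFun I, ⟨s.toFun_mem_closed I, hI0⟩, by rw [ringAt_bot]⟩
  rw [hs] at hmem
  rcases hmem with h | h
  · obtain ⟨d, hd, hle⟩ := exists_sc_le_skelAlg hD he hI0 (S := Set.univ) fun i _ =>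
      (Set.eq_univ_iff_forall.1 h i : _)
    rw [skelAlg_univ hD he] at hle
    exact absurd ((isFracOf_bot_iff.2 ⟨d, hd, hle⟩ : IsFracOf D K ⊥ (s.toFun I)).mono
      (s.le_star' I)) hI
  · refine eq_top_iff.2 fun x _ => ?_
    rw [mem_iff_forall_loc hD he hI0]
    intro i
    have hi : ¬ loc (above (e i)) (s.toFun I) ≠ ⊤ := Set.eq_empty_iff_forall_notMem.1 h i
    rw [not_not.1 hi]; exact Submodule.mem_top

/-- Fractional star operations are the semistar operations with the smallest support
containing `⊥`. -/
def fracStarIso : FracStar D K ⊥ ≃o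
    {s : Semistar D K // suppAt K ⊥ e (s.closed \ {⊥}) = {Set.univ, ∅}} where
  toFun f := ⟨f.extend, suppAt_extend hD he f⟩
  invFun s := s.1.restrict (isFracOf_toFun_bot hD he s.2)
  left_inv f := FracStar.ext' (funext fun I => Subtype.ext (f.extend_apply I))
  right_inv s := by
    refine Subtype.ext (Semistar.ext' (funext fun I => ?_))
    by_cases h : IsFracOf D K ⊥ I
    · exact FracStar.extend_apply _ ⟨I, h⟩
    · exact (FracStar.extend_of_not _ h).trans (toFun_eq_top_of_suppAt hD he s.2 h).symm
  map_rel_iff' := by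
    intro f g
    constructor
    · intro h I
      have : f.extend.toFun I.1 ≤ g.extend.toFun I.1 := h I.1
      rwa [f.extend_apply, g.extend_apply] at this
    · intro h I
      change f.extend.toFun I ≤ g.extend.toFun I
      by_cases hI : IsFracOf D K ⊥ I
      · rw [f.extend_apply ⟨I, hI⟩, g.extend_apply ⟨I, hI⟩]; exact h _
      · rw [g.extend_of_not hI]; exact le_top

end Fractional

end Paper

namespace Paper

section Comparison

variable {D₁ : Type*} [CommRing D₁] [IsDomain D₁] {K₁ : Type*} [Field K₁] [Algebra D₁ K₁]
  [IsFractionRing D₁ K₁] {D₂ : Type*} [CommRing D₂] [IsDomain D₂] {K₂ : Type*} [Field K₂]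
  [Algebra D₂ K₂] [IsFractionRing D₂ K₂]

theorem map_bot_hiSpec (ν : ↥(hiSpec D₁) ≃o ↥(hiSpec D₂)) : (ν ⟨⊥, bot_mem_hiSpec⟩).1 = ⊥ := by
  refine le_bot_iff.1 ?_
  have : ν ⟨⊥, bot_mem_hiSpec⟩ ≤ ⟨⊥, bot_mem_hiSpec⟩ := by
    rw [← ν.le_symm_apply]
    exact (bot_le : (⊥ : Ideal D₁) ≤ _)
  exact this

variable {ι : Type*} [Finite ι] {e : ι → Ideal D₁} {e' : ι → Ideal D₂}

theorem exists_orderIsos_of_root (hD₁ : IsSemilocalPrufer D₁ K₁) (hD₂ : IsSemilocalPrufer D₂ K₂)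
    (he : IsChildEnum ⊥ e) (he' : IsChildEnum ⊥ e')
    (h : ∃ Ψ : SS K₁ (⊥ : Ideal D₁) ≃o SS K₂ (⊥ : Ideal D₂), ∀ C,
      suppAt K₂ ⊥ e' (Ψ C).1 = suppAt K₁ ⊥ e C.1) :
    ∃ (bnu : Semistar D₁ K₁ ≃o Semistar D₂ K₂)
      (_ : FracStar D₁ K₁ ⊥ ≃o FracStar D₂ K₂ ⊥)
      (νbar : ↥(SkOver D₁ K₁) ≃o ↥(SkOver D₂ K₂)),
      (∀ T : ↥(SkOver D₁ K₁), T.1 ∈ stdDecomp D₁ K₁ ↔ (νbar T).1 ∈ stdDecomp D₂ K₂) ∧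
      ∀ Δ : Set (Subalgebra D₁ K₁), Δ ⊆ SkOver D₁ K₁ →
        (⇑bnu) '' {s | supp D₁ K₁ s = Δ} =
          {s | supp D₂ K₂ s =
            (fun A : ↥(SkOver D₁ K₁) => (νbar A).1) '' {A | A.1 ∈ Δ}} := by
  obtain ⟨Ψ, hΨ⟩ := h
  obtain ⟨b, hb⟩ := exists_semistar_orderIso Ψ
  have hbs : ∀ s, suppAt K₂ ⊥ e' ((b s).closed \ {⊥}) = suppAt K₁ ⊥ e (s.closed \ {⊥}) := by
    intro s
    obtain ⟨C, h1, h2⟩ := hb s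
    rw [h1, h2, hΨ]
  let bF : {s : Semistar D₁ K₁ // suppAt K₁ ⊥ e (s.closed \ {⊥}) = {Set.univ, ∅}} ≃o
      {s : Semistar D₂ K₂ // suppAt K₂ ⊥ e' (s.closed \ {⊥}) = {Set.univ, ∅}} :=
    { b.toEquiv.subtypeEquiv fun s => by
        change _ ↔ suppAt K₂ ⊥ e' ((b s).closed \ {⊥}) = _
        rw [hbs] with
      map_rel_iff' := b.le_iff_le }
  let νbar := (skelIso hD₁ he).symm.trans (skelIso hD₂ he')
  have hν : ∀ S, (νbar (skelIso hD₁ he S)).1 = skelAlg K₂ e' (OrderDual.ofDual S) := by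
    intro S
    simp only [νbar, OrderIso.trans_apply, OrderIso.symm_apply_apply]
    rfl
  refine ⟨b, (fracStarIso hD₁ he).trans (bF.trans (fracStarIso hD₂ he').symm), νbar, ?_, ?_⟩
  · intro T
    obtain ⟨S, rfl⟩ := (skelIso hD₁ he).surjective T
    rw [hν, mem_stdDecomp_iff hD₁ he, mem_stdDecomp_iff hD₂ he']
    change (∃ i, skelAlg K₁ e (OrderDual.ofDual S) = _) ∨
      _ ∧ skelAlg K₁ e (OrderDual.ofDual S) = _ ↔ _
    simp only [(skelAlg_injective hD₁ he).eq_iff, (skelAlg_injective hD₂ he').eq_iff]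
  · intro Δ hΔ
    have key : ∀ s, supp D₂ K₂ (b s) =
        (fun A : ↥(SkOver D₁ K₁) => (νbar A).1) '' {A | A.1 ∈ supp D₁ K₁ s} := by
      intro s
      rw [supp_eq_image hD₂ he', supp_eq_image hD₁ he, hbs]
      ext A
      constructor
      · rintro ⟨S, hS, rfl⟩
        exact ⟨skelIso hD₁ he (OrderDual.toDual S), ⟨S, hS, rfl⟩, hν _⟩
      · rintro ⟨T, ⟨S, hS, hT⟩, rfl⟩
        obtain rfl : skelIso hD₁ he (OrderDual.toDual S) = T := Subtype.ext hT
        exact ⟨S, hS, (hν _).symm⟩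
    have hinj : Function.Injective fun A : ↥(SkOver D₁ K₁) => (νbar A).1 :=
      Subtype.val_injective.comp νbar.injective
    ext t
    obtain ⟨s, rfl⟩ := b.surjective t
    rw [b.injective.mem_set_image, Set.mem_ofPred_eq, Set.mem_ofPred_eq, key,
      hinj.image_injective.eq_iff]
    refine ⟨fun h => by rw [h], fun h => ?_⟩
    ext A
    constructor
    · exact fun hA => ((Set.ext_iff.1 h ⟨A, hA.1⟩).1 hA : _)
    · exact fun hA => ((Set.ext_iff.1 h ⟨A, hΔ hA⟩).2 hA : _)

end Comparison

end Paper

namespace Paper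

/-- (Finite-dimensional case.) If `ν : hiSpec(D₁) → hiSpec(D₂)` is
an order isomorphism with `ω(P) = ω(ν(P))` for every `P`, then there are order
isomorphisms `𝛎 : SStar(D₁) → SStar(D₂)` and `𝛎_F : FStar(D₁) → FStar(D₂)` with `𝛎`
carrying the semistar operations of support `Δ` onto those of support `ν̄(Δ)`, for
every `Δ ⊆ SkOver(D₁)` closed under intersections. -/
theorem statement14
    (D₁ : Type*) [CommRing D₁] [IsDomain D₁]
    (K₁ : Type*) [Field K₁] [Algebra D₁ K₁] [IsFractionRing D₁ K₁]
    (D₂ : Type*) [CommRing D₂] [IsDomain D₂]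
    (K₂ : Type*) [Field K₂] [Algebra D₂ K₂] [IsFractionRing D₂ K₂]
    (hp₁ : IsPrufer D₁ K₁) (hsl₁ : IsSemilocal D₁) (hdim₁ : ringKrullDim D₁ < ⊤)
    (hp₂ : IsPrufer D₂ K₂) (hsl₂ : IsSemilocal D₂) (hdim₂ : ringKrullDim D₂ < ⊤)
    (ν : ↥(hiSpec D₁) ≃o ↥(hiSpec D₂))
    (hω : ∀ P Q : ↥(hiSpec D₁), DirectlyBelow D₁ Q.1 P.1 →
      omegaAt D₁ P.1 Q.1 (mem_hiSpec_prime P.2) =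
        omegaAt D₂ (ν P).1 (ν Q).1 (mem_hiSpec_prime (ν P).2)) :
    ∃ (bnu : Semistar D₁ K₁ ≃o Semistar D₂ K₂)
      (_ : FracStar D₁ K₁ ⊥ ≃o FracStar D₂ K₂ ⊥)
      (νbar : ↥(SkOver D₁ K₁) ≃o ↥(SkOver D₂ K₂)),
      (∀ T : ↥(SkOver D₁ K₁), T.1 ∈ stdDecomp D₁ K₁ ↔ (νbar T).1 ∈ stdDecomp D₂ K₂) ∧
      ∀ Δ : Set (Subalgebra D₁ K₁), Δ ⊆ SkOver D₁ K₁ →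
        (∀ A ∈ Δ, ∀ B ∈ Δ, A ⊓ B ∈ Δ) →
        (⇑bnu) '' {s | supp D₁ K₁ s = Δ} =
          {s | supp D₂ K₂ s =
            (fun A : ↥(SkOver D₁ K₁) => (νbar A).1) '' {A | A.1 ∈ Δ}} := by
  have hD₁ : IsSemilocalPrufer D₁ K₁ := ⟨hp₁, hsl₁, hdim₁⟩
  have hD₂ : IsSemilocalPrufer D₂ K₂ := ⟨hp₂, hsl₂, hdim₂⟩
  have := finite_childIndex hD₁ ⟨⊥, bot_mem_hiSpec⟩
  have h := exists_SS_orderIso hD₁ hD₂ ν hω ⟨⊥, bot_mem_hiSpec⟩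
  have he' := isChildEnum_orderIso ν ⟨⊥, bot_mem_hiSpec⟩
  rw [map_bot_hiSpec] at h he'
  obtain ⟨b, f, νbar, hν, hb⟩ :=
    exists_orderIsos_of_root hD₁ hD₂ (isChildEnum_subtype ⟨⊥, bot_mem_hiSpec⟩) he' h
  exact ⟨b, f, νbar, hν, fun Δ hΔ _ => hb Δ hΔ⟩

end Paper
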